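/- There exists an absolute constant ε₀ > 0 with the following property: let (v,p) be a suitable weak solution of the Navier–Stokes equations in Q_T = Ω×(0,T), let z₀ = (x₀,t₀) ∈ Q_T and r > 0 be such that the closure of Q_{z₀,r} is contained in Q_T, and let ω = curl v be the vorticity of v. If ‖v × (ω/|ω|)‖_{L^{3,∞}_{x,t}(Q_{z₀,r})} ≤ ε₀, then z₀ is a regular point of v. -/

import Mathlib

open MeasureTheory Set Filter ENNReal

noncomputable section

/-- Euclidean 3-space. -/
abbrev E3 := EuclideanSpace ℝ (Fin 3)

/-- The parabolic cylinder `Q_{z,r} = B_{x,r} × (t - r², t)`. -/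
def pcyl (z : E3 × ℝ) (r : ℝ) : Set (E3 × ℝ) :=
  (Metric.ball z.1 r) ×ˢ (Ioo (z.2 - r ^ 2) z.2)

/-- The mixed space-time norm `‖f‖_{L^{γ,α}_{x,t}(B × (a,b))}`,
with the essential-supremum modification when an exponent is `∞`. -/
def mixedNorm {F : Type*} [NormedAddCommGroup F]
    (f : E3 × ℝ → F) (B : Set E3) (a b : ℝ) (γ α : ℝ≥0∞) : ℝ≥0∞ :=
  if α = ∞ then
    essSup (fun t => eLpNorm (fun x => f (x, t)) γ (volume.restrict B))
      (volume.restrict (Ioo a b))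
  else
    (∫⁻ t in Ioo a b,
      (eLpNorm (fun x => f (x, t)) γ (volume.restrict B)) ^ α.toReal) ^ (1 / α.toReal)

/-- `f ∈ L^{γ,α}_{x,t}(B × (a,b))`. -/
def MemMixed {F : Type*} [NormedAddCommGroup F]
    (f : E3 × ℝ → F) (B : Set E3) (a b : ℝ) (γ α : ℝ≥0∞) : Prop :=
  mixedNorm f B a b γ α < ∞

/-- Vector in `ℝ³` from coordinates. -/
def vec3 (a b c : ℝ) : E3 := (WithLp.equiv 2 (Fin 3 → ℝ)).symm ![a, b, c]

/-- Cross product in `ℝ³`. -/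
def cross3 (u w : E3) : E3 :=
  vec3 (u 1 * w 2 - u 2 * w 1) (u 2 * w 0 - u 0 * w 2) (u 0 * w 1 - u 1 * w 0)

/-- The unit direction `w/|w|`, interpreted as `0` when `w = 0`. -/
def unitd (w : E3) : E3 := ‖w‖⁻¹ • w

/-- Spatial partial derivative (in direction `i`) of a function on space-time. -/
def sdz {F : Type*} [NormedAddCommGroup F] [NormedSpace ℝ F]
    (φ : E3 × ℝ → F) (i : Fin 3) (z : E3 × ℝ) : F :=
  fderiv ℝ φ z (EuclideanSpace.single i 1, 0)

/-- Time derivative of a function on space-time. -/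
def tdz {F : Type*} [NormedAddCommGroup F] [NormedSpace ℝ F]
    (φ : E3 × ℝ → F) (z : E3 × ℝ) : F :=
  fderiv ℝ φ z (0, 1)

/-- The vorticity `ω = curl v` built from the (weak) velocity gradient
`Dv`, where `Dv z j i` represents `∂_j v_i (z)`. -/
def curlOf (Dv : E3 × ℝ → Fin 3 → Fin 3 → ℝ) (z : E3 × ℝ) : E3 :=
  vec3 (Dv z 1 2 - Dv z 2 1) (Dv z 2 0 - Dv z 0 2) (Dv z 0 1 - Dv z 1 0)

/-- A `3×3` matrix regarded as a Euclidean vector (so that its norm is the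
Frobenius norm). -/
def frob (M : Fin 3 → Fin 3 → ℝ) : EuclideanSpace ℝ (Fin 3 × Fin 3) :=
  (WithLp.equiv 2 (Fin 3 × Fin 3 → ℝ)).symm fun q => M q.1 q.2

/-- `(v, p)` is a suitable weak solution of the Navier–Stokes equations on
`Q_T = Ω × (0,T)`, with weak spatial gradient `Dv` (`Dv z j i = ∂_j v_i (z)`)
and initial data `v₀`. -/
structure IsSuitableWeakSolution (Ω : Set E3) (T : ℝ) (v : E3 × ℝ → E3)
    (Dv : E3 × ℝ → Fin 3 → Fin 3 → ℝ) (p : E3 × ℝ → ℝ) (v₀ : E3 → E3) : Prop where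
  meas_v : Measurable v
  meas_Dv : Measurable Dv
  meas_p : Measurable p
  /-- `Dv` is the weak spatial gradient of `v`. -/
  weak_grad : ∀ ψ : E3 → ℝ, ContDiff ℝ (⊤ : ℕ∞) ψ → HasCompactSupport ψ → tsupport ψ ⊆ Ω →
    ∀ᵐ t ∂(volume.restrict (Ioo 0 T)), ∀ i j : Fin 3,
      ∫ x in Ω, v (x, t) j * fderiv ℝ ψ x (EuclideanSpace.single i 1) =
        - ∫ x in Ω, Dv (x, t) i j * ψ x
  /-- `v ∈ L^∞(0,T;L²(Ω))`. -/
  v_linf_l2 : MemMixed v Ω 0 T 2 ∞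
  /-- `v ∈ L²(0,T;W^{1,2}(Ω))`. -/
  v_l2_w12 : IntegrableOn (fun z => ‖v z‖ ^ 2 + ∑ i, ∑ j, (Dv z i j) ^ 2) (Ω ×ˢ Ioo 0 T)
  /-- `p ∈ L^{3/2}(Q_T)`. -/
  p_l32 : IntegrableOn (fun z => |p z| ^ (3 / 2 : ℝ)) (Ω ×ˢ Ioo 0 T)
  /-- The weak form of the Navier–Stokes equations. -/
  weak_nse : ∀ φ : E3 × ℝ → E3, ContDiff ℝ (⊤ : ℕ∞) φ → HasCompactSupport φ →
    tsupport φ ⊆ Ω ×ˢ Iio T →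
    ∫ z in Ω ×ˢ Ioo 0 T,
        (-(∑ i, v z i * tdz φ z i) + (∑ i, ∑ j, v z j * Dv z j i * φ z i)
          + (∑ i, ∑ j, Dv z j i * sdz φ j z i) - p z * ∑ i, sdz φ i z i)
      = ∫ x in Ω, ∑ i, v₀ x i * φ (x, 0) i
  /-- `div v = 0` weakly. -/
  div_free : ∀ ψ : E3 × ℝ → ℝ, ContDiff ℝ (⊤ : ℕ∞) ψ → HasCompactSupport ψ →
    tsupport ψ ⊆ Ω ×ˢ Ioo 0 T →
    ∫ z in Ω ×ˢ Ioo 0 T, ∑ i, v z i * sdz ψ i z = 0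
  /-- The local energy inequality. -/
  local_energy : ∀ᵐ t ∂(volume.restrict (Ioo 0 T)), ∀ φ : E3 × ℝ → ℝ,
    ContDiff ℝ (⊤ : ℕ∞) φ → HasCompactSupport φ → tsupport φ ⊆ Ω ×ˢ Ioo 0 T → (∀ z, 0 ≤ φ z) →
    (∫ x in Ω, ‖v (x, t)‖ ^ 2 * φ (x, t))
        + 2 * ∫ z in Ω ×ˢ Ioo 0 t, (∑ i, ∑ j, (Dv z i j) ^ 2) * φ z
      ≤ ∫ z in Ω ×ˢ Ioo 0 t,
          (‖v z‖ ^ 2 * (tdz φ z + ∑ i, sdz (fun w => sdz φ i w) i z)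
            + (‖v z‖ ^ 2 + 2 * p z) * ∑ i, v z i * sdz φ i z)

/-- `z` is a regular point of `v`: `v` is essentially bounded on some parabolic
cylinder `Q_{z,r} ⊆ Q_T`. -/
def RegularPoint (Ω : Set E3) (T : ℝ) (v : E3 × ℝ → E3) (z : E3 × ℝ) : Prop :=
  ∃ r > 0, pcyl z r ⊆ Ω ×ˢ Ioo 0 T ∧
    ∃ M : ℝ, ∀ᵐ w ∂(volume.restrict (pcyl z r)), ‖v w‖ ≤ M

/-- `z` is a singular point of `v` in `Q_T`. -/
def SingularPoint (Ω : Set E3) (T : ℝ) (v : E3 × ℝ → E3) (z : E3 × ℝ) : Prop :=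
  z ∈ Ω ×ˢ Ioo 0 T ∧ ¬ RegularPoint Ω T v z


set_option linter.unusedSectionVars false
set_option autoImplicit false

abbrev X4 := E3 × ℝ

def ex (i : Fin 3) : X4 := (EuclideanSpace.single i 1, 0)
def et : X4 := (0, 1)

instance : (volume : Measure X4).IsAddHaarMeasure :=
  inferInstanceAs ((volume : Measure E3).prod (volume : Measure ℝ)).IsAddHaarMeasure

section gen
variable {E : Type*} [NormedAddCommGroup E] [NormedSpace ℝ E]

def dd (u : E) (ψ : E → ℝ) (z : E) : ℝ := fderiv ℝ ψ z u

structure TF (ψ : E → ℝ) : Prop where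
  sm : ContDiff ℝ (⊤ : ℕ∞) ψ
  cp : HasCompactSupport ψ

lemma dd_smooth {ψ : E → ℝ} (h : ContDiff ℝ (⊤ : ℕ∞) ψ) (u : E) : ContDiff ℝ (⊤ : ℕ∞) (dd u ψ) := by
  have : ContDiff ℝ (⊤ : ℕ∞) (fderiv ℝ ψ) := h.fderiv_right (by simp)
  exact this.clm_apply contDiff_const

lemma tsupport_dd (ψ : E → ℝ) (u : E) : tsupport (dd u ψ) ⊆ tsupport ψ :=
  tsupport_fderiv_apply_subset ℝ u

lemma TF.dd {ψ : E → ℝ} (h : TF ψ) (u : E) : TF (dd u ψ) :=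
  ⟨dd_smooth h.sm u, h.cp.fderiv_apply ℝ u⟩

lemma TF.cont {ψ : E → ℝ} (h : TF ψ) : Continuous ψ := h.sm.continuous

lemma TF.diff {ψ : E → ℝ} (h : TF ψ) : Differentiable ℝ ψ := h.sm.differentiable (by simp)

lemma dd_comm {ψ : E → ℝ} (h : ContDiff ℝ (⊤ : ℕ∞) ψ) (u w : E) : dd u (dd w ψ) = dd w (dd u ψ) := by
  funext z
  have hd : DifferentiableAt ℝ (fderiv ℝ ψ) z :=
    ((h.fderiv_right (m := (⊤ : ℕ∞)) (by simp)).differentiable (by simp)) z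
  have hs : IsSymmSndFDerivAt ℝ ψ z := by
    apply ContDiffAt.isSymmSndFDerivAt (n := (⊤ : ℕ∞)) h.contDiffAt
    simp [minSmoothness_of_isRCLikeNormedField]
    exact WithTop.coe_le_coe.2 le_top
  have e : ∀ a b : E, dd a (dd b ψ) z = fderiv ℝ (fderiv ℝ ψ) z a b := by
    intro a b
    unfold dd
    rw [fderiv_clm_apply hd (differentiableAt_const b)]
    simp
  rw [e, e, hs.eq]

lemma dd_mul {f g : E → ℝ} (hf : Differentiable ℝ f) (hg : Differentiable ℝ g) (u z : E) :
    dd u (fun z => f z * g z) z = f z * dd u g z + dd u f z * g z := by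
  unfold dd
  have := fderiv_mul (hf z) (hg z)
  have e : (fun z => f z * g z) = f * g := rfl
  rw [e, this]; simp [mul_comm]

lemma TF.mul {f ψ : E → ℝ} (hf : ContDiff ℝ (⊤ : ℕ∞) f) (h : TF ψ) : TF (fun z => f z * ψ z) :=
  ⟨hf.mul h.sm, h.cp.mul_left⟩

lemma TF.add {f ψ : E → ℝ} (hf : TF f) (h : TF ψ) : TF (fun z => f z + ψ z) :=
  ⟨hf.sm.add h.sm, hf.cp.add h.cp⟩

lemma TF.sub {f ψ : E → ℝ} (hf : TF f) (h : TF ψ) : TF (fun z => f z - ψ z) :=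
  ⟨hf.sm.sub h.sm, by
    have : HasCompactSupport (fun z => -ψ z) := h.cp.comp_left (g := fun x : ℝ => -x) (by simp)
    simpa [sub_eq_add_neg] using! hf.cp.add this⟩

lemma TF.sum {ι : Type*} (s : Finset ι) {f : ι → E → ℝ} (hf : ∀ i, TF (f i)) :
    TF (fun z => ∑ i ∈ s, f i z) := by
  classical
  induction s using Finset.induction_on with
  | empty => simp only [Finset.sum_empty]; exact ⟨contDiff_const, HasCompactSupport.zero⟩
  | insert a s ha ih =>
    simp only [Finset.sum_insert ha]; exact (hf a).add ih

variable [MeasurableSpace E] [BorelSpace E] [FiniteDimensional ℝ E] {μ : Measure E}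
  [μ.IsAddHaarMeasure]

lemma TF.integrable {ψ : E → ℝ} (h : TF ψ) : Integrable ψ μ :=
  h.cont.integrable_of_hasCompactSupport h.cp

lemma TF.memLp {ψ : E → ℝ} (h : TF ψ) {p : ℝ≥0∞} : MemLp ψ p μ :=
  h.cont.memLp_of_hasCompactSupport h.cp

lemma int_l2 {f g : E → ℝ} (hf : MemLp f 2 μ) (hg : MemLp g 2 μ) :
    Integrable (fun z => f z * g z) μ := hf.integrable_mul hg

lemma ibp {f g : E → ℝ} (hf : ContDiff ℝ (⊤ : ℕ∞) f) (hg : TF g) (u : E) :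
    ∫ z, f z * dd u g z ∂μ = - ∫ z, dd u f z * g z ∂μ := by
  apply integral_mul_fderiv_eq_neg_fderiv_mul_of_integrable
  · exact ((TF.mul (dd_smooth hf u) hg)).integrable
  · exact ((TF.mul hf (hg.dd u))).integrable
  · exact (TF.mul hf hg).integrable
  · exact fun z _ => hf.differentiable (by simp) z
  · exact fun z _ => hg.diff z

lemma int_dd_zero {g : E → ℝ} (hg : TF g) (u : E) : ∫ z, dd u g z ∂μ = 0 := by
  have := ibp (μ := μ) (f := fun _ => (1 : ℝ)) contDiff_const hg u
  simpa [dd] using this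

end gen

/-- spatial Laplacian and backward heat operator -/
def lap (ψ : X4 → ℝ) (z : X4) : ℝ := ∑ i, dd (ex i) (dd (ex i) ψ) z
def heat (ψ : X4 → ℝ) (z : X4) : ℝ := dd et ψ z + lap ψ z

lemma TF.lap {ψ : X4 → ℝ} (h : TF ψ) : TF (lap ψ) := TF.sum _ fun _ => (h.dd _).dd _
lemma TF.heat {ψ : X4 → ℝ} (h : TF ψ) : TF (heat ψ) := (h.dd _).add h.lap

lemma energy_dt {u : X4 → ℝ} (h : TF u) (i : Fin 3) :
    ∫ z, dd et u z * dd (ex i) (dd (ex i) u) z = 0 := by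
  rw [ibp (h.dd et).sm (h.dd (ex i))]
  rw [dd_comm h.sm]
  have h1 := ibp (μ := (volume : Measure X4)) (h.dd (ex i)).sm (h.dd (ex i)) et
  have h2 : ∫ z, dd (ex i) u z * dd et (dd (ex i) u) z = ∫ z, dd et (dd (ex i) u) z * dd (ex i) u z := by
    congr 1; funext z; ring
  linarith

lemma energy_ij {u : X4 → ℝ} (h : TF u) (i j : Fin 3) :
    ∫ z, dd (ex i) (dd (ex i) u) z * dd (ex j) (dd (ex j) u) z =
      ∫ z, (dd (ex i) (dd (ex j) u) z) ^ 2 := by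
  rw [ibp ((h.dd _).dd _).sm (h.dd (ex j)), dd_comm (h.dd _).sm, 
    dd_comm h.sm (ex j) (ex i)]
  have := ibp (μ := (volume : Measure X4)) (h.dd (ex j)).sm ((h.dd (ex j)).dd (ex i)) (ex i)
  simp only [mul_comm] at this ⊢
  rw [this]; simp [sq]

lemma energy {u : X4 → ℝ} (h : TF u) :
    ∑ i, ∑ j, ∫ z, (dd (ex i) (dd (ex j) u) z) ^ 2 ≤ ∫ z, (heat u z) ^ 2 := by
  have e : ∀ z, (heat u z)^2 = (dd et u z)^2 + 2 * ∑ i, dd et u z * dd (ex i) (dd (ex i) u) z +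
      ∑ i, ∑ j, dd (ex i) (dd (ex i) u) z * dd (ex j) (dd (ex j) u) z := by
    intro z
    simp only [heat, lap, Fin.sum_univ_three]; ring
  simp_rw [e]
  have i1 : Integrable (fun z => (dd et u z)^2) := by
    have := (TF.mul (h.dd et).sm (h.dd et)).integrable (μ := (volume : Measure X4))
    simpa [sq] using this
  have i2 : ∀ i, Integrable (fun z => dd et u z * dd (ex i) (dd (ex i) u) z) :=
    fun i => (TF.mul (h.dd et).sm ((h.dd _).dd _)).integrable
  have i3 : ∀ i j, Integrable (fun z => dd (ex i) (dd (ex i) u) z * dd (ex j) (dd (ex j) u) z) :=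
    fun i j => (TF.mul ((h.dd _).dd _).sm ((h.dd _).dd _)).integrable
  have s2 : Integrable (fun z => 2 * ∑ i, dd et u z * dd (ex i) (dd (ex i) u) z) :=
    (integrable_finsetSum _ fun i _ => i2 i).const_mul 2
  have s3 : Integrable (fun z => ∑ i, ∑ j, dd (ex i) (dd (ex i) u) z * dd (ex j) (dd (ex j) u) z) :=
    integrable_finsetSum _ fun i _ => integrable_finsetSum _ fun j _ => i3 i j
  have s12 : Integrable (fun z => (dd et u z)^2 + 2 * ∑ i, dd et u z * dd (ex i) (dd (ex i) u) z) :=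
    i1.add s2
  rw [integral_add s12 s3, integral_add i1 s2, integral_const_mul,
    integral_finsetSum _ (fun i _ => i2 i),
    integral_finsetSum _ (fun i _ => integrable_finsetSum _ fun j _ => i3 i j)]
  simp_rw [integral_finsetSum _ (fun j _ => i3 _ j), energy_dt h, energy_ij h]
  have : 0 ≤ ∫ z, (dd et u z)^2 := integral_nonneg fun z => sq_nonneg _
  simp; exact this

section conv
variable {E : Type*} [NormedAddCommGroup E] [NormedSpace ℝ E]
variable [MeasurableSpace E] [BorelSpace E] [FiniteDimensional ℝ E] {μ : Measure E}
  [μ.IsAddHaarMeasure]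

def cv (μ : Measure E) (f g : E → ℝ) (z : E) : ℝ := ∫ y, f y * g (z - y) ∂μ

lemma cv_eq (f g : E → ℝ) : cv μ f g = convolution f g (ContinuousLinearMap.lsmul ℝ ℝ) μ := by
  funext z; rfl

lemma cv_smooth {f g : E → ℝ} (hf : LocallyIntegrable f μ) (hg : TF g) :
    ContDiff ℝ (⊤ : ℕ∞) (cv μ f g) := by
  rw [cv_eq]
  exact hg.cp.contDiff_convolution_right _ hf hg.sm

lemma dd_cv {f g : E → ℝ} (hf : LocallyIntegrable f μ) (hg : TF g) (u : E) :
    dd u (cv μ f g) = cv μ f (dd u g) := by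
  funext z
  have h := hg.cp.hasFDerivAt_convolution_right (ContinuousLinearMap.lsmul ℝ ℝ) hf
    (hg.sm.of_le (by exact_mod_cast le_top)) z
  unfold dd
  rw [cv_eq, h.fderiv, convolution_precompR_apply _ hf (hg.cp.fderiv ℝ)
    (hg.sm.continuous_fderiv (by simp))]
  rfl

lemma TF.cv {f g : E → ℝ} (hf : LocallyIntegrable f μ) (hc : HasCompactSupport f) (hg : TF g) :
    TF (cv μ f g) := by
  refine ⟨cv_smooth hf hg, ?_⟩
  rw [cv_eq]; exact hc.convolution _ hg.cp

/-- correlation -/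
def cr (μ : Measure E) (f g : E → ℝ) (z : E) : ℝ := ∫ y, f y * g (z + y) ∂μ

lemma cr_eq (f g : E → ℝ) : cr μ f g = cv μ (fun y => f (-y)) g := by
  funext z
  unfold cr cv
  rw [← integral_neg_eq_self]; simp [sub_eq_add_neg]

lemma neg_cp {f : E → ℝ} (hc : HasCompactSupport f) : HasCompactSupport (fun y => f (-y)) :=
  hc.comp_homeomorph (Homeomorph.neg E)

lemma TF.neg_arg {f : E → ℝ} (hf : TF f) : TF (fun y => f (-y)) :=
  ⟨hf.sm.comp contDiff_neg, neg_cp hf.cp⟩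

lemma TF.cr {f g : E → ℝ} (hf : TF f) (hg : TF g) : TF (cr μ f g) := by
  rw [cr_eq]; exact TF.cv hf.neg_arg.integrable.locallyIntegrable hf.neg_arg.cp hg

lemma dd_cr {f g : E → ℝ} (hf : TF f) (hg : TF g) (u : E) :
    dd u (cr μ f g) = cr μ f (dd u g) := by
  rw [cr_eq, dd_cv hf.neg_arg.integrable.locallyIntegrable hg, cr_eq]

lemma dd_shift {g : E → ℝ} (a u z : E) : dd u (fun y => g (a + y)) z = dd u g (a + z) := by
  unfold dd; rw [fderiv_comp_add_left]

lemma dd_refl {g : E → ℝ} (hg : Differentiable ℝ g) (a u z : E) :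
    dd u (fun y => g (a - y)) z = - dd u g (a - z) := by
  unfold dd
  have h1 : HasFDerivAt (fun y : E => a - y) (-(ContinuousLinearMap.id ℝ E)) z := by
    simpa using! (hasFDerivAt_id z).const_sub a
  have := ((hg (a - z)).hasFDerivAt.comp z h1).fderiv
  have e : (fun y => g (a - y)) = g ∘ (fun y => a - y) := rfl
  rw [e, this]; simp

lemma TF.shift {g : E → ℝ} (hg : TF g) (a : E) : TF (fun y => g (a + y)) :=
  ⟨hg.sm.comp (contDiff_const.add contDiff_id), hg.cp.comp_homeomorph (Homeomorph.addLeft a)⟩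

lemma TF.refl {g : E → ℝ} (hg : TF g) (a : E) : TF (fun y => g (a - y)) := by
  simpa [sub_eq_add_neg] using! (hg.shift a).neg_arg

/-- integrate by parts in a correlation -/
lemma cr_ibp {f g : E → ℝ} (hf : TF f) (hg : TF g) (u : E) (z : E) :
    cr μ f (dd u g) z = - cr μ (dd u f) g z := by
  unfold cr
  rw [← ibp hf.sm (hg.shift z)]
  simp_rw [dd_shift]

end conv

section moll
variable {E : Type*} [NormedAddCommGroup E] [NormedSpace ℝ E]
variable [MeasurableSpace E] [BorelSpace E] [FiniteDimensional ℝ E] {μ : Measure E}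
  [μ.IsAddHaarMeasure]

lemma corr_cont {X Y : E → ℝ} (hX : MemLp X 2 μ) (hY : MemLp Y 2 μ) :
    Continuous (fun h => ∫ z, Y z * X (z - h) ∂μ) := by
  have hm : ∀ h : E, MeasurePreserving (fun z : E => z - h) μ μ := fun h =>
    measurePreserving_sub_right μ h
  let g : E → C(E, E) := fun h => ⟨fun z => z - h, by fun_prop⟩
  have hg : Continuous g := by
    apply ContinuousMap.continuous_of_continuous_uncurry
    show Continuous (fun p : E × E => p.2 - p.1)
    fun_prop
  have hc := Continuous.compMeasurePreservingLp (p := 2) (f := fun _ : E => hX.toLp X) 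
    continuous_const hg (fun h => hm h) (by simp)
  have hi := (continuous_const (y := hY.toLp Y)).inner (𝕜 := ℝ) hc
  refine hi.congr fun h => ?_
  rw [L2.inner_def]
  apply integral_congr_ae
  have e : Lp.compMeasurePreserving (g h) (hm h) (hX.toLp X) =
    (hX.comp_measurePreserving (hm h)).toLp _ := rfl
  rw [e]
  filter_upwards [hY.coeFn_toLp, (hX.comp_measurePreserving (hm h)).coeFn_toLp] with z h1 h2
  rw [h1, h2]; simp [mul_comm]

lemma moll_fub {X Y ζ : E → ℝ} (hX : MemLp X 2 μ) (hY : MemLp Y 2 μ) (hζ : TF ζ) :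
    ∫ z, Y z * cv μ X ζ z ∂μ = ∫ h, ζ h * ∫ z, Y z * X (z - h) ∂μ ∂μ := by
  have e1 : ∀ z, Y z * cv μ X ζ z = ∫ h, ζ h * (Y z * X (z - h)) ∂μ := by
    intro z
    have : cv μ X ζ z = ∫ h, X (z - h) * ζ h ∂μ := by
      unfold cv
      rw [← integral_sub_left_eq_self _ μ z]
      simp
    rw [this, ← integral_const_mul]
    congr 1; funext h; ring
  simp_rw [e1]
  have hXn : MemLp (fun z => ‖X z‖) 2 μ := hX.norm
  have hYn : MemLp (fun z => ‖Y z‖) 2 μ := hY.norm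
  rw [integral_integral_swap]
  · simp_rw [integral_const_mul]
  · refine (integrable_prod_iff' ?_).2 ⟨?_, ?_⟩
    · refine AEStronglyMeasurable.mul ?_ (AEStronglyMeasurable.mul ?_ ?_)
      · exact (hζ.cont.comp continuous_snd).aestronglyMeasurable
      · exact hY.1.comp_fst
      · exact hX.1.comp_quasiMeasurePreserving (quasiMeasurePreserving_sub_of_right_invariant μ μ)
    · refine Eventually.of_forall fun h => ?_
      have := int_l2 hY (hX.comp_measurePreserving (measurePreserving_sub_right μ h))
      exact this.const_mul (ζ h)
    · simp only [norm_mul, Function.uncurry]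
      simp_rw [integral_const_mul]
      have hc := corr_cont hXn hYn
      refine Continuous.integrable_of_hasCompactSupport (hζ.cont.norm.mul hc) ?_
      exact hζ.cp.norm.mul_right

lemma moll {X Y : E → ℝ} (hX : MemLp X 2 μ) (hY : MemLp Y 2 μ) {φ : ℕ → ContDiffBump (0 : E)}
    (hφ : Tendsto (fun n => (φ n).rOut) atTop (nhds 0)) :
    Tendsto (fun n => ∫ z, Y z * cv μ X ((φ n).normed μ) z ∂μ) atTop (nhds (∫ z, Y z * X z ∂μ)) := by
  have hc := corr_cont hX hY
  have := ContDiffBump.convolution_tendsto_right_of_continuous (μ := μ) hφ 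
    (hc.comp continuous_neg) 0
  simp only [Function.comp] at this
  simp only [neg_zero, sub_zero] at this
  refine this.congr fun n => ?_
  have ht : TF ((φ n).normed μ) := ⟨(φ n).contDiff_normed, (φ n).hasCompactSupport_normed⟩
  rw [moll_fub hX hY ht]
  unfold convolution
  simp

/-- weak chain rule -/
lemma weak_chain {O : Set E} (hO : IsOpen O) {V D₁ D₂ : E → ℝ} {a b : E}
    (hV : MemLp V 2 μ) (h1 : MemLp D₁ 2 μ) (h2 : MemLp D₂ 2 μ)
    (w1 : ∀ ψ : E → ℝ, TF ψ → tsupport ψ ⊆ O → ∫ z, V z * dd a ψ z ∂μ = - ∫ z, D₁ z * ψ z ∂μ)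
    (w2 : ∀ ψ : E → ℝ, TF ψ → tsupport ψ ⊆ O → ∫ z, V z * dd b ψ z ∂μ = - ∫ z, D₂ z * ψ z ∂μ)
    {ψ : E → ℝ} (hψ : TF ψ) (hs : tsupport ψ ⊆ O) :
    ∫ z, V z * D₂ z * dd a ψ z ∂μ = ∫ z, V z * D₁ z * dd b ψ z ∂μ := by
  obtain ⟨δ, δ0, hδ⟩ := hψ.cp.isCompact.exists_cthickening_subset_open hO hs
  let φ : ℕ → ContDiffBump (0 : E) := fun n => 
    ⟨δ / 2 / (n + 2), δ / (n + 2), by positivity, by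
      rw [div_right_comm]; exact half_lt_self (by positivity)⟩
  have hφ : Tendsto (fun n => (φ n).rOut) atTop (nhds 0) := by
    show Tendsto (fun n : ℕ => δ / ((n : ℝ) + 2)) atTop (nhds 0)
    exact Tendsto.const_div_atTop (tendsto_natCast_atTop_atTop.atTop_add tendsto_const_nhds) δ
  have hr : ∀ n, (φ n).rOut ≤ δ := by
    intro n
    show δ / ((n : ℝ) + 2) ≤ δ
    apply div_le_self δ0.le; have := Nat.cast_nonneg (α := ℝ) n; linarith
  have ht : ∀ n, TF ((φ n).normed μ) := fun n =>
    ⟨(φ n).contDiff_normed, (φ n).hasCompactSupport_normed⟩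
  have hVl := hV.locallyIntegrable (by norm_num)
  -- derivative of the mollification on the support
  have key : ∀ (c : E) (D : E → ℝ)
      (_ : ∀ ψ : E → ℝ, TF ψ → tsupport ψ ⊆ O → ∫ z, V z * dd c ψ z ∂μ = - ∫ z, D z * ψ z ∂μ)
      (n : ℕ) (z : E), z ∈ tsupport ψ → 
      dd c (cv μ V ((φ n).normed μ)) z = cv μ D ((φ n).normed μ) z := by
    intro c D w n z hz
    rw [dd_cv hVl (ht n)]
    unfold cv
    have := w (fun y => (φ n).normed μ (z - y)) ((ht n).refl z) ?_
    · simp_rw [dd_refl (ht n).diff] at this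
      simp only [mul_neg, integral_neg, neg_inj] at this
      exact this
    · refine subset_trans ?_ hδ
      have hsub : Function.support (fun y => (φ n).normed μ (z - y)) ⊆ 
          Metric.cthickening δ (tsupport ψ) := by
        intro y hy
        have hy' : z - y ∈ Function.support ((φ n).normed μ) := hy
        rw [(φ n).support_normed_eq] at hy'
        apply Metric.mem_cthickening_of_dist_le y z δ _ hz
        rw [dist_comm, dist_eq_norm]
        have := mem_ball_zero_iff.1 hy'
        linarith [hr n]
      exact closure_minimal hsub Metric.isClosed_cthickening
  -- identity at level n
  have bd : ∀ (f g : E → ℝ), MemLp f 2 μ → TF g → MemLp (fun z => f z * g z) 2 μ := by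
    intro f g hf hg
    obtain ⟨C, hC⟩ := hg.cp.exists_bound_of_continuous hg.cont
    have := hf.mul (p := ∞) (q := 2) (r := 2) (memLp_top_of_bound hg.cont.aestronglyMeasurable C
      (Eventually.of_forall hC))
    refine this.ae_eq (Eventually.of_forall fun z => ?_)
    simp [mul_comm]
  have idn : ∀ n, (∫ z, (D₂ z * dd a ψ z) * cv μ V ((φ n).normed μ) z ∂μ) -
      (∫ z, (D₁ z * dd b ψ z) * cv μ V ((φ n).normed μ) z ∂μ) =
      - ((∫ z, (V z * dd a ψ z) * cv μ D₂ ((φ n).normed μ) z ∂μ) -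
      ∫ z, (V z * dd b ψ z) * cv μ D₁ ((φ n).normed μ) z ∂μ) := by
    intro n
    set U := cv μ V ((φ n).normed μ) with hU
    have hUs : ContDiff ℝ (⊤ : ℕ∞) U := cv_smooth hVl (ht n)
    have hUd : Differentiable ℝ U := hUs.differentiable (by simp)
    have T1 := w1 (fun z => U z * dd b ψ z) (TF.mul hUs (hψ.dd b)) 
      ((tsupport_mul_subset_right).trans ((tsupport_dd ψ b).trans hs))
    have T2 := w2 (fun z => U z * dd a ψ z) (TF.mul hUs (hψ.dd a)) 
      ((tsupport_mul_subset_right).trans ((tsupport_dd ψ a).trans hs))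
    simp_rw [dd_mul hUd (hψ.dd _).diff] at T1 T2
    have z1 : ∀ z, dd a U z * dd b ψ z = cv μ D₁ ((φ n).normed μ) z * dd b ψ z := by
      intro z
      by_cases hz : z ∈ tsupport ψ
      · rw [key a D₁ w1 n z hz]
      · have : dd b ψ z = 0 := image_eq_zero_of_notMem_tsupport fun h => hz (tsupport_dd ψ b h)
        simp [this]
    have z2 : ∀ z, dd b U z * dd a ψ z = cv μ D₂ ((φ n).normed μ) z * dd a ψ z := by
      intro z
      by_cases hz : z ∈ tsupport ψ
      · rw [key b D₂ w2 n z hz]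
      · have : dd a ψ z = 0 := image_eq_zero_of_notMem_tsupport fun h => hz (tsupport_dd ψ a h)
        simp [this]
    simp_rw [z1] at T1
    simp_rw [z2] at T2
    have c1 : ContDiff ℝ (⊤ : ℕ∞) (cv μ D₁ ((φ n).normed μ)) := 
      cv_smooth (h1.locallyIntegrable (by norm_num)) (ht n)
    have c2 : ContDiff ℝ (⊤ : ℕ∞) (cv μ D₂ ((φ n).normed μ)) := 
      cv_smooth (h2.locallyIntegrable (by norm_num)) (ht n)
    simp_rw [mul_add] at T1 T2
    rw [integral_add (int_l2 hV (TF.mul hUs ((hψ.dd _).dd _)).memLp)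
      (int_l2 hV (TF.mul c1 (hψ.dd _)).memLp)] at T1
    rw [integral_add (int_l2 hV (TF.mul hUs ((hψ.dd _).dd _)).memLp)
      (int_l2 hV (TF.mul c2 (hψ.dd _)).memLp)] at T2
    rw [dd_comm hψ.sm] at T1
    have r1 : ∫ z, (D₁ z * dd b ψ z) * U z ∂μ = ∫ z, D₁ z * (U z * dd b ψ z) ∂μ := by
      congr 1; funext z; ring
    have r2 : ∫ z, (D₂ z * dd a ψ z) * U z ∂μ = ∫ z, D₂ z * (U z * dd a ψ z) ∂μ := by
      congr 1; funext z; ring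
    have r3 : ∫ z, (V z * dd a ψ z) * cv μ D₂ ((φ n).normed μ) z ∂μ = 
        ∫ z, V z * (cv μ D₂ ((φ n).normed μ) z * dd a ψ z) ∂μ := by
      congr 1; funext z; ring
    have r4 : ∫ z, (V z * dd b ψ z) * cv μ D₁ ((φ n).normed μ) z ∂μ = 
        ∫ z, V z * (cv μ D₁ ((φ n).normed μ) z * dd b ψ z) ∂μ := by
      congr 1; funext z; ring
    rw [r1, r2, r3, r4]
    linarith
  have L := (moll hV (bd _ _ h2 (hψ.dd a)) hφ).sub (moll hV (bd _ _ h1 (hψ.dd b)) hφ)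
  have R := ((moll h2 (bd _ _ hV (hψ.dd a)) hφ).sub (moll h1 (bd _ _ hV (hψ.dd b)) hφ)).neg
  have := tendsto_nhds_unique (L.congr idn) R
  have r1 : ∫ z, (D₁ z * dd b ψ z) * V z ∂μ = ∫ z, V z * D₁ z * dd b ψ z ∂μ := by
    congr 1; funext z; ring
  have r2 : ∫ z, (D₂ z * dd a ψ z) * V z ∂μ = ∫ z, V z * D₂ z * dd a ψ z ∂μ := by
    congr 1; funext z; ring
  have r3 : ∫ z, (V z * dd a ψ z) * D₂ z ∂μ = ∫ z, V z * D₂ z * dd a ψ z ∂μ := by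
    congr 1; funext z; ring
  have r4 : ∫ z, (V z * dd b ψ z) * D₁ z ∂μ = ∫ z, V z * D₁ z * dd b ψ z ∂μ := by
    congr 1; funext z; ring
  rw [r1, r2, r3, r4] at this
  linarith

end moll

section gen2
variable {E : Type*} [NormedAddCommGroup E] [NormedSpace ℝ E]
variable [MeasurableSpace E] [BorelSpace E] [FiniteDimensional ℝ E] {μ : Measure E}
  [μ.IsAddHaarMeasure]

lemma TF.bdd {g : E → ℝ} (hg : TF g) : ∃ C, ∀ z, ‖g z‖ ≤ C :=
  hg.cp.exists_bound_of_continuous hg.cont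

lemma memLp_mul_TF {f g : E → ℝ} (hf : MemLp f 2 μ) (hg : TF g) :
    MemLp (fun z => f z * g z) 2 μ := by
  obtain ⟨C, hC⟩ := hg.bdd
  have := hf.mul (p := ∞) (q := 2) (r := 2) (memLp_top_of_bound hg.cont.aestronglyMeasurable C
      (Eventually.of_forall hC))
  refine this.ae_eq (Eventually.of_forall fun z => ?_)
  simp [mul_comm]

lemma int3 {f g h : E → ℝ} (hf : MemLp f 2 μ) (hg : MemLp g 2 μ) (hh : TF h) :
    Integrable (fun z => f z * g z * h z) μ := by
  have := int_l2 hf (memLp_mul_TF hg hh)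
  simpa [mul_assoc] using this
end gen2

/-- slices of test functions -/
lemma TF.slice {ψ : X4 → ℝ} (h : TF ψ) (q : ℝ) : TF (fun x : E3 => ψ (x, q)) := by
  refine ⟨h.sm.comp (contDiff_id.prodMk contDiff_const), ?_⟩
  refine HasCompactSupport.intro (h.cp.isCompact.image continuous_fst) fun x hx => ?_
  by_contra hne
  exact hx ⟨(x, q), subset_tsupport _ hne, rfl⟩

lemma tsupport_slice {ψ : X4 → ℝ} {O : Set E3} {I : Set ℝ} (hs : tsupport ψ ⊆ O ×ˢ I) (q : ℝ) :
    tsupport (fun x : E3 => ψ (x, q)) ⊆ O := by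
  have : tsupport (fun x : E3 => ψ (x, q)) ⊆ (fun x : E3 => (x, q)) ⁻¹' tsupport ψ := by
    apply closure_minimal
    · intro x hx; exact subset_tsupport _ hx
    · exact (isClosed_tsupport ψ).preimage (by fun_prop)
  intro x hx
  exact (hs (this hx)).1

lemma fderiv_slice {ψ : X4 → ℝ} (h : Differentiable ℝ ψ) (x : E3) (q : ℝ) (u : E3) :
    fderiv ℝ (fun x : E3 => ψ (x, q)) x u = dd (u, (0 : ℝ)) ψ (x, q) := by
  have h1 : HasFDerivAt (fun x : E3 => (x, q)) (ContinuousLinearMap.inl ℝ E3 ℝ) x := 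
    hasFDerivAt_prodMk_left x q
  have := ((h (x, q)).hasFDerivAt.comp x h1).fderiv
  have e : (fun x : E3 => ψ (x, q)) = ψ ∘ (fun x : E3 => (x, q)) := rfl
  rw [e, this]; simp [dd]

lemma cont_slice_int {f : E3 → ℝ} (hf : LocallyIntegrable f) {Φ : X4 → ℝ} (hΦ : TF Φ) :
    Continuous (fun q : ℝ => ∫ x, f x * Φ (x, q)) := by
  set K := Prod.fst '' tsupport Φ with hK
  have hKc : IsCompact K := hΦ.cp.isCompact.image continuous_fst
  obtain ⟨C, hC⟩ := hΦ.bdd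
  apply continuous_of_dominated (bound := fun x => K.indicator (fun x => ‖f x‖ * C) x)
  · intro q
    exact hf.aestronglyMeasurable.mul (hΦ.slice q).cont.aestronglyMeasurable
  · intro q
    refine Eventually.of_forall fun x => ?_
    by_cases hx : x ∈ K
    · rw [indicator_of_mem hx, norm_mul]
      exact mul_le_mul_of_nonneg_left (hC _) (norm_nonneg _)
    · have : Φ (x, q) = 0 := by
        by_contra hne; exact hx ⟨(x, q), subset_tsupport _ hne, rfl⟩
      simp [this, hx]
  · rw [integrable_indicator_iff hKc.measurableSet]
    exact (hf.integrableOn_isCompact hKc).norm.mul_const C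
  · refine Eventually.of_forall fun x => ?_
    exact continuous_const.mul (hΦ.cont.comp (by fun_prop))

/-- the antisymmetric gradient and the Lamb vector -/
def ww (D : Fin 3 → Fin 3 → X4 → ℝ) (a b : Fin 3) (z : X4) : ℝ := D a b z - D b a z
def FF (V : Fin 3 → X4 → ℝ) (D : Fin 3 → Fin 3 → X4 → ℝ) (i : Fin 3) (z : X4) : ℝ :=
  ∑ j, V j z * ww D j i z

structure SolD (O : Set X4) (V : Fin 3 → X4 → ℝ) (D : Fin 3 → Fin 3 → X4 → ℝ) : Prop where
  hV : ∀ j, MemLp (V j) 2 volume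
  hD : ∀ i j, MemLp (D i j) 2 volume
  wg : ∀ i j ψ, TF ψ → tsupport ψ ⊆ O → 
    ∫ z, V j z * dd (ex i) ψ z = - ∫ z, D i j z * ψ z
  dv : ∀ᵐ z : X4, ∑ i, D i i z = 0
  ve : ∀ a b ψ, TF ψ → tsupport ψ ⊆ O →
    (∫ z, ww D a b z * heat ψ z) + (∫ z, FF V D b z * dd (ex a) ψ z)
      - (∫ z, FF V D a z * dd (ex b) ψ z) = 0

section sol
variable {Ω : Set E3} {T : ℝ} {v : E3 × ℝ → E3}
    {Dv : E3 × ℝ → Fin 3 → Fin 3 → ℝ} {p : E3 × ℝ → ℝ} {v₀ : E3 → E3}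

def Vx (O : Set X4) (v : X4 → E3) (j : Fin 3) : X4 → ℝ := O.indicator fun z => v z j
def Dx (O : Set X4) (Dv : X4 → Fin 3 → Fin 3 → ℝ) (i j : Fin 3) : X4 → ℝ :=
  O.indicator fun z => Dv z i j


lemma QT_meas (hΩ : IsOpen Ω) (_h : IsSuitableWeakSolution Ω T v Dv p v₀) : MeasurableSet (Ω ×ˢ Ioo 0 T) := hΩ.measurableSet.prod measurableSet_Ioo

lemma Vx_meas (hΩ : IsOpen Ω) (h : IsSuitableWeakSolution Ω T v Dv p v₀) (j : Fin 3) : Measurable (Vx (Ω ×ˢ Ioo 0 T) v j) := by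
  have : Measurable fun z => v z j := by
    have := h.meas_v
    fun_prop
  exact this.indicator (QT_meas hΩ h)

lemma Dx_meas (hΩ : IsOpen Ω) (h : IsSuitableWeakSolution Ω T v Dv p v₀) (i j : Fin 3) : Measurable (Dx (Ω ×ˢ Ioo 0 T) Dv i j) := by
  have : Measurable fun z => Dv z i j := by
    have := h.meas_Dv
    fun_prop
  exact this.indicator (QT_meas hΩ h)

lemma Vx_L2 (hΩ : IsOpen Ω) (h : IsSuitableWeakSolution Ω T v Dv p v₀) (j : Fin 3) : MemLp (Vx (Ω ×ˢ Ioo 0 T) v j) 2 volume := by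
  rw [memLp_two_iff_integrable_sq (Vx_meas hΩ h j).aestronglyMeasurable]
  have h1 := (integrable_indicator_iff (QT_meas hΩ h)).2 h.v_l2_w12
  refine h1.mono' ((Vx_meas hΩ h j).pow_const 2).aestronglyMeasurable (Eventually.of_forall fun z => ?_)
  rw [norm_pow, Real.norm_eq_abs, sq_abs]
  by_cases hz : z ∈ Ω ×ˢ Ioo 0 T
  · simp only [Vx, indicator_of_mem hz]
    have : (v z j)^2 ≤ ‖v z‖^2 := by
      rw [EuclideanSpace.norm_sq_eq]
      have := Finset.single_le_sum (f := fun i => ‖v z i‖^2) (fun i _ => sq_nonneg _) (Finset.mem_univ j)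
      simpa using this
    have h2 : 0 ≤ ∑ i, ∑ j, (Dv z i j)^2 := Finset.sum_nonneg fun i _ => Finset.sum_nonneg fun j _ => sq_nonneg _
    linarith
  · simp [Vx, hz]

lemma Dx_L2 (hΩ : IsOpen Ω) (h : IsSuitableWeakSolution Ω T v Dv p v₀) (i j : Fin 3) : MemLp (Dx (Ω ×ˢ Ioo 0 T) Dv i j) 2 volume := by
  rw [memLp_two_iff_integrable_sq (Dx_meas hΩ h i j).aestronglyMeasurable]
  have h1 := (integrable_indicator_iff (QT_meas hΩ h)).2 h.v_l2_w12
  refine h1.mono' ((Dx_meas hΩ h i j).pow_const 2).aestronglyMeasurable (Eventually.of_forall fun z => ?_)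
  rw [norm_pow, Real.norm_eq_abs, sq_abs]
  by_cases hz : z ∈ Ω ×ˢ Ioo 0 T
  · simp only [Dx, indicator_of_mem hz]
    have h2 : (Dv z i j)^2 ≤ ∑ i, ∑ j, (Dv z i j)^2 := by
      have a1 := Finset.single_le_sum (f := fun j => (Dv z i j)^2) (fun i _ => sq_nonneg _) (Finset.mem_univ j)
      have a2 := Finset.single_le_sum (f := fun i => ∑ j, (Dv z i j)^2) (fun i _ => Finset.sum_nonneg fun j _ => sq_nonneg _) (Finset.mem_univ i)
      exact a1.trans a2
    have := sq_nonneg ‖v z‖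
    linarith
  · simp [Dx, hz]


lemma slice_L2 {f : X4 → ℝ} (hm : Measurable f) (hf : MemLp f 2 volume) :
    ∀ᵐ t : ℝ, MemLp (fun x : E3 => f (x, t)) 2 volume := by
  have h1 := (memLp_two_iff_integrable_sq hm.aestronglyMeasurable).1 hf
  have h2 := (show Integrable (fun z => f z ^ 2) ((volume : Measure E3).prod (volume : Measure ℝ)) from h1).prod_left_ae
  filter_upwards [h2] with t ht
  have hm2 : Measurable (fun x : E3 => f (x, t)) := hm.comp (by fun_prop)
  exact (memLp_two_iff_integrable_sq hm2.aestronglyMeasurable).2 ht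

lemma wg_sol (hΩ : IsOpen Ω) (h : IsSuitableWeakSolution Ω T v Dv p v₀) (i j : Fin 3) {ψ : X4 → ℝ} (hψ : TF ψ) (hs : tsupport ψ ⊆ Ω ×ˢ Ioo 0 T) :
    ∫ z, Vx (Ω ×ˢ Ioo 0 T) v j z * dd (ex i) ψ z = - ∫ z, Dx (Ω ×ˢ Ioo 0 T) Dv i j z * ψ z := by
  set V := Vx (Ω ×ˢ Ioo 0 T) v j with hVd
  set D := Dx (Ω ×ˢ Ioo 0 T) Dv i j with hDd
  have hV2 : MemLp V 2 volume := Vx_L2 hΩ h j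
  have hD2 : MemLp D 2 volume := Dx_L2 hΩ h i j
  have e1 : ∫ z, V z * dd (ex i) ψ z = ∫ t, ∫ x, V (x, t) * dd (ex i) ψ (x, t) :=
    integral_prod_symm _ (int_l2 hV2 (hψ.dd _).memLp)
  have e2 : ∫ z, D z * ψ z = ∫ t, ∫ x, D (x, t) * ψ (x, t) :=
    integral_prod_symm _ (int_l2 hD2 hψ.memLp)
  rw [e1, e2, ← integral_neg]
  apply integral_congr_ae
  have w : ∀ q : ℚ, ∀ᵐ t ∂(volume.restrict (Ioo 0 T)), 
      ∫ x in Ω, v (x, t) j * dd (ex i) ψ (x, (q : ℝ)) = - ∫ x in Ω, Dv (x, t) i j * ψ (x, (q : ℝ)) := by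
    intro q
    filter_upwards [h.weak_grad (fun x => ψ (x, (q : ℝ))) (hψ.slice q).sm (hψ.slice q).cp 
      (tsupport_slice hs q)] with t ht
    have := ht i j
    simp_rw [fderiv_slice hψ.diff] at this
    exact this
  have w' := (ae_restrict_iff' measurableSet_Ioo).1 (ae_all_iff.2 w)
  filter_upwards [w', slice_L2 (Vx_meas hΩ h j) hV2, slice_L2 (Dx_meas hΩ h i j) hD2] with t ht hVt hDt
  by_cases htI : t ∈ Ioo 0 T
  · have hq := ht htI
    have c1 := cont_slice_int (hVt.locallyIntegrable (by norm_num)) (hψ.dd (ex i))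
    have c2 := (cont_slice_int (hDt.locallyIntegrable (by norm_num)) hψ).neg
    have := Continuous.ext_on (Rat.denseRange_cast (𝕜 := ℝ)) c1 c2 ?_
    · exact congrFun this t
    · rintro _ ⟨q, rfl⟩
      have := hq q
      rw [← integral_indicator hΩ.measurableSet, ← integral_indicator hΩ.measurableSet] at this
      have i1 : ∀ x, Vx (Ω ×ˢ Ioo 0 T) v j (x, t) * dd (ex i) ψ (x, (q : ℝ)) =
          Ω.indicator (fun x => v (x, t) j * dd (ex i) ψ (x, (q : ℝ))) x := by
        intro x
        by_cases hx : x ∈ Ω <;> simp [Vx, hx, htI.1, htI.2, indicator]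
      have i2 : ∀ x, Dx (Ω ×ˢ Ioo 0 T) Dv i j (x, t) * ψ (x, (q : ℝ)) =
          Ω.indicator (fun x => Dv (x, t) i j * ψ (x, (q : ℝ))) x := by
        intro x
        by_cases hx : x ∈ Ω <;> simp [Dx, hx, htI.1, htI.2, indicator]
      show (∫ x, Vx (Ω ×ˢ Ioo 0 T) v j (x, t) * dd (ex i) ψ (x, (q : ℝ))) =
        - ∫ x, Dx (Ω ×ˢ Ioo 0 T) Dv i j (x, t) * ψ (x, (q : ℝ))
      simp_rw [i1, i2]
      exact this
  · have a1 : ∀ x, V (x, t) = 0 := fun x => indicator_of_notMem (fun hh => htI hh.2) _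
    have a2 : ∀ x, D (x, t) = 0 := fun x => indicator_of_notMem (fun hh => htI hh.2) _
    simp [a1, a2]

lemma dv_sol (hΩ : IsOpen Ω) (h : IsSuitableWeakSolution Ω T v Dv p v₀) : ∀ᵐ z : X4, ∑ i, Dx (Ω ×ˢ Ioo 0 T) Dv i i z = 0 := by
  have hint : ∀ i, Integrable (fun z => Dx (Ω ×ˢ Ioo 0 T) Dv i i z ^ 2) := fun i => 
    (Dx_L2 hΩ h i i).integrable_sq
  have hl : LocallyIntegrable (fun z => ∑ i, Dx (Ω ×ˢ Ioo 0 T) Dv i i z) :=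
    (memLp_finsetSum _ fun i _ => Dx_L2 hΩ h i i).locallyIntegrable (by norm_num)
  have hO : IsOpen (Ω ×ˢ Ioo 0 T) := hΩ.prod isOpen_Ioo
  have := hO.ae_eq_zero_of_integral_contDiff_smul_eq_zero (μ := volume) (hl.locallyIntegrableOn _) ?_
  · filter_upwards [this] with z hz
    by_cases hzO : z ∈ Ω ×ˢ Ioo 0 T
    · exact hz hzO
    · simp [Dx, hzO]
  · intro g hg hgc hgs
    have tg : TF g := ⟨hg, hgc⟩
    have h1 := h.div_free g hg hgc hgs
    rw [← integral_indicator (QT_meas hΩ h)] at h1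
    have e : ∀ z, (Ω ×ˢ Ioo 0 T).indicator (fun z => ∑ i, v z i * sdz g i z) z =
        ∑ i, Vx (Ω ×ˢ Ioo 0 T) v i z * dd (ex i) g z := by
      intro z
      by_cases hz : z ∈ Ω ×ˢ Ioo 0 T
      · simp [Vx, indicator_of_mem hz]; rfl
      · simp [Vx, hz]
    simp_rw [e] at h1
    rw [integral_finsetSum _ fun i _ => int_l2 (Vx_L2 hΩ h i) (tg.dd _).memLp] at h1
    simp_rw [wg_sol hΩ h _ _ tg hgs] at h1
    simp only [smul_eq_mul, Finset.mul_sum]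
    rw [integral_finsetSum _ fun i _ => int_l2 tg.memLp (Dx_L2 hΩ h i i)]
    simp_rw [mul_comm (g _)]
    rw [Finset.sum_neg_distrib] at h1
    linarith

end sol

section sol2
variable {Ω : Set E3} {T : ℝ} {v : E3 × ℝ → E3}
    {Dv : E3 × ℝ → Fin 3 → Fin 3 → ℝ} {p : E3 × ℝ → ℝ} {v₀ : E3 → E3}

def phi2 (A B : X4 → ℝ) (a b : Fin 3) (z : X4) : E3 :=
  A z • EuclideanSpace.single b (1 : ℝ) - B z • EuclideanSpace.single a (1 : ℝ)

lemma phi2_apply (A B : X4 → ℝ) (a b : Fin 3) (z : X4) (i : Fin 3) :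
    phi2 A B a b z i = (if i = b then A z else 0) - (if i = a then B z else 0) := by
  simp [phi2]

lemma phi2_fderiv {A B : X4 → ℝ} (hA : Differentiable ℝ A) (hB : Differentiable ℝ B) (a b : Fin 3)
    (z u : X4) (i : Fin 3) : (fderiv ℝ (phi2 A B a b) z u) i =
      (if i = b then dd u A z else 0) - (if i = a then dd u B z else 0) := by
  have h1 : HasFDerivAt (phi2 A B a b) ((fderiv ℝ A z).smulRight (EuclideanSpace.single b (1 : ℝ)) -
      (fderiv ℝ B z).smulRight (EuclideanSpace.single a (1 : ℝ))) z :=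
    ((hA z).hasFDerivAt.smul_const _).sub ((hB z).hasFDerivAt.smul_const _)
  rw [h1.fderiv]
  simp [dd]

lemma ite_sum (f : Fin 3 → ℝ) (A B : ℝ) (a b : Fin 3) :
    ∑ i, f i * ((if i = b then A else 0) - (if i = a then B else 0)) = f b * A - f a * B := by
  simp [mul_sub, Finset.sum_sub_distrib]

lemma int_sum_sub {f g : Fin 3 → X4 → ℝ} (hf : ∀ j, Integrable (f j)) (hg : ∀ j, Integrable (g j)) :
    ∫ z, ∑ j, (f j z - g j z) = ∑ j, ((∫ z, f j z) - ∫ z, g j z) := by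
  rw [integral_finsetSum _ fun j _ => (show Integrable (fun z => f j z - g j z) from (hf j).sub (hg j))]
  exact Finset.sum_congr rfl fun j _ => integral_sub (hf j) (hg j)

lemma ve_sol (hΩ : IsOpen Ω) (h : IsSuitableWeakSolution Ω T v Dv p v₀) (a b : Fin 3)
    {ψ : X4 → ℝ} (hψ : TF ψ) (hs : tsupport ψ ⊆ Ω ×ˢ Ioo 0 T) :
    (∫ z, ww (Dx (Ω ×ˢ Ioo 0 T) Dv) a b z * heat ψ z) +
      (∫ z, FF (Vx (Ω ×ˢ Ioo 0 T) v) (Dx (Ω ×ˢ Ioo 0 T) Dv) b z * dd (ex a) ψ z)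
      - (∫ z, FF (Vx (Ω ×ˢ Ioo 0 T) v) (Dx (Ω ×ˢ Ioo 0 T) Dv) a z * dd (ex b) ψ z) = 0 := by
  set O := Ω ×ˢ Ioo 0 T with hOd
  have hO : IsOpen O := hΩ.prod isOpen_Ioo
  set V := Vx O v with hVd
  set D := Dx O Dv with hDd
  have hV : ∀ j, MemLp (V j) 2 volume := Vx_L2 hΩ h
  have hD : ∀ i j, MemLp (D i j) 2 volume := Dx_L2 hΩ h
  have wg : ∀ i j (ψ : X4 → ℝ), TF ψ → tsupport ψ ⊆ O →
    ∫ z, V j z * dd (ex i) ψ z = - ∫ z, D i j z * ψ z := fun i j ψ h1 h2 => wg_sol hΩ h i j h1 h2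
  have tA := hψ.dd (ex a)
  have tB := hψ.dd (ex b)
  set A := dd (ex a) ψ with hA
  set B := dd (ex b) ψ with hB
  have N := h.weak_nse (phi2 A B a b) ?_ ?_ ?_
  rotate_left
  · exact (tA.sm.smul contDiff_const).sub (tB.sm.smul contDiff_const)
  · refine HasCompactSupport.intro hψ.cp fun z hz => ?_
    have z1 : A z = 0 := image_eq_zero_of_notMem_tsupport fun h => hz (tsupport_dd ψ _ h)
    have z2 : B z = 0 := image_eq_zero_of_notMem_tsupport fun h => hz (tsupport_dd ψ _ h)
    simp [phi2, z1, z2]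
  · have : tsupport (phi2 A B a b) ⊆ tsupport ψ := by
      apply closure_minimal _ (isClosed_tsupport ψ)
      intro z hz
      by_contra hn
      have z1 : A z = 0 := image_eq_zero_of_notMem_tsupport fun h => hn (tsupport_dd ψ _ h)
      have z2 : B z = 0 := image_eq_zero_of_notMem_tsupport fun h => hn (tsupport_dd ψ _ h)
      exact hz (by simp [phi2, z1, z2])
    exact this.trans (hs.trans (prod_mono_right fun t ht => ht.2))
  have rhs : ∫ x in Ω, ∑ i, v₀ x i * phi2 A B a b (x, 0) i = 0 := by
    have : ∀ x : E3, phi2 A B a b (x, 0) = 0 := by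
      intro x
      have hn : ((x, 0) : X4) ∉ tsupport ψ := fun hh => by
        have := (hs hh).2; simp at this
      have z1 : A (x, 0) = 0 := image_eq_zero_of_notMem_tsupport fun h => hn (tsupport_dd ψ _ h)
      have z2 : B (x, 0) = 0 := image_eq_zero_of_notMem_tsupport fun h => hn (tsupport_dd ψ _ h)
      simp [phi2, z1, z2]
    simp [this]
  rw [rhs, ← integral_indicator hO.measurableSet] at N
  have pw : ∀ z, O.indicator (fun z => (-(∑ i, v z i * tdz (phi2 A B a b) z i) + 
      (∑ i, ∑ j, v z j * Dv z j i * phi2 A B a b z i)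
          + (∑ i, ∑ j, Dv z j i * sdz (phi2 A B a b) j z i) - p z * ∑ i, sdz (phi2 A B a b) i z i)) z
      = V a z * dd et B z - V b z * dd et A z 
        + ∑ j, (V j z * D j b z * A z - V j z * D j a z * B z)
        + ∑ j, (D j b z * dd (ex j) A z - D j a z * dd (ex j) B z) := by
    intro z
    by_cases hz : z ∈ O
    · rw [indicator_of_mem hz]
      have e1 : ∑ i, v z i * tdz (phi2 A B a b) z i = v z b * dd et A z - v z a * dd et B z := by
        simp only [tdz, phi2_fderiv tA.diff tB.diff]
        exact ite_sum (fun i => v z i) _ _ a b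
      have e2 : ∑ i, ∑ j, v z j * Dv z j i * phi2 A B a b z i = 
          ∑ j, (v z j * Dv z j b * A z - v z j * Dv z j a * B z) := by
        rw [Finset.sum_comm]
        refine Finset.sum_congr rfl fun j _ => ?_
        simp only [phi2_apply]
        exact ite_sum (fun i => v z j * Dv z j i) _ _ a b
      have e3 : ∑ i, ∑ j, Dv z j i * sdz (phi2 A B a b) j z i = 
          ∑ j, (Dv z j b * dd (ex j) A z - Dv z j a * dd (ex j) B z) := by
        rw [Finset.sum_comm]
        refine Finset.sum_congr rfl fun j _ => ?_
        simp only [sdz, phi2_fderiv tA.diff tB.diff]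
        exact ite_sum (fun i => Dv z j i) _ _ a b
      have e4 : ∑ i, sdz (phi2 A B a b) i z i = 0 := by
        have : ∑ i, sdz (phi2 A B a b) i z i = dd (ex b) A z - dd (ex a) B z := by
          simp only [sdz, phi2_fderiv tA.diff tB.diff, Finset.sum_sub_distrib]
          simp [ex]
        rw [this, hA, hB, dd_comm hψ.sm]; simp
      rw [e1, e2, e3, e4]
      simp only [hVd, hDd, Vx, Dx, indicator_of_mem hz]; ring
    · simp [hVd, hDd, Vx, Dx, hz]
  simp_rw [pw] at N
  -- integrability
  have iV : ∀ j (g : X4 → ℝ), TF g → Integrable (fun z => V j z * g z) := fun j g hg =>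
    int_l2 (hV j) hg.memLp
  have iD : ∀ i j (g : X4 → ℝ), TF g → Integrable (fun z => D i j z * g z) := fun i j g hg =>
    int_l2 (hD i j) hg.memLp
  have i3 : ∀ k i j (g : X4 → ℝ), TF g → Integrable (fun z => V k z * D i j z * g z) := 
    fun k i j g hg => int3 (hV k) (hD i j) hg
  have N1 : Integrable fun z => V a z * dd et B z - V b z * dd et A z := 
    (iV a _ (tB.dd _)).sub (iV b _ (tA.dd _))
  have N2 : Integrable fun z => ∑ j, (V j z * D j b z * A z - V j z * D j a z * B z) :=
    integrable_finsetSum _ fun j _ => (i3 _ _ _ _ tA).sub (i3 _ _ _ _ tB)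
  have N3 : Integrable fun z => ∑ j, (D j b z * dd (ex j) A z - D j a z * dd (ex j) B z) :=
    integrable_finsetSum _ fun j _ => (iD _ _ _ (tA.dd _)).sub (iD _ _ _ (tB.dd _))
  have N12 : Integrable fun z => V a z * dd et B z - V b z * dd et A z 
        + ∑ j, (V j z * D j b z * A z - V j z * D j a z * B z) := N1.add N2
  have s2 : ∫ z, ∑ j, (V j z * D j b z * A z - V j z * D j a z * B z) = 
      ∑ j, ((∫ z, V j z * D j b z * A z) - ∫ z, V j z * D j a z * B z) :=
    int_sum_sub (fun j => i3 _ _ _ _ tA) (fun j => i3 _ _ _ _ tB)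
  have s3 : ∫ z, ∑ j, (D j b z * dd (ex j) A z - D j a z * dd (ex j) B z) =
      ∑ j, ((∫ z, D j b z * dd (ex j) A z) - ∫ z, D j a z * dd (ex j) B z) :=
    int_sum_sub (fun j => iD _ _ _ (tA.dd _)) (fun j => iD _ _ _ (tB.dd _))
  rw [integral_add N12 N3, integral_add N1 N2, integral_sub (iV a _ (tB.dd _)) (iV b _ (tA.dd _)),
    s2, s3] at N
  -- transform terms
  have sup1 : ∀ u, tsupport (dd u ψ) ⊆ O := fun u => (tsupport_dd ψ u).trans hs
  have sup2 : ∀ u u', tsupport (dd u (dd u' ψ)) ⊆ O := fun u u' => (tsupport_dd _ u).trans (sup1 u')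
  have q1 : ∫ z, V b z * dd et A z = - ∫ z, D a b z * dd et ψ z := by
    rw [hA, dd_comm hψ.sm, wg a b _ (hψ.dd _) (sup1 _)]
  have q2 : ∫ z, V a z * dd et B z = - ∫ z, D b a z * dd et ψ z := by
    rw [hB, dd_comm hψ.sm, wg b a _ (hψ.dd _) (sup1 _)]
  have q3 : ∀ j, ∫ z, D j b z * dd (ex j) A z = ∫ z, D a b z * dd (ex j) (dd (ex j) ψ) z := by
    intro j
    have h1 := wg j b _ (tA.dd (ex j)) (sup2 _ _)
    have h2 := wg a b _ ((hψ.dd (ex j)).dd (ex j)) (sup2 _ _)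
    rw [dd_comm (hψ.dd _).sm, dd_comm hψ.sm (ex a) (ex j)] at h2
    rw [hA] at h1 ⊢
    linarith
  have q4 : ∀ j, ∫ z, D j a z * dd (ex j) B z = ∫ z, D b a z * dd (ex j) (dd (ex j) ψ) z := by
    intro j
    have h1 := wg j a _ (tB.dd (ex j)) (sup2 _ _)
    have h2 := wg b a _ ((hψ.dd (ex j)).dd (ex j)) (sup2 _ _)
    rw [dd_comm (hψ.dd _).sm, dd_comm hψ.sm (ex b) (ex j)] at h2
    rw [hB] at h1 ⊢
    linarith
  have q5 : ∀ j, ∫ z, V j z * D b j z * A z = ∫ z, V j z * D a j z * B z := fun j =>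
    weak_chain hO (hV j) (hD a j) (hD b j) (wg a j) (wg b j) hψ hs
  rw [q1, q2] at N
  simp_rw [q3, q4] at N
  -- left side
  have l1 : ∫ z, ww D a b z * heat ψ z = 
      (∫ z, D a b z * dd et ψ z) - (∫ z, D b a z * dd et ψ z) +
      ∑ j, ((∫ z, D a b z * dd (ex j) (dd (ex j) ψ) z) - ∫ z, D b a z * dd (ex j) (dd (ex j) ψ) z) := by
    have : ∀ z, ww D a b z * heat ψ z = (D a b z * dd et ψ z - D b a z * dd et ψ z) +
        ∑ j, (D a b z * dd (ex j) (dd (ex j) ψ) z - D b a z * dd (ex j) (dd (ex j) ψ) z) := by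
      intro z; simp only [ww, heat, lap, Fin.sum_univ_three]; ring
    simp_rw [this]
    have j1 : Integrable fun z => D a b z * dd et ψ z - D b a z * dd et ψ z := 
      (iD _ _ _ (hψ.dd _)).sub (iD _ _ _ (hψ.dd _))
    have j2 : Integrable fun z => ∑ j, (D a b z * dd (ex j) (dd (ex j) ψ) z - D b a z * dd (ex j) (dd (ex j) ψ) z) :=
      integrable_finsetSum _ fun j _ => (iD _ _ _ ((hψ.dd _).dd _)).sub (iD _ _ _ ((hψ.dd _).dd _))
    rw [integral_add j1 j2, integral_sub (iD _ _ _ (hψ.dd _)) (iD _ _ _ (hψ.dd _))]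
    congr 1
    exact int_sum_sub (fun j => iD _ _ _ ((hψ.dd _).dd _)) (fun j => iD _ _ _ ((hψ.dd _).dd _))
  have l2 : ∀ c (g : X4 → ℝ), TF g → ∫ z, FF V D c z * g z = 
      ∑ j, ((∫ z, V j z * D j c z * g z) - ∫ z, V j z * D c j z * g z) := by
    intro c g hg
    have : ∀ z, FF V D c z * g z = ∑ j, (V j z * D j c z * g z - V j z * D c j z * g z) := by
      intro z; simp only [FF, ww, Fin.sum_univ_three]; ring
    simp_rw [this]
    exact int_sum_sub (fun j => i3 _ _ _ _ hg) (fun j => i3 _ _ _ _ hg)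
  rw [l1, l2 b A tA, l2 a B tB]
  simp only [Finset.sum_sub_distrib] at N ⊢
  have q6 : ∑ j, ∫ z, V j z * D b j z * A z = ∑ j, ∫ z, V j z * D a j z * B z := 
    Finset.sum_congr rfl fun j _ => q5 j
  linarith

lemma solD (hΩ : IsOpen Ω) (h : IsSuitableWeakSolution Ω T v Dv p v₀) :
    SolD (Ω ×ˢ Ioo 0 T) (Vx (Ω ×ˢ Ioo 0 T) v) (Dx (Ω ×ˢ Ioo 0 T) Dv) where
  hV := Vx_L2 hΩ h
  hD := Dx_L2 hΩ h
  wg := fun i j _ h1 h2 => wg_sol hΩ h i j h1 h2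
  dv := dv_sol hΩ h
  ve := fun a b _ h1 h2 => ve_sol hΩ h a b h1 h2

end sol2

/-- the (unnormalised) heat kernel, meaningful for positive time -/
def gl (z : X4) : ℝ := -(3/2) * Real.log z.2 - ‖z.1‖ ^ 2 / (4 * z.2)
def GG (z : X4) : ℝ := Real.exp (gl z)

lemma gl_fderiv {z : X4} (hz : 0 < z.2) : ∃ L : X4 →L[ℝ] ℝ, HasFDerivAt gl L z ∧
    (∀ i, L (ex i) = - (z.1 i / (2 * z.2))) ∧ L et = -(3/(2 * z.2)) + ‖z.1‖ ^ 2 / (4 * z.2 ^ 2) := by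
  have hf : HasFDerivAt (fun z : X4 => z.1) (ContinuousLinearMap.fst ℝ E3 ℝ) z := hasFDerivAt_fst
  have hs : HasFDerivAt (fun z : X4 => z.2) (ContinuousLinearMap.snd ℝ E3 ℝ) z := hasFDerivAt_snd
  have h1 := (hs.log hz.ne').const_mul (-(3/2 : ℝ))
  have hn := hf.norm_sq
  have hi := (hasDerivAt_inv (by positivity : (4 * z.2) ≠ 0)).comp_hasFDerivAt z (hs.const_mul 4)
  have h2 := hn.mul hi
  have h3 := h1.sub h2
  refine ⟨_, h3.congr_of_eventuallyEq ?_, ?_, ?_⟩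
  · refine Eventually.of_forall fun w => ?_
    simp [gl, div_eq_mul_inv]
  · intro i
    simp [ex, EuclideanSpace.inner_single_right]
    field_simp
    ring
  · simp [et]
    field_simp
    try ring

lemma GG_fderiv {z : X4} (hz : 0 < z.2) : ∃ L : X4 →L[ℝ] ℝ, HasFDerivAt GG L z ∧
    (∀ i, L (ex i) = - (z.1 i / (2 * z.2)) * GG z) ∧ 
    L et = (-(3/(2 * z.2)) + ‖z.1‖ ^ 2 / (4 * z.2 ^ 2)) * GG z := by
  obtain ⟨L, h1, h2, h3⟩ := gl_fderiv hz
  refine ⟨_, h1.exp, fun i => ?_, ?_⟩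
  · simp [h2, GG]; ring
  · simp [h3, GG]; ring

lemma pos_open : IsOpen {z : X4 | 0 < z.2} := isOpen_lt continuous_const continuous_snd

lemma dd_GG {q : X4 → ℝ} (hq : Differentiable ℝ q) {z : X4} (hz : 0 < z.2) (i : Fin 3) :
    dd (ex i) (fun z => GG z * q z) z = 
      GG z * (dd (ex i) q z - z.1 i / (2 * z.2) * q z) := by
  obtain ⟨L, h1, h2, h3⟩ := GG_fderiv hz
  have k : HasFDerivAt (fun z => GG z * q z) _ z := h1.mul (hq z).hasFDerivAt
  unfold dd
  rw [k.fderiv]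
  simp [h2]; ring

lemma dd_GG_t {q : X4 → ℝ} (hq : Differentiable ℝ q) {z : X4} (hz : 0 < z.2) :
    dd et (fun z => GG z * q z) z = 
      GG z * (dd et q z + (-(3/(2 * z.2)) + ‖z.1‖ ^ 2 / (4 * z.2 ^ 2)) * q z) := by
  obtain ⟨L, h1, h2, h3⟩ := GG_fderiv hz
  have k : HasFDerivAt (fun z => GG z * q z) _ z := h1.mul (hq z).hasFDerivAt
  unfold dd
  rw [k.fderiv]
  simp [h3]; ring

lemma dd_GG2 {q : X4 → ℝ} (hq : ContDiff ℝ (⊤ : ℕ∞) q) {z : X4} (hz : 0 < z.2) (i : Fin 3) :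
    dd (ex i) (dd (ex i) (fun z => GG z * q z)) z = 
      GG z * (dd (ex i) (dd (ex i) q) z - z.1 i / z.2 * dd (ex i) q z 
        + ((z.1 i) ^ 2 / (4 * z.2 ^ 2) - 1 / (2 * z.2)) * q z) := by
  obtain ⟨L, h1, h2, h3⟩ := GG_fderiv hz
  have e : dd (ex i) (fun z => GG z * q z) =ᶠ[nhds z] fun z => 
      GG z * (dd (ex i) q z - z.1 i / (2 * z.2) * q z) := by
    filter_upwards [pos_open.mem_nhds hz] with w hw
    exact dd_GG (hq.differentiable (by simp)) hw i
  have hqd : Differentiable ℝ q := hq.differentiable (by simp)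
  have hqd2 : Differentiable ℝ (dd (ex i) q) := (dd_smooth hq (ex i)).differentiable (by simp)
  have hf : HasFDerivAt (fun z : X4 => z.1 i) ((EuclideanSpace.proj i).comp (ContinuousLinearMap.fst ℝ E3 ℝ)) z := 
    ((EuclideanSpace.proj i : E3 →L[ℝ] ℝ).comp (ContinuousLinearMap.fst ℝ E3 ℝ)).hasFDerivAt
  have hs : HasFDerivAt (fun z : X4 => z.2) (ContinuousLinearMap.snd ℝ E3 ℝ) z := hasFDerivAt_snd
  have hi := (hasDerivAt_inv (by positivity : (2 * z.2) ≠ 0)).comp_hasFDerivAt z (hs.const_mul 2)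
  have k := (h1.mul ((hqd2 z).hasFDerivAt.sub ((hf.mul hi).mul (hqd z).hasFDerivAt)))
  have k2 : HasFDerivAt (fun z : X4 => GG z * (dd (ex i) q z - z.1 i / (2 * z.2) * q z)) _ z := k
  unfold dd at e ⊢
  rw [e.fderiv_eq]
  have k3 := k2.fderiv
  unfold dd at k3
  rw [k3]
  simp [h2]
  simp [ex]
  field_simp
  ring

lemma hk {q : X4 → ℝ} (hq : ContDiff ℝ (⊤ : ℕ∞) q) {z : X4} (hz : 0 < z.2) :
    dd et (fun z => GG z * q z) z - lap (fun z => GG z * q z) z =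
      GG z * (dd et q z - lap q z + ∑ i, z.1 i / z.2 * dd (ex i) q z) := by
  unfold lap
  simp_rw [dd_GG2 hq hz]
  rw [dd_GG_t (hq.differentiable (by simp)) hz, EuclideanSpace.norm_sq_eq]
  simp only [Fin.sum_univ_three, Real.norm_eq_abs, sq_abs]
  field_simp
  ring

lemma GG_smooth {z : X4} (hz : 0 < z.2) : ContDiffAt ℝ (⊤ : ℕ∞) GG z := by
  unfold GG gl
  refine ContDiffAt.exp (ContDiffAt.sub (contDiffAt_const.mul (contDiffAt_snd.log hz.ne')) ?_)
  exact (contDiffAt_fst.norm_sq ℝ).div (contDiffAt_const.mul contDiffAt_snd) (by positivity)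

lemma TF.GG {q : X4 → ℝ} (hq : TF q) {s₀ : ℝ} (hs : 0 < s₀) (h0 : ∀ z : X4, z.2 ≤ s₀ → q z = 0) :
    TF (fun z => GG z * q z) := by
  refine ⟨?_, hq.cp.mul_left⟩
  rw [contDiff_iff_contDiffAt]
  intro z
  by_cases hz : 0 < z.2
  · exact (GG_smooth hz).mul hq.sm.contDiffAt
  · have : (fun z => _root_.GG z * q z) =ᶠ[nhds z] fun _ => 0 := by
      have ho : IsOpen {w : X4 | w.2 < s₀} := isOpen_lt continuous_snd continuous_const
      filter_upwards [ho.mem_nhds (show z.2 < s₀ by linarith)] with w hw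
      simp [h0 w (le_of_lt hw)]
    exact contDiffAt_const.congr_of_eventuallyEq this

lemma GG_pos (z : X4) : 0 < GG z := Real.exp_pos _

lemma GG_bound1 {z : X4} (h1 : 1/16 ≤ z.2) : GG z ≤ 64 := by
  unfold GG gl
  have hz : 0 < z.2 := by linarith
  have : Real.log (1/16) ≤ Real.log z.2 := Real.log_le_log (by norm_num) h1
  have h2 : 0 ≤ ‖z.1‖ ^ 2 / (4 * z.2) := by positivity
  calc _ ≤ Real.exp (-(3/2) * Real.log (1/16)) := by
        apply Real.exp_le_exp.2; linarith
    _ = 64 := by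
        have : (1/16 : ℝ) = (1/4)^2 := by norm_num
        rw [this, Real.log_pow]
        have e : -(3/2) * (((2:ℕ):ℝ) * Real.log (1/4)) = ((3:ℕ):ℝ) * Real.log 4 := by
          rw [one_div, Real.log_inv]; push_cast; ring
        rw [e, ← Real.log_pow, Real.exp_log (by norm_num)]; norm_num

lemma GG_bound2 {z : X4} (hz : 0 < z.2) (h1 : z.2 ≤ 1) (h : 1/4 ≤ ‖z.1‖) : 
    GG z * (1 + 1 / z.2) ≤ 2 * 64 ^ 3 * 6 := by
  have e1 : GG z ≤ (1 / z.2) ^ 2 * Real.exp (- (1 / (64 * z.2))) := by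
    unfold GG gl
    have : (1 / z.2) ^ 2 = Real.exp (-2 * Real.log z.2) := by
      have : -2 * Real.log z.2 = ((2:ℕ):ℝ) * Real.log (1 / z.2) := by
        rw [one_div, Real.log_inv]; push_cast; ring
      rw [this, ← Real.log_pow, Real.exp_log (by positivity)]
    rw [this, ← Real.exp_add]
    apply Real.exp_le_exp.2
    have l := Real.log_nonpos hz.le h1
    have h4 : 1 / (64 * z.2) ≤ ‖z.1‖ ^ 2 / (4 * z.2) := by
      rw [div_le_div_iff₀ (by positivity) (by positivity)]
      have : (1/16 : ℝ) ≤ ‖z.1‖ ^ 2 := by nlinarith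
      nlinarith
    linarith
  have e2 : (1 + 1 / z.2) ≤ 2 * (1 / z.2) := by
    have : 1 ≤ 1 / z.2 := by rw [le_div_iff₀ hz]; linarith
    linarith
  have e3 := Real.pow_div_factorial_le_exp (x := 1 / (64 * z.2)) (by positivity) 3
  have e4 : (1 / z.2) ^ 3 * Real.exp (- (1 / (64 * z.2))) ≤ 64 ^ 3 * 6 := by
    rw [Real.exp_neg, ← div_eq_mul_inv, div_le_iff₀ (Real.exp_pos _)]
    have : (1 / z.2) ^ 3 = 64 ^ 3 * 6 * ((1 / (64 * z.2)) ^ 3 / (Nat.factorial 3)) := by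
      simp [Nat.factorial]; field_simp; try norm_num
    rw [this]
    exact mul_le_mul_of_nonneg_left e3 (by norm_num)
  calc GG z * (1 + 1 / z.2) ≤ ((1 / z.2) ^ 2 * Real.exp (- (1 / (64 * z.2)))) * (2 * (1 / z.2)) := by
        apply mul_le_mul e1 e2 (by positivity) (by positivity)
    _ = 2 * ((1 / z.2) ^ 3 * Real.exp (- (1 / (64 * z.2)))) := by ring
    _ ≤ _ := by linarith

/-- parabolic scaling -/
def ps (a : ℝ) (z : X4) : X4 := (a • z.1, a ^ 2 * z.2)

lemma map_ps {a : ℝ} (ha : 0 < a) :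
    Measure.map (ps a) (volume : Measure X4) = ENNReal.ofReal ((a ^ 5)⁻¹) • volume := by
  have h1 := Measure.map_addHaar_smul (volume : Measure E3) ha.ne'
  have h2 := Measure.map_addHaar_smul (volume : Measure ℝ) (pow_pos ha 2).ne'
  have : ps a = Prod.map (fun x : E3 => a • x) (fun t : ℝ => a ^ 2 • t) := rfl
  have hv : (volume : Measure X4) = (volume : Measure E3).prod (volume : Measure ℝ) := rfl
  rw [this, hv, ← Measure.map_prod_map _ _ (by fun_prop) (by fun_prop)]
  have e1 : (fun x : E3 => a • x) = (a • ·) := rfl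
  have e2 : (fun x : ℝ => a ^ 2 • x) = (a ^ 2 • ·) := rfl
  rw [e1, e2, h1, h2, Measure.prod_smul_left, Measure.prod_smul_right, smul_smul]
  congr 1
  rw [← ENNReal.ofReal_mul (by positivity)]
  congr 1
  simp [abs_of_pos ha]
  rw [← mul_inv, ← pow_add]

lemma ps_emb {a : ℝ} (ha : 0 < a) : MeasurableEmbedding (ps a) := by
  have h : ps a = Homeomorph.prodCongr (Homeomorph.smulOfNeZero a ha.ne') 
    (Homeomorph.smulOfNeZero (a ^ 2) (pow_pos ha 2).ne') := rfl
  rw [h]; exact Homeomorph.measurableEmbedding _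

lemma int_ps {a : ℝ} (ha : 0 < a) (f : X4 → ℝ) : ∫ z, f (ps a z) = (a ^ 5)⁻¹ * ∫ z, f z := by
  rw [← (ps_emb ha).integral_map, map_ps ha, integral_smul_measure, ENNReal.toReal_ofReal (by positivity)]
  rfl

lemma GG_ps {a : ℝ} (ha : 0 < a) {z : X4} (hz : 0 < z.2) : GG (ps a z) = (a ^ 3)⁻¹ * GG z := by
  unfold GG
  have : (a ^ 3)⁻¹ = Real.exp (- (3 * Real.log a)) := by
    rw [Real.exp_neg]; congr 1
    have : 3 * Real.log a = ((3 : ℕ) : ℝ) * Real.log a := by norm_num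
    rw [this, ← Real.log_pow, Real.exp_log (by positivity)]
  rw [this, ← Real.exp_add]
  congr 1
  simp only [gl, ps, norm_smul, Real.norm_eq_abs, mul_pow, sq_abs]
  rw [Real.log_mul (by positivity) hz.ne', Real.log_pow]
  push_cast
  field_simp
  ring

/-- transition -/
def mtr (s : ℝ) : ℝ := Real.smoothTransition (s - 1)

lemma mtr_smooth : ContDiff ℝ (⊤ : ℕ∞) mtr := Real.smoothTransition.contDiff.comp (contDiff_id.sub contDiff_const)
lemma mtr_zero {s : ℝ} (h : s ≤ 1) : mtr s = 0 := Real.smoothTransition.zero_of_nonpos (by linarith)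
lemma mtr_one {s : ℝ} (h : 2 ≤ s) : mtr s = 1 := Real.smoothTransition.one_of_one_le (by linarith)
lemma mtr_nonneg (s : ℝ) : 0 ≤ mtr s := Real.smoothTransition.nonneg _
lemma mtr_le (s : ℝ) : mtr s ≤ 1 := Real.smoothTransition.le_one _
lemma mtr_mono : Monotone mtr := fun a b h => Real.smoothTransition.monotone (by linarith)
lemma mtd_nonneg (s : ℝ) : 0 ≤ deriv mtr s := mtr_mono.deriv_nonneg
lemma mtd_smooth : ContDiff ℝ (⊤ : ℕ∞) (deriv mtr) := by
  have := mtr_smooth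
  exact this.deriv' 
lemma mtd_zero {s : ℝ} (h : s < 1) : deriv mtr s = 0 := by
  have : mtr =ᶠ[nhds s] fun _ => 0 := by
    filter_upwards [Iio_mem_nhds h] with w hw using mtr_zero (le_of_lt hw)
  rw [this.deriv_eq]; simp
lemma mtd_zero1 {s : ℝ} (h : s ≤ 1) : deriv mtr s = 0 := by
  rcases h.lt_or_eq with h | h
  · exact mtd_zero h
  · subst h
    have h1 : Tendsto (deriv mtr) (nhdsWithin 1 (Iio 1)) (nhds (deriv mtr 1)) := 
      (mtd_smooth.continuous.tendsto 1).mono_left nhdsWithin_le_nhds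
    have h2 : Tendsto (deriv mtr) (nhdsWithin 1 (Iio 1)) (nhds 0) := by
      apply tendsto_const_nhds.congr'
      filter_upwards [self_mem_nhdsWithin] with w hw using (mtd_zero hw).symm
    exact tendsto_nhds_unique h1 h2
lemma mtd_zero2 {s : ℝ} (h : 2 < s) : deriv mtr s = 0 := by
  have : mtr =ᶠ[nhds s] fun _ => 1 := by
    filter_upwards [Ioi_mem_nhds h] with w hw using mtr_one (le_of_lt hw)
  rw [this.deriv_eq]; simp
lemma mtd_TF : TF (deriv mtr) := by
  refine ⟨mtd_smooth, HasCompactSupport.intro (K := Icc 1 2) isCompact_Icc fun s hs => ?_⟩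
  by_cases h : s < 1
  · exact mtd_zero h
  · exact mtd_zero2 (by by_contra h2; exact hs ⟨not_lt.1 h, not_lt.1 h2⟩)

lemma gauss_int : Integrable (fun x : E3 => Real.exp (-(‖x‖ ^ 2 / 8))) := by
  have := (GaussianFourier.integrable_cexp_neg_mul_sq_norm_add (b := (1/8 : ℂ)) (by norm_num) 0 (0 : E3)).norm
  refine this.congr (Eventually.of_forall fun x => ?_)
  simp only [Complex.norm_exp]
  congr 1
  have : (-(1/8 : ℂ) * (‖x‖ : ℂ) ^ 2 + 0 * ((inner ℝ (0:E3) x : ℝ) : ℂ)) = ((-(‖x‖ ^ 2 / 8) : ℝ) : ℂ) := by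
    push_cast; ring
  rw [this, Complex.ofReal_re]

/-- the limiting approximate identity profile -/
def Gm (z : X4) : ℝ := GG z * deriv mtr z.2

lemma Gm_nonneg (z : X4) : 0 ≤ Gm z := mul_nonneg (GG_pos z).le (mtd_nonneg _)

lemma Gm_cont : Continuous Gm := by
  rw [continuous_iff_continuousAt]
  intro z
  by_cases hz : 0 < z.2
  · exact (GG_smooth hz).continuousAt.mul (mtd_smooth.continuous.continuousAt.comp continuousAt_snd)
  · have : Gm =ᶠ[nhds z] fun _ => 0 := by
      have ho : IsOpen {w : X4 | w.2 < 1} := isOpen_lt continuous_snd continuous_const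
      filter_upwards [ho.mem_nhds (show z.2 < 1 by linarith)] with w hw
      simp [Gm, mtd_zero hw]
    exact continuousAt_const.congr this.symm

lemma Gm_int : Integrable Gm := by
  have h : Integrable (fun z : X4 => Real.exp (-(‖z.1‖ ^ 2 / 8)) * deriv mtr z.2) :=
    gauss_int.mul_prod mtd_TF.integrable
  refine h.mono Gm_cont.aestronglyMeasurable (Eventually.of_forall fun z => ?_)
  rw [Real.norm_of_nonneg (Gm_nonneg z), Real.norm_of_nonneg (mul_nonneg (Real.exp_pos _).le (mtd_nonneg _))]
  by_cases h1 : z.2 < 1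
  · simp [Gm, mtd_zero h1]
  by_cases h2 : 2 < z.2
  · simp [Gm, mtd_zero2 h2]
  push Not at h1 h2
  refine mul_le_mul_of_nonneg_right ?_ (mtd_nonneg _)
  unfold GG gl
  apply Real.exp_le_exp.2
  have l := Real.log_nonneg h1
  have : ‖z.1‖ ^ 2 / 8 ≤ ‖z.1‖ ^ 2 / (4 * z.2) := by
    apply div_le_div_of_nonneg_left (by positivity) (by positivity) (by linarith)
  linarith

def c0 : ℝ := ∫ z, Gm z

lemma c0_pos : 0 < c0 := by
  unfold c0
  rw [integral_pos_iff_support_of_nonneg Gm_nonneg Gm_int]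
  have ho : IsOpen (Function.support Gm) := Gm_cont.isOpen_support
  refine ho.measure_pos (volume : Measure X4) ?_
  obtain ⟨s, hs, e⟩ := exists_deriv_eq_slope mtr (by norm_num : (1:ℝ) < 2) mtr_smooth.continuous.continuousOn
    (mtr_smooth.differentiable (by simp)).differentiableOn
  refine ⟨((0 : E3), s), ?_⟩
  simp only [Function.mem_support, Gm]
  rw [e, mtr_one le_rfl, mtr_zero le_rfl]
  have := GG_pos ((0 : E3), s)
  norm_num
  exact this.ne'

def eta0 : ContDiffBump (0 : E3) := ⟨1/4, 1/2, by norm_num, by norm_num⟩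
def tht0 : ContDiffBump (0 : ℝ) := ⟨1/16, 1/4, by norm_num, by norm_num⟩
def chi (z : X4) : ℝ := eta0 z.1 * tht0 z.2

lemma prod_TF {f : E3 → ℝ} {g : ℝ → ℝ} (hf : TF f) (hg : TF g) : TF (fun z : X4 => f z.1 * g z.2) := by
  refine ⟨(hf.sm.comp contDiff_fst).mul (hg.sm.comp contDiff_snd), ?_⟩
  refine HasCompactSupport.intro (K := tsupport f ×ˢ tsupport g) (hf.cp.isCompact.prod hg.cp.isCompact) ?_
  intro z hz
  by_cases h : z.1 ∈ tsupport f
  · have : z.2 ∉ tsupport g := fun h2 => hz ⟨h, h2⟩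
    simp [image_eq_zero_of_notMem_tsupport this]
  · simp [image_eq_zero_of_notMem_tsupport h]

lemma prod_supp (f : E3 → ℝ) (g : ℝ → ℝ) : tsupport (fun z : X4 => f z.1 * g z.2) ⊆ tsupport f ×ˢ tsupport g := by
  refine closure_minimal ?_ ((isClosed_tsupport f).prod (isClosed_tsupport g))
  intro z hz
  simp only [Function.mem_support, ne_eq, mul_eq_zero, not_or] at hz
  exact ⟨subset_tsupport _ hz.1, subset_tsupport _ hz.2⟩

lemma bump_TF {E : Type*} [NormedAddCommGroup E] [InnerProductSpace ℝ E] [FiniteDimensional ℝ E] {c : E} (f : ContDiffBump c) : TF f :=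
  ⟨f.contDiff, f.hasCompactSupport⟩

lemma chi_TF : TF chi := prod_TF (bump_TF eta0) (bump_TF tht0)

lemma chi_supp : tsupport chi ⊆ Metric.closedBall 0 (1/2) ×ˢ Metric.closedBall 0 (1/4) := by
  refine (prod_supp _ _).trans ?_
  rw [eta0.tsupport_eq, tht0.tsupport_eq]; rfl

lemma chi_nonneg (z : X4) : 0 ≤ chi z := mul_nonneg eta0.nonneg tht0.nonneg
lemma chi_le (z : X4) : chi z ≤ 1 := mul_le_one₀ eta0.le_one tht0.nonneg tht0.le_one

lemma dd_snd {g : ℝ → ℝ} (hg : Differentiable ℝ g) (u z : X4) :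
    dd u (fun z : X4 => g z.2) z = deriv g z.2 * u.2 := by
  have h := (hg z.2).hasDerivAt.comp_hasFDerivAt z (hasFDerivAt_snd (𝕜 := ℝ) (p := z))
  have h2 : HasFDerivAt (fun z : X4 => g z.2) _ z := h
  unfold dd
  rw [h2.fderiv]; simp

lemma chi_x {z : X4} (h : ‖z.1‖ < 1/4) (i : Fin 3) : dd (ex i) chi z = 0 := by
  have ho : IsOpen {w : X4 | ‖w.1‖ < 1/4} := isOpen_lt (by fun_prop) continuous_const
  have e : chi =ᶠ[nhds z] fun w => tht0 w.2 := by
    filter_upwards [ho.mem_nhds h] with w hw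
    have : eta0 w.1 = 1 := eta0.one_of_mem_closedBall (by simp [eta0]; exact (le_of_lt hw).trans (by norm_num))
    simp [chi, this]
  have := dd_snd (tht0.contDiff.differentiable (n := 1) (by simp)) (ex i) z
  unfold dd at this ⊢
  rw [e.fderiv_eq, this]; simp [ex]

lemma chi_xx {z : X4} (h : ‖z.1‖ < 1/4) (i j : Fin 3) : dd (ex j) (dd (ex i) chi) z = 0 := by
  have ho : IsOpen {w : X4 | ‖w.1‖ < 1/4} := isOpen_lt (by fun_prop) continuous_const
  have e : dd (ex i) chi =ᶠ[nhds z] fun w => 0 := by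
    filter_upwards [ho.mem_nhds h] with w hw using chi_x hw i
  rw [dd, e.fderiv_eq]; simp

lemma chi_one {z : X4} (h : ‖z.1‖ < 1/4) (h2 : |z.2| < 1/16) : chi z = 1 := by
  have : eta0 z.1 = 1 := eta0.one_of_mem_closedBall (by simp [eta0]; exact (le_of_lt h).trans (by norm_num))
  have h3 : tht0 z.2 = 1 := tht0.one_of_mem_closedBall (by simp [tht0]; exact (le_of_lt h2).trans (by norm_num))
  simp [chi, this, h3]

lemma chi_t {z : X4} (h : ‖z.1‖ < 1/4) (h2 : |z.2| < 1/16) : dd et chi z = 0 := by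
  have ho : IsOpen {w : X4 | ‖w.1‖ < 1/4 ∧ |w.2| < 1/16} := 
    (isOpen_lt (f := fun w : X4 => ‖w.1‖) (by fun_prop) continuous_const).inter 
      (isOpen_lt (f := fun w : X4 => |w.2|) (by fun_prop) continuous_const)
  have e : chi =ᶠ[nhds z] fun w => 1 := by
    filter_upwards [ho.mem_nhds ⟨h, h2⟩] with w hw using chi_one hw.1 hw.2
  rw [dd, e.fderiv_eq]; simp

def mz (a : ℝ) (z : X4) : ℝ := mtr (z.2 / a ^ 2)
lemma mz_smooth (a : ℝ) : ContDiff ℝ (⊤ : ℕ∞) (mz a) := mtr_smooth.comp (contDiff_snd.div_const _)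
lemma dd_mz (a : ℝ) (u z : X4) : dd u (mz a) z = deriv mtr (z.2 / a ^ 2) / a ^ 2 * u.2 := by
  have hd : Differentiable ℝ (fun s : ℝ => mtr (s / a ^ 2)) := 
    (mtr_smooth.differentiable (by simp)).comp (differentiable_id.div_const _)
  have := dd_snd hd u z
  unfold mz; rw [this]
  congr 1
  have h1 : HasDerivAt (fun s : ℝ => s / a ^ 2) (1 / a ^ 2) z.2 := (hasDerivAt_id _).div_const _
  have h2 := ((mtr_smooth.differentiable (by simp)) (z.2 / a ^ 2)).hasDerivAt.comp z.2 h1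
  have h3 : HasDerivAt (fun s : ℝ => mtr (s / a ^ 2)) _ z.2 := h2
  rw [h3.deriv]; ring

def qa (a : ℝ) (z : X4) : ℝ := mz a z * chi z
lemma qa_TF (a : ℝ) : TF (qa a) := TF.mul (mz_smooth a) chi_TF
lemma qa_zero {a : ℝ} (ha : 0 < a) {z : X4} (h : z.2 ≤ a ^ 2) : qa a z = 0 := by
  have : mz a z = 0 := mtr_zero (by rw [div_le_one (by positivity)]; exact h)
  simp [qa, this]
def Ka (a : ℝ) (z : X4) : ℝ := GG z * qa a z
lemma Ka_TF {a : ℝ} (ha : 0 < a) : TF (Ka a) := TF.GG (qa_TF a) (pow_pos ha 2) fun _ h => qa_zero ha h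
def Aa (a : ℝ) (z : X4) : ℝ := GG z * (deriv mtr (z.2 / a ^ 2) / a ^ 2 * chi z)
lemma Aa_TF {a : ℝ} (ha : 0 < a) : TF (Aa a) := by
  refine TF.GG (TF.mul (f := fun z => deriv mtr (z.2 / a ^ 2) / a ^ 2) ?_ chi_TF) (pow_pos ha 2) fun z h => ?_
  · exact (mtd_smooth.comp (contDiff_snd.div_const _)).div_const _
  · have : deriv mtr (z.2 / a ^ 2) = 0 := mtd_zero1 (by rw [div_le_one (by positivity)]; exact h)
    simp [this]
def Ba (a : ℝ) (z : X4) : ℝ := (dd et (Ka a) z - lap (Ka a) z) - Aa a z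
lemma Ba_TF {a : ℝ} (ha : 0 < a) : TF (Ba a) := 
  (((Ka_TF ha).dd et).sub (Ka_TF ha).lap).sub (Aa_TF ha)

lemma dd_qa_x (a : ℝ) (i : Fin 3) : dd (ex i) (qa a) = fun z => mz a z * dd (ex i) chi z := by
  funext z
  have := dd_mul ((mz_smooth a).differentiable (by simp)) chi_TF.diff (ex i) z
  unfold qa; rw [this, dd_mz]; simp [ex]

lemma dd_qa_xx (a : ℝ) (i : Fin 3) : dd (ex i) (dd (ex i) (qa a)) = fun z => mz a z * dd (ex i) (dd (ex i) chi) z := by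
  rw [dd_qa_x]
  funext z
  have := dd_mul ((mz_smooth a).differentiable (by simp)) (chi_TF.dd (ex i)).diff (ex i) z
  rw [this, dd_mz]; simp [ex]

lemma dd_qa_t (a : ℝ) (z : X4) : dd et (qa a) z = mz a z * dd et chi z + deriv mtr (z.2 / a ^ 2) / a ^ 2 * chi z := by
  have := dd_mul ((mz_smooth a).differentiable (by simp)) chi_TF.diff et z
  unfold qa; rw [this, dd_mz]; simp [et]

lemma Ba_pos (a : ℝ) {z : X4} (hz : 0 < z.2) : Ba a z = 
    mz a z * (GG z * (dd et chi z - lap chi z + ∑ i, z.1 i / z.2 * dd (ex i) chi z)) := by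
  have h := hk (qa_TF a).sm hz
  unfold Ba Aa
  have e : Ka a = fun z => GG z * qa a z := rfl
  rw [e, h]
  unfold lap
  simp only [dd_qa_xx]
  simp only [dd_qa_x, dd_qa_t, Fin.sum_univ_three]
  ring

lemma Ba_neg {a : ℝ} (ha : 0 < a) {z : X4} (hz : z.2 ≤ 0) : Ba a z = 0 := by
  have ho : IsOpen {w : X4 | w.2 < a ^ 2} := isOpen_lt continuous_snd continuous_const
  have hm : z ∈ {w : X4 | w.2 < a ^ 2} := lt_of_le_of_lt hz (pow_pos ha 2)
  have e : ∀ w ∈ {w : X4 | w.2 < a ^ 2}, Ka a w = 0 := by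
    intro w hw; simp [Ka, qa_zero ha (le_of_lt hw)]
  have e1 : ∀ u, ∀ w ∈ {w : X4 | w.2 < a ^ 2}, dd u (Ka a) w = 0 := by
    intro u w hw
    have : Ka a =ᶠ[nhds w] fun _ => 0 := by filter_upwards [ho.mem_nhds hw] with y hy using e y hy
    rw [dd, this.fderiv_eq]; simp
  have e2 : ∀ u, dd u (dd u (Ka a)) z = 0 := by
    intro u
    have : dd u (Ka a) =ᶠ[nhds z] fun _ => 0 := by filter_upwards [ho.mem_nhds hm] with y hy using e1 u y hy
    rw [dd, this.fderiv_eq]; simp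
  have e3 : deriv mtr (z.2 / a ^ 2) = 0 := mtd_zero1 (by rw [div_le_one (by positivity)]; exact le_of_lt hm)
  simp [Ba, Aa, lap, e1 _ _ hm, e2, e3]

lemma supp_dd_zero {z : X4} (h : z ∉ tsupport chi) (u w : X4) : dd u chi z = 0 ∧ dd w (dd u chi) z = 0 :=
  ⟨image_eq_zero_of_notMem_tsupport fun h2 => h (tsupport_dd _ _ h2), 
   image_eq_zero_of_notMem_tsupport fun h2 => h (tsupport_dd _ _ (tsupport_dd _ _ h2))⟩

lemma Ba_bdd : ∃ C, 0 ≤ C ∧ ∀ a, 0 < a → ∀ z, |Ba a z| ≤ C := by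
  obtain ⟨C1, h1⟩ := (chi_TF.dd et).bdd
  obtain ⟨C2, h2⟩ := chi_TF.lap.bdd
  choose C3 h3 using fun i => (chi_TF.dd (ex i)).bdd
  have p1 : 0 ≤ C1 := (norm_nonneg _).trans (h1 0)
  have p2 : 0 ≤ C2 := (norm_nonneg _).trans (h2 0)
  have p3 : ∀ i, 0 ≤ C3 i := fun i => (norm_nonneg _).trans (h3 i 0)
  set S := C1 + C2 + ∑ i, C3 i with hS
  have pS : 0 ≤ S := by have := Finset.sum_nonneg fun i (_ : i ∈ Finset.univ) => p3 i; positivity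
  refine ⟨2 * 64 ^ 3 * 6 * S, by positivity, fun a ha z => ?_⟩
  have pos : 0 ≤ 2 * 64 ^ 3 * 6 * S := by positivity
  by_cases hz : z.2 ≤ 0
  · rw [Ba_neg ha hz]; simpa using pos
  push Not at hz
  rw [Ba_pos a hz, abs_mul, abs_of_nonneg (show 0 ≤ mz a z from mtr_nonneg _)]
  refine (mul_le_of_le_one_left (abs_nonneg _) (mtr_le _)).trans ?_
  by_cases hs : z ∈ tsupport chi
  swap
  · have : lap chi z = 0 := by unfold lap; simp [(supp_dd_zero hs _ _).2]
    simp [(supp_dd_zero hs _ 0).1, this]; exact pS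
  obtain ⟨s1, s2⟩ := chi_supp hs
  simp only [Metric.mem_closedBall, dist_zero_right, Real.norm_eq_abs] at s1 s2
  rw [abs_mul, abs_of_pos (GG_pos z)]
  by_cases hy : ‖z.1‖ < 1/4
  · have l0 : lap chi z = 0 := by unfold lap; simp [chi_xx hy]
    simp only [l0, chi_x hy]
    by_cases ht : |z.2| < 1/16
    · simp [chi_t hy ht]; exact pS
    · have : 1/16 ≤ z.2 := by rw [abs_of_pos hz] at ht; linarith
      have g := GG_bound1 this
      simp only [sub_zero, mul_zero, Finset.sum_const_zero, add_zero]
      have k := h1 z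
      rw [Real.norm_eq_abs] at k
      have : C1 ≤ S := by have := Finset.sum_nonneg fun i (_ : i ∈ Finset.univ) => p3 i; linarith
      calc GG z * |dd et chi z| ≤ 64 * S := mul_le_mul g (k.trans this) (abs_nonneg _) (by norm_num)
        _ ≤ _ := by linarith
  · push Not at hy
    have z1 : z.2 ≤ 1 := by rw [abs_of_pos hz] at s2; linarith
    have g := GG_bound2 hz z1 hy
    have k : |dd et chi z - lap chi z + ∑ i, z.1 i / z.2 * dd (ex i) chi z| ≤ (1 + 1 / z.2) * S := by
      have a1 := h1 z
      have a2 := h2 z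
      rw [Real.norm_eq_abs] at a1 a2
      have a3 : |∑ i, z.1 i / z.2 * dd (ex i) chi z| ≤ 1 / z.2 * ∑ i, C3 i := by
        rw [Finset.mul_sum]
        refine (Finset.abs_sum_le_sum_abs _ _).trans (Finset.sum_le_sum fun i _ => ?_)
        rw [abs_mul, abs_div, abs_of_pos hz]
        have b1 := h3 i z
        rw [Real.norm_eq_abs] at b1
        have b2 : |z.1 i| ≤ 1 := by
          have := PiLp.norm_apply_le z.1 i
          rw [Real.norm_eq_abs] at this; linarith
        apply mul_le_mul _ b1 (abs_nonneg _) (by positivity)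
        gcongr
      have q : 0 ≤ 1 / z.2 := by positivity
      calc _ ≤ |dd et chi z| + |lap chi z| + |∑ i, z.1 i / z.2 * dd (ex i) chi z| := 
            (abs_add_le _ _).trans (add_le_add_left (abs_sub _ _) _)
        _ ≤ C1 + C2 + 1 / z.2 * ∑ i, C3 i := by linarith
        _ ≤ _ := by
            have := Finset.sum_nonneg fun i (_ : i ∈ Finset.univ) => p3 i
            rw [hS]
            nlinarith [mul_nonneg q p1, mul_nonneg q p2]
    calc _ ≤ GG z * ((1 + 1 / z.2) * S) := mul_le_mul_of_nonneg_left k (GG_pos z).le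
      _ = (GG z * (1 + 1 / z.2)) * S := by ring
      _ ≤ _ := mul_le_mul_of_nonneg_right g pS

lemma cr_supp {E : Type*} [NormedAddCommGroup E] [MeasurableSpace E] {μ : Measure E} {f g : E → ℝ}
    (hf : HasCompactSupport f) (hg : HasCompactSupport g) :
    tsupport (cr μ f g) ⊆ {w | ∃ y ∈ tsupport f, w + y ∈ tsupport g} := by
  have hc : IsCompact ((fun p : E × E => p.1 - p.2) '' (tsupport g ×ˢ tsupport f)) :=
    (hg.isCompact.prod hf.isCompact).image (by fun_prop)
  refine (closure_minimal (t := (fun p : E × E => p.1 - p.2) '' (tsupport g ×ˢ tsupport f)) ?_ hc.isClosed).trans ?_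
  · intro z hz
    by_contra hn
    apply hz
    unfold cr
    have : ∀ y, f y * g (z + y) = 0 := by
      intro y
      by_cases hy : y ∈ tsupport f
      · have : z + y ∉ tsupport g := fun h2 => hn ⟨(z + y, y), ⟨h2, hy⟩, by simp⟩
        simp [image_eq_zero_of_notMem_tsupport this]
      · simp [image_eq_zero_of_notMem_tsupport hy]
    simp [this]
  · rintro _ ⟨⟨p, q⟩, ⟨h1, h2⟩, rfl⟩
    exact ⟨q, h2, by simpa using h1⟩

lemma cr_int {f g : X4 → ℝ} (hf : TF f) (hg : TF g) (z : X4) : Integrable (fun y => f y * g (z + y)) :=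
  TF.integrable (TF.mul hf.sm (hg.shift z))

lemma heat_cr {K h : X4 → ℝ} (hK : TF K) (hh : TF h) (z : X4) :
    heat (cr volume K h) z = - cr volume (fun z => dd et K z - lap K z) h z := by
  unfold heat lap
  have e : ∀ u, dd u (dd u (cr volume K h)) z = cr volume (dd u (dd u K)) h z := by
    intro u
    rw [dd_cr hK hh, dd_cr hK (hh.dd u), cr_ibp hK (hh.dd u), cr_ibp (hK.dd u) hh, neg_neg]
  have e2 : dd et (cr volume K h) z = - cr volume (dd et K) h z := by
    rw [dd_cr hK hh, cr_ibp hK hh]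
  simp only [e, e2]
  have : cr volume (fun z => dd et K z - ∑ i, dd (ex i) (dd (ex i) K) z) h z = 
      cr volume (dd et K) h z - ∑ i, cr volume (dd (ex i) (dd (ex i) K)) h z := by
    unfold cr
    rw [← integral_finsetSum _ fun i _ => cr_int ((hK.dd _).dd _) hh z, ← integral_sub (cr_int (hK.dd _) hh z)
      (integrable_finsetSum _ fun i _ => cr_int ((hK.dd _).dd _) hh z)]
    congr 1; funext y; rw [sub_mul, Finset.sum_mul]
  rw [this]; ring

lemma cr_add_left {A B h : X4 → ℝ} (hA : TF A) (hB : TF B) (hh : TF h) (z : X4) :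
    cr volume (fun z => A z + B z) h z = cr volume A h z + cr volume B h z := by
  unfold cr
  rw [← integral_add (cr_int hA hh z) (cr_int hB hh z)]
  congr 1; funext y; ring

lemma crA_eq {a : ℝ} (ha : 0 < a) (h : X4 → ℝ) (z : X4) :
    cr volume (Aa a) h z = ∫ y, Gm y * (chi (ps a y) * h (z + ps a y)) := by
  unfold cr
  have := int_ps ha (fun y => Aa a y * h (z + y))
  have e : ∫ y, Aa a y * h (z + y) = a ^ 5 * ∫ y, Aa a (ps a y) * h (z + ps a y) := by
    rw [this]; field_simp
  rw [e, ← integral_const_mul]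
  congr 1; funext y
  have p2 : (ps a y).2 / a ^ 2 = y.2 := by simp only [ps]; field_simp
  simp only [Aa, Gm, p2]
  by_cases hy : 0 < y.2
  · rw [GG_ps ha hy]; field_simp
  · have : deriv mtr y.2 = 0 := mtd_zero1 (by linarith)
    simp [this]

lemma ps_tend (y : X4) : Tendsto (fun n : ℕ => ps (1 / ((n : ℝ) + 1)) y) atTop (nhds 0) := by
  have h := tendsto_one_div_add_atTop_nhds_zero_nat (𝕜 := ℝ)
  have h2 : Tendsto (fun n : ℕ => ((1 / ((n : ℝ) + 1)) • y.1, (1 / ((n : ℝ) + 1)) ^ 2 * y.2)) atTop (nhds ((0 : ℝ) • y.1, (0 : ℝ) ^ 2 * y.2)) :=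
    (h.smul_const _).prodMk_nhds ((h.pow 2).mul_const _)
  have e : ((0 : ℝ) • y.1, (0 : ℝ) ^ 2 * y.2) = (0 : X4) := by ext <;> simp
  rw [e] at h2
  exact h2

lemma crA_bdd {a : ℝ} (ha : 0 < a) {h : X4 → ℝ} {M : ℝ} (hM : ∀ z, ‖h z‖ ≤ M) (z : X4) :
    |cr volume (Aa a) h z| ≤ c0 * M := by
  rw [crA_eq ha, ← Real.norm_eq_abs]
  unfold c0
  rw [← integral_mul_const]
  apply norm_integral_le_of_norm_le (Gm_int.mul_const _)
  refine Eventually.of_forall fun y => ?_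
  rw [norm_mul, Real.norm_of_nonneg (Gm_nonneg y), norm_mul, Real.norm_of_nonneg (chi_nonneg _)]
  refine mul_le_mul_of_nonneg_left ?_ (Gm_nonneg y)
  exact (mul_le_of_le_one_left (norm_nonneg _) (chi_le _)).trans (hM _)

lemma crA_tend {h : X4 → ℝ} (hh : TF h) (z : X4) :
    Tendsto (fun n : ℕ => cr volume (Aa (1 / ((n : ℝ) + 1))) h z) atTop (nhds (c0 * h z)) := by
  obtain ⟨M, hM⟩ := hh.bdd
  have e : c0 * h z = ∫ y, Gm y * (chi 0 * h (z + 0)) := by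
    rw [integral_mul_const, add_zero, chi_one (by simp) (by simp), one_mul]; rfl
  rw [e]
  simp_rw [fun n : ℕ => crA_eq (show (0:ℝ) < 1 / ((n : ℝ) + 1) by positivity) h z]
  apply tendsto_integral_of_dominated_convergence (fun y => Gm y * M)
  · intro n
    refine (Gm_cont.mul ((chi_TF.cont.comp ?_).mul (hh.cont.comp (continuous_const.add ?_)))).aestronglyMeasurable <;>
    · unfold ps; fun_prop
  · exact Gm_int.mul_const _
  · intro n
    refine Eventually.of_forall fun y => ?_
    rw [norm_mul, Real.norm_of_nonneg (Gm_nonneg y), norm_mul, Real.norm_of_nonneg (chi_nonneg _)]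
    refine mul_le_mul_of_nonneg_left ?_ (Gm_nonneg y)
    exact (mul_le_of_le_one_left (norm_nonneg _) (chi_le _)).trans (hM _)
  · refine Eventually.of_forall fun y => ?_
    have t := ps_tend y
    refine tendsto_const_nhds.mul (Tendsto.mul ?_ ?_)
    · exact (chi_TF.cont.tendsto 0).comp t
    · exact (hh.cont.tendsto _).comp (tendsto_const_nhds.add t)

lemma Aa_supp {a : ℝ} (ha : 0 < a) : tsupport (Aa a) ⊆ Metric.closedBall 0 (1/2) ×ˢ Icc 0 (1/4) := by
  refine closure_minimal ?_ (Metric.isClosed_closedBall.prod isClosed_Icc)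
  intro z hz
  have h1 : chi z ≠ 0 := fun h => hz (by simp [Aa, h])
  have h2 : 0 ≤ z.2 := by
    by_contra h
    apply hz
    have : deriv mtr (z.2 / a ^ 2) = 0 := mtd_zero1 (by rw [div_le_one (by positivity)]; nlinarith [sq_nonneg a])
    simp [Aa, this]
  have h3 := chi_supp (subset_tsupport _ h1)
  refine ⟨h3.1, h2, ?_⟩
  have := h3.2
  simp at this
  exact (le_abs_self _).trans (this.trans (by norm_num))

lemma Ka_supp {a : ℝ} (ha : 0 < a) : tsupport (Ka a) ⊆ Metric.closedBall 0 (1/2) ×ˢ Icc 0 (1/4) := by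
  refine closure_minimal ?_ (Metric.isClosed_closedBall.prod isClosed_Icc)
  intro z hz
  have h1 : chi z ≠ 0 := fun h => hz (by simp [Ka, qa, h])
  have h2 : 0 ≤ z.2 := by
    by_contra h
    apply hz
    simp [Ka, qa_zero ha (show z.2 ≤ a ^ 2 by nlinarith [sq_nonneg a])]
  have h3 := chi_supp (subset_tsupport _ h1)
  refine ⟨h3.1, h2, ?_⟩
  have := h3.2
  simp at this
  exact (le_abs_self _).trans (this.trans (by norm_num))

lemma cr_supp_pcyl {f g : X4 → ℝ} (hf : TF f) (hg : TF g) 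
    (h1 : tsupport f ⊆ Metric.closedBall 0 (1/2) ×ˢ Icc 0 (1/4)) (h2 : tsupport g ⊆ pcyl 0 (1/2)) :
    tsupport (cr volume f g) ⊆ pcyl 0 1 := by
  refine (cr_supp hf.cp hg.cp).trans ?_
  rintro w ⟨y, hy, hw⟩
  obtain ⟨a1, a2, a3⟩ := h1 hy
  obtain ⟨b1, b2, b3⟩ := h2 hw
  simp at a1 b1 b2 b3
  refine ⟨?_, ?_, ?_⟩
  · simp
    have : w.1 = (w.1 + y.1) - y.1 := by simp
    rw [this]
    calc _ ≤ ‖w.1 + y.1‖ + ‖y.1‖ := norm_sub_le _ _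
      _ < 1 := by linarith
  · simp; linarith
  · simp; linarith

lemma heat_supp (ψ : X4 → ℝ) : tsupport (heat ψ) ⊆ tsupport ψ := by
  refine closure_minimal ?_ (isClosed_tsupport _)
  intro z hz
  by_contra h
  apply hz
  have a1 : ∀ u, dd u ψ z = 0 := fun u => image_eq_zero_of_notMem_tsupport fun h2 => h (tsupport_dd _ _ h2)
  have a2 : ∀ u, dd u (dd u ψ) z = 0 := fun u => image_eq_zero_of_notMem_tsupport fun h2 => h (tsupport_dd _ _ (tsupport_dd _ _ h2))
  simp [heat, lap, a1, a2]

/-- unit scale parametrix -/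
lemma parm1 : ∃ C : ℝ, 0 ≤ C ∧ ∀ h : X4 → ℝ, TF h → tsupport h ⊆ pcyl 0 (1/2) →
    ∃ (Ψ H B : ℕ → X4 → ℝ) (M : ℝ), ∀ n, TF (Ψ n) ∧ TF (H n) ∧ TF (B n) ∧ tsupport (Ψ n) ⊆ pcyl 0 1 ∧
      tsupport (H n) ⊆ pcyl 0 1 ∧ (∀ z, heat (Ψ n) z = B n z - H n z) ∧ (∀ z, |H n z| ≤ M) ∧
      (∀ z, |B n z| ≤ C * ∫ y, |h y|) ∧ ∀ z, Tendsto (fun n => H n z) atTop (nhds (c0 * h z)) := by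
  obtain ⟨C, hC, hB⟩ := Ba_bdd
  refine ⟨C, hC, fun h hh hs => ?_⟩
  obtain ⟨M, hM⟩ := hh.bdd
  have pos : ∀ n : ℕ, (0:ℝ) < 1 / ((n : ℝ) + 1) := fun n => by positivity
  refine ⟨fun n => cr volume (Ka (1 / ((n : ℝ) + 1))) h, fun n => cr volume (Aa (1 / ((n : ℝ) + 1))) h,
    fun n z => -1 * cr volume (Ba (1 / ((n : ℝ) + 1))) h z, c0 * M, fun n => ⟨?_, ?_, ?_, ?_, ?_, ?_, ?_, ?_, ?_⟩⟩
  · exact (Ka_TF (pos n)).cr hh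
  · exact (Aa_TF (pos n)).cr hh
  · exact TF.mul contDiff_const ((Ba_TF (pos n)).cr hh)
  · exact cr_supp_pcyl (Ka_TF (pos n)) hh (Ka_supp (pos n)) hs
  · exact cr_supp_pcyl (Aa_TF (pos n)) hh (Aa_supp (pos n)) hs
  · intro z
    have e : (fun z => dd et (Ka (1 / ((n : ℝ) + 1))) z - lap (Ka (1 / ((n : ℝ) + 1))) z) = 
        fun z => Aa (1 / ((n : ℝ) + 1)) z + Ba (1 / ((n : ℝ) + 1)) z := by
      funext z; simp [Ba]
    rw [heat_cr (Ka_TF (pos n)) hh, e, cr_add_left (Aa_TF (pos n)) (Ba_TF (pos n)) hh]; ring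
  · exact crA_bdd (pos n) hM
  · intro z
    beta_reduce
    rw [neg_one_mul, abs_neg, ← Real.norm_eq_abs, ← integral_const_mul, ← integral_add_left_eq_self _ z]
    apply norm_integral_le_of_norm_le ((hh.shift z).integrable.abs.const_mul _)
    refine Eventually.of_forall fun y => ?_
    rw [norm_mul]
    exact mul_le_mul_of_nonneg_right (hB _ (pos n) _) (norm_nonneg _)
  · exact crA_tend hh

def pl (a : ℝ) : X4 →L[ℝ] X4 := 
  (a • ContinuousLinearMap.fst ℝ E3 ℝ).prod (a ^ 2 • ContinuousLinearMap.snd ℝ E3 ℝ)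
lemma pl_apply (a : ℝ) (z : X4) : pl a z = ps a z := rfl
lemma ps_ps {a b : ℝ} (h : a * b = 1) (z : X4) : ps a (ps b z) = z := by
  ext1
  · simp [ps, smul_smul, h]
  · simp only [ps]; rw [← mul_assoc, ← mul_pow, h]; simp

def Shm (z0 : X4) (R : ℝ) (hR : 0 < R) : X4 ≃ₜ X4 where
  toFun z := z0 + ps R z
  invFun z := ps R⁻¹ (z - z0)
  left_inv z := by simp [ps_ps (inv_mul_cancel₀ hR.ne')]
  right_inv z := by simp [ps_ps (mul_inv_cancel₀ hR.ne')]
  continuous_toFun := continuous_const.add (pl R).continuous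
  continuous_invFun := (pl R⁻¹).continuous.comp (continuous_id.sub continuous_const)

lemma TF.ps {f : X4 → ℝ} (hf : TF f) (z0 : X4) {R : ℝ} (hR : 0 < R) : TF (fun z => f (z0 + ps R z)) :=
  ⟨hf.sm.comp (contDiff_const.add (pl R).contDiff), hf.cp.comp_homeomorph (Shm z0 R hR)⟩

lemma TF.psi {f : X4 → ℝ} (hf : TF f) (z0 : X4) {R : ℝ} (hR : 0 < R) : TF (fun z => f (_root_.ps R⁻¹ (z - z0))) :=
  ⟨hf.sm.comp ((pl R⁻¹).contDiff.comp (contDiff_id.sub contDiff_const)), hf.cp.comp_homeomorph (Shm z0 R hR).symm⟩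

lemma dd_psi {f : X4 → ℝ} (hf : Differentiable ℝ f) (z0 : X4) (R : ℝ) (u z : X4) :
    dd u (fun z => f (ps R⁻¹ (z - z0))) z = dd (ps R⁻¹ u) f (ps R⁻¹ (z - z0)) := by
  have h1 : HasFDerivAt (fun z => ps R⁻¹ (z - z0)) (pl R⁻¹) z := by
    have := (pl R⁻¹).hasFDerivAt.comp z ((hasFDerivAt_id z).sub_const z0)
    rw [ContinuousLinearMap.comp_id] at this
    exact this
  have h2 : HasFDerivAt (fun z => f (ps R⁻¹ (z - z0))) _ z := (hf (ps R⁻¹ (z - z0))).hasFDerivAt.comp z h1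
  unfold dd
  rw [h2.fderiv]; rfl

lemma ps_ex (a : ℝ) (i : Fin 3) : ps a (ex i) = a • ex i := by
  ext1 <;> simp [ps, ex]
lemma ps_et (a : ℝ) : ps a et = a ^ 2 • et := by
  ext1 <;> simp [ps, et]
lemma dd_smul (a : ℝ) (u : X4) (f : X4 → ℝ) (z : X4) : dd (a • u) f z = a * dd u f z := by
  simp [dd]
lemma dd_cmul {E : Type*} [NormedAddCommGroup E] [NormedSpace ℝ E] (a : ℝ) (u : E) {f : E → ℝ} (hf : Differentiable ℝ f) (z : E) : 
    dd u (fun z => a * f z) z = a * dd u f z := by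
  unfold dd
  rw [fderiv_const_mul (hf z)]; simp

lemma heat_psi {f : X4 → ℝ} (hf : TF f) (z0 : X4) {R : ℝ} (hR : 0 < R) (z : X4) :
    heat (fun z => R ^ 2 * f (ps R⁻¹ (z - z0))) z = heat f (ps R⁻¹ (z - z0)) := by
  unfold heat lap
  have e1 : ∀ i, dd (ex i) (fun z => R ^ 2 * f (ps R⁻¹ (z - z0))) = fun z => R * dd (ex i) f (ps R⁻¹ (z - z0)) := by
    intro i; funext z
    rw [dd_cmul _ _ (hf.psi z0 hR).diff, dd_psi hf.diff, ps_ex, dd_smul]; field_simp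
  have e2 : ∀ i, dd (ex i) (fun z => R * dd (ex i) f (ps R⁻¹ (z - z0))) z = dd (ex i) (dd (ex i) f) (ps R⁻¹ (z - z0)) := by
    intro i
    rw [dd_cmul _ _ ((hf.dd _).psi z0 hR).diff, dd_psi (hf.dd _).diff, ps_ex, dd_smul]; field_simp
  simp only [e1, e2]
  rw [dd_cmul _ _ (hf.psi z0 hR).diff, dd_psi hf.diff, ps_et, dd_smul]; field_simp

lemma pcyl_ps (z0 : X4) {R : ℝ} (hR : 0 < R) (r : ℝ) (z : X4) : z ∈ pcyl 0 r ↔ z0 + ps R z ∈ pcyl z0 (R * r) := by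
  simp only [pcyl, ps, mem_prod, Metric.mem_ball, mem_Ioo, dist_eq_norm, Prod.fst_add, Prod.snd_add, add_sub_cancel_left, Prod.fst_zero, Prod.snd_zero, sub_zero, norm_smul, Real.norm_eq_abs, abs_of_pos hR]
  have h2 := pow_pos hR 2
  constructor
  · rintro ⟨a, b, c⟩
    refine ⟨by nlinarith, by nlinarith, by nlinarith⟩
  · rintro ⟨a, b, c⟩
    refine ⟨lt_of_mul_lt_mul_left a hR.le, ?_, ?_⟩
    · refine lt_of_mul_lt_mul_left (a := R ^ 2) ?_ h2.le; nlinarith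
    · refine lt_of_mul_lt_mul_left (a := R ^ 2) ?_ h2.le; nlinarith

lemma parm : ∃ C : ℝ, 0 ≤ C ∧ ∀ (z0 : X4) (R : ℝ), 0 < R → ∀ h : X4 → ℝ, TF h → tsupport h ⊆ pcyl z0 (R/2) →
    ∃ (Ψ H B : ℕ → X4 → ℝ) (M : ℝ), ∀ n, TF (Ψ n) ∧ TF (H n) ∧ TF (B n) ∧ tsupport (Ψ n) ⊆ pcyl z0 R ∧
      tsupport (H n) ⊆ pcyl z0 R ∧ (∀ z, heat (Ψ n) z = B n z - H n z) ∧ (∀ z, |H n z| ≤ M) ∧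
      (∀ z, |B n z| ≤ C * ((R ^ 5)⁻¹ * ∫ y, |h y|)) ∧ ∀ z, Tendsto (fun n => H n z) atTop (nhds (c0 * h z)) := by
  obtain ⟨C, hC, hp⟩ := parm1
  refine ⟨C, hC, fun z0 R hR h hh hs => ?_⟩
  have hi : ∀ z, z0 + ps R (ps R⁻¹ (z - z0)) = z := fun z => by rw [ps_ps (mul_inv_cancel₀ hR.ne')]; simp
  have back : ∀ {f : X4 → ℝ}, tsupport f ⊆ pcyl 0 1 → tsupport (fun z => f (ps R⁻¹ (z - z0))) ⊆ pcyl z0 R := by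
    intro f hf z hz
    have := hf (tsupport_comp_subset_preimage f (Shm z0 R hR).symm.continuous hz)
    rw [pcyl_ps z0 hR 1] at this
    have e : z0 + ps R ((Shm z0 R hR).symm z) = z := (Shm z0 R hR).apply_symm_apply z
    rw [e, mul_one] at this
    exact this
  have hs' : tsupport (fun z => h (z0 + ps R z)) ⊆ pcyl 0 (1/2) := by
    intro z hz
    have := hs (tsupport_comp_subset_preimage h (Shm z0 R hR).continuous hz)
    rw [pcyl_ps z0 hR]
    have e : R * (1/2) = R / 2 := by ring
    rw [e]; exact this
  obtain ⟨Ψ, H, B, M, hn⟩ := hp _ (hh.ps z0 hR) hs'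
  refine ⟨fun n z => R ^ 2 * Ψ n (ps R⁻¹ (z - z0)), fun n z => H n (ps R⁻¹ (z - z0)), fun n z => B n (ps R⁻¹ (z - z0)), M, fun n => ?_⟩
  obtain ⟨a1, a2, a3, a4, a5, a6, a7, a8, a9⟩ := hn n
  refine ⟨TF.mul contDiff_const (a1.psi z0 hR), a2.psi z0 hR, a3.psi z0 hR, ?_, back a5, ?_, fun z => a7 _, ?_, ?_⟩
  · exact (tsupport_mul_subset_right (f := fun _ => R ^ 2)).trans (back a4)
  · intro z; rw [heat_psi a1 z0 hR, a6]
  · intro z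
    refine (a8 _).trans (le_of_eq ?_)
    congr 1
    rw [int_ps hR (fun y => |h (z0 + y)|), integral_add_left_eq_self (fun y => |h y|) z0]
  · intro z
    have := a9 (ps R⁻¹ (z - z0))
    rwa [hi] at this

section l2
variable {α : Type*} [MeasurableSpace α] {μ : Measure α}

lemma l2_sq {f : α → ℝ} : eLpNorm f 2 μ ^ 2 = ∫⁻ z, ‖f z‖ₑ ^ 2 ∂μ := by
  have := eLpNorm_nnreal_pow_eq_lintegral (μ := μ) (f := f) (p := 2) (by norm_num)
  simpa using this

lemma l2_eq {f : α → ℝ} (hf : MemLp f 2 μ) : eLpNorm f 2 μ = ENNReal.ofReal (Real.sqrt (∫ z, f z ^ 2 ∂μ)) := by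
  have h1 := (memLp_two_iff_integrable_sq hf.1).1 hf
  have e : eLpNorm f 2 μ ^ 2 = ENNReal.ofReal (Real.sqrt (∫ z, f z ^ 2 ∂μ)) ^ 2 := by
    rw [l2_sq, ← ENNReal.ofReal_pow (Real.sqrt_nonneg _), Real.sq_sqrt (integral_nonneg fun z => sq_nonneg _),
      ofReal_integral_eq_lintegral_ofReal h1 (Eventually.of_forall fun z => sq_nonneg _)]
    refine lintegral_congr fun z => ?_
    rw [← ofReal_norm, ← ENNReal.ofReal_pow (norm_nonneg _), Real.norm_eq_abs, sq_abs]
  refine le_antisymm ?_ ?_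
  · exact (ENNReal.pow_le_pow_left_iff (n := 2) (by norm_num)).1 e.le
  · exact (ENNReal.pow_le_pow_left_iff (n := 2) (by norm_num)).1 e.ge

lemma holder2 {f g : α → ℝ} (hf : AEStronglyMeasurable f μ) (hg : AEStronglyMeasurable g μ) :
    ∫⁻ z, ‖f z * g z‖ₑ ∂μ ≤ eLpNorm f 2 μ * eLpNorm g 2 μ := by
  have := eLpNorm_smul_le_mul_eLpNorm (p := 2) (q := 2) (r := 1) hg hf
  rw [eLpNorm_one_eq_lintegral_enorm] at this
  exact this

lemma cs2 {f g : α → ℝ} (hf : MemLp f 2 μ) (hg : MemLp g 2 μ) :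
    ∫ z, |f z * g z| ∂μ ≤ Real.sqrt (∫ z, f z ^ 2 ∂μ) * Real.sqrt (∫ z, g z ^ 2 ∂μ) := by
  have h := holder2 hf.1 hg.1
  rw [l2_eq hf, l2_eq hg, ← ENNReal.ofReal_mul (Real.sqrt_nonneg _)] at h
  have hi : Integrable (fun z => f z * g z) μ := hf.integrable_mul hg
  have e : ∫⁻ z, ‖f z * g z‖ₑ ∂μ = ENNReal.ofReal (∫ z, |f z * g z| ∂μ) := by
    rw [ofReal_integral_eq_lintegral_ofReal hi.abs (Eventually.of_forall fun z => abs_nonneg _)]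
    refine lintegral_congr fun z => ?_
    rw [← ofReal_norm, Real.norm_eq_abs]
  rw [e] at h
  exact (ENNReal.ofReal_le_ofReal_iff (by positivity)).1 h
end l2

instance h362 : ENNReal.HolderTriple 3 6 2 := by
  refine ⟨?_⟩
  rw [← ENNReal.toReal_eq_toReal_iff' (by simp) (by simp), ENNReal.toReal_add (by simp) (by simp)]
  norm_num

lemma clm_norm (L : E3 →L[ℝ] ℝ) : ‖L‖ ^ 2 ≤ ∑ j, (L (EuclideanSpace.single j 1)) ^ 2 := by
  have h : ‖L‖ ≤ ‖(InnerProductSpace.toDual ℝ E3).symm L‖ := by simp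
  have e : ∀ j, ((InnerProductSpace.toDual ℝ E3).symm L) j = L (EuclideanSpace.single j 1) := by
    intro j
    have : inner ℝ ((InnerProductSpace.toDual ℝ E3).symm L) (EuclideanSpace.single j (1:ℝ)) = L (EuclideanSpace.single j 1) := 
      InnerProductSpace.toDual_symm_apply
    rw [← this, EuclideanSpace.inner_single_right]; simp
  calc ‖L‖ ^ 2 ≤ ‖(InnerProductSpace.toDual ℝ E3).symm L‖ ^ 2 := by gcongr
    _ = _ := by rw [EuclideanSpace.norm_sq_eq]; simp [e]

def Csob : ℝ := (SNormLESNormFDerivOfEqConst ℝ (volume : Measure E3) 2 : NNReal)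
lemma Csob_nonneg : 0 ≤ Csob := NNReal.coe_nonneg _

lemma sob {ζ : E3 → ℝ} (h : TF ζ) : eLpNorm ζ 6 volume ≤ ENNReal.ofReal Csob * eLpNorm (fderiv ℝ ζ) 2 volume := by
  have := eLpNorm_le_eLpNorm_fderiv_of_eq (μ := (volume : Measure E3)) (h.sm.of_le (by exact_mod_cast le_top)) h.cp (p := 2) (p' := 6)
    (by norm_num) (by simp) (by simp; norm_num)
  unfold Csob
  rw [ENNReal.ofReal_coe_nnreal]
  exact this

lemma grad_g {g : X4 → ℝ} (hg : Measurable g) {ε : ℝ} (hε : 0 ≤ ε)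
    (h : ∀ᵐ t : ℝ, eLpNorm (fun x : E3 => g (x, t)) 3 volume ≤ ENNReal.ofReal ε) {u : X4 → ℝ} (hu : TF u) (a : Fin 3) :
    eLpNorm (fun z => g z * dd (ex a) u z) 2 volume ≤ ENNReal.ofReal (Csob * ε * Real.sqrt (∫ z, heat u z ^ 2)) := by
  have hm : Measurable (fun z => g z * dd (ex a) u z) := hg.mul (hu.dd _).cont.measurable
  have key : ∀ᵐ t : ℝ, ∫⁻ x : E3, ‖g (x, t) * dd (ex a) u (x, t)‖ₑ ^ 2 ≤ 
      ENNReal.ofReal (Csob * ε) ^ 2 * ∫⁻ x : E3, ENNReal.ofReal (∑ j, (dd (ex j) (dd (ex a) u) (x, t)) ^ 2) := by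
    filter_upwards [h] with t ht
    set ζ : E3 → ℝ := fun x => dd (ex a) u (x, t) with hζ
    have tf : TF ζ := (hu.dd _).slice t
    have h1 := eLpNorm_smul_le_mul_eLpNorm (p := 3) (q := 6) (r := 2) (μ := (volume : Measure E3)) (f := ζ) tf.cont.aestronglyMeasurable
      (φ := fun x => g (x, t)) (hg.comp (by fun_prop)).aestronglyMeasurable
    have h2 : eLpNorm ((fun x => g (x, t)) • ζ) 2 volume ≤ ENNReal.ofReal (Csob * ε) * eLpNorm (fderiv ℝ ζ) 2 volume := by
      refine h1.trans ?_
      rw [mul_comm Csob, ENNReal.ofReal_mul hε, mul_assoc]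
      gcongr
      exact sob tf
    have h3 : ∫⁻ x : E3, ‖g (x, t) * dd (ex a) u (x, t)‖ₑ ^ 2 = eLpNorm ((fun x => g (x, t)) • ζ) 2 volume ^ 2 := by
      rw [l2_sq]; rfl
    rw [h3]
    refine (pow_le_pow_left' h2 2).trans ?_
    rw [mul_pow]
    gcongr
    have h4 := eLpNorm_nnreal_pow_eq_lintegral (μ := (volume : Measure E3)) (f := fderiv ℝ ζ) (p := 2) (by norm_num)
    have h5 : eLpNorm (fderiv ℝ ζ) 2 volume ^ 2 = ∫⁻ x, ‖fderiv ℝ ζ x‖ₑ ^ 2 := by simpa using h4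
    rw [h5]
    refine lintegral_mono fun x => ?_
    rw [← ofReal_norm, ← ENNReal.ofReal_pow (norm_nonneg _)]
    apply ENNReal.ofReal_le_ofReal
    refine (clm_norm _).trans (le_of_eq ?_)
    congr 1; funext j
    congr 1
    exact fderiv_slice (hu.dd _).diff x t _
  have ti : Integrable (fun z => ∑ j, (dd (ex j) (dd (ex a) u) z) ^ 2) := 
    integrable_finsetSum _ fun j _ => ((memLp_two_iff_integrable_sq ((hu.dd _).dd _).cont.aestronglyMeasurable).1 ((hu.dd _).dd _).memLp)
  have tot : eLpNorm (fun z => g z * dd (ex a) u z) 2 volume ^ 2 ≤ ENNReal.ofReal (Csob * ε * Real.sqrt (∫ z, heat u z ^ 2)) ^ 2 := by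
    rw [l2_sq]
    have hv : (volume : Measure X4) = (volume : Measure E3).prod (volume : Measure ℝ) := rfl
    rw [hv, lintegral_prod_symm' _ (hm.enorm.pow_const 2)]
    refine (lintegral_mono_ae key).trans ?_
    rw [lintegral_const_mul' _ _ (by simp)]
    rw [← lintegral_prod_symm' (fun z : X4 => ENNReal.ofReal (∑ j, (dd (ex j) (dd (ex a) u) z) ^ 2)) 
      (ENNReal.measurable_ofReal.comp (Finset.measurable_sum _ fun j _ => (((hu.dd _).dd _).cont.measurable.pow_const 2)))]
    rw [← hv, ← ofReal_integral_eq_lintegral_ofReal ti (Eventually.of_forall fun z => Finset.sum_nonneg fun j _ => sq_nonneg _)]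
    rw [ENNReal.ofReal_mul (mul_nonneg Csob_nonneg hε), mul_pow]
    gcongr
    rw [← ENNReal.ofReal_pow (Real.sqrt_nonneg _), Real.sq_sqrt (integral_nonneg fun z => sq_nonneg _)]
    apply ENNReal.ofReal_le_ofReal
    refine le_trans ?_ (energy hu)
    rw [integral_finsetSum _ fun j _ => ((memLp_two_iff_integrable_sq ((hu.dd _).dd _).cont.aestronglyMeasurable).1 ((hu.dd _).dd _).memLp)]
    apply Finset.sum_le_sum
    intro j _
    exact Finset.single_le_sum (f := fun b => ∫ z, (dd (ex j) (dd (ex b) u) z) ^ 2) (fun b _ => integral_nonneg fun z => sq_nonneg _) (Finset.mem_univ a)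
  exact (ENNReal.pow_le_pow_left_iff (n := 2) (by norm_num)).1 tot

/-- the smallness setting -/
structure Smal (Q : Set X4) (ε : ℝ) (F : Fin 3 → X4 → ℝ) (W g : X4 → ℝ) : Prop where
  mW : Measurable W
  W2 : MemLp W 2 volume
  W0 : ∀ z, 0 ≤ W z
  mg : Measurable g
  he : 0 ≤ ε
  g3 : ∀ᵐ t : ℝ, eLpNorm (fun x : E3 => g (x, t)) 3 volume ≤ ENNReal.ofReal ε
  Fb : ∀ i, ∀ z ∈ Q, |F i z| ≤ W z * g z

def wn (W : X4 → ℝ) (S : Set X4) : ℝ := Real.sqrt (∫ z in S, W z ^ 2)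

lemma ES {Q : Set X4} {ε : ℝ} {F : Fin 3 → X4 → ℝ} {W g : X4 → ℝ} (h : Smal Q ε F W g) {S : Set X4} (hS : MeasurableSet S)
    (hSQ : S ⊆ Q) {u : X4 → ℝ} (hu : TF u) (hs : tsupport u ⊆ S) (a b : Fin 3) :
    |∫ z, F b z * dd (ex a) u z| ≤ Csob * ε * wn W S * Real.sqrt (∫ z, heat u z ^ 2) := by
  have hW : MemLp (S.indicator W) 2 volume := h.W2.indicator hS
  have e0 : eLpNorm (S.indicator W) 2 volume = ENNReal.ofReal (wn W S) := by
    rw [l2_eq hW]; congr 2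
    rw [← integral_indicator hS]
    congr 1; funext z; by_cases hz : z ∈ S <;> simp [hz]
  have h1 := enorm_integral_le_lintegral_enorm (μ := volume) (fun z => F b z * dd (ex a) u z)
  have h2 : ∫⁻ z, ‖F b z * dd (ex a) u z‖ₑ ≤ ∫⁻ z, ‖S.indicator W z * (g z * dd (ex a) u z)‖ₑ := by
    refine lintegral_mono fun z => ?_
    by_cases hz : z ∈ S
    · rw [← ofReal_norm, ← ofReal_norm]
      apply ENNReal.ofReal_le_ofReal
      simp only [indicator_of_mem hz, norm_mul, Real.norm_eq_abs]
      rw [← mul_assoc]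
      refine mul_le_mul_of_nonneg_right ?_ (abs_nonneg _)
      rw [← abs_mul]
      exact (h.Fb b z (hSQ hz)).trans (le_abs_self _)
    · have : dd (ex a) u z = 0 := image_eq_zero_of_notMem_tsupport fun h2 => hz (hs (tsupport_dd _ _ h2))
      simp [this]
  have h3 := (h1.trans h2).trans (holder2 hW.1 (h.mg.mul (hu.dd (ex a)).cont.measurable).aestronglyMeasurable)
  have h4 := h3.trans (mul_le_mul_right (grad_g h.mg h.he h.g3 hu a) _)
  rw [e0, ← ENNReal.ofReal_mul (show 0 ≤ wn W S from Real.sqrt_nonneg _), ← ofReal_norm, Real.norm_eq_abs] at h4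
  have p : 0 ≤ wn W S * (Csob * ε * Real.sqrt (∫ z, heat u z ^ 2)) := 
    mul_nonneg (Real.sqrt_nonneg _) (mul_nonneg (mul_nonneg Csob_nonneg h.he) (Real.sqrt_nonneg _))
  refine ((ENNReal.ofReal_le_ofReal_iff p).1 h4).trans (le_of_eq (by ring))

def n2 (f : X4 → ℝ) : ℝ := Real.sqrt (∫ z, f z ^ 2)
lemma n2_nonneg (f : X4 → ℝ) : 0 ≤ n2 f := Real.sqrt_nonneg _
lemma n2_sq (f : X4 → ℝ) : n2 f ^ 2 = ∫ z, f z ^ 2 := Real.sq_sqrt (integral_nonneg fun z => sq_nonneg _)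
lemma n2_eq {f : X4 → ℝ} (hf : MemLp f 2 volume) : eLpNorm f 2 volume = ENNReal.ofReal (n2 f) := l2_eq hf
lemma n2_add {f g : X4 → ℝ} (hf : MemLp f 2 volume) (hg : MemLp g 2 volume) : n2 (fun z => f z + g z) ≤ n2 f + n2 g := by
  have h := eLpNorm_add_le hf.1 hg.1 (p := 2) (by norm_num)
  rw [n2_eq (hf.add hg), n2_eq hf, n2_eq hg, ← ENNReal.ofReal_add (n2_nonneg _) (n2_nonneg _)] at h
  exact (ENNReal.ofReal_le_ofReal_iff (add_nonneg (n2_nonneg _) (n2_nonneg _))).1 h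
lemma n2_mono {f g : X4 → ℝ} (hf : MemLp f 2 volume) (hg : MemLp g 2 volume) (h : ∀ z, |f z| ≤ |g z|) : n2 f ≤ n2 g := by
  have := eLpNorm_mono (p := 2) (μ := volume) (f := f) (g := g) h
  rw [n2_eq hf, n2_eq hg] at this
  exact (ENNReal.ofReal_le_ofReal_iff (n2_nonneg _)).1 this
lemma abs_cs {f g : X4 → ℝ} (hf : MemLp f 2 volume) (hg : MemLp g 2 volume) : |∫ z, f z * g z| ≤ n2 f * n2 g :=
  abs_integral_le_integral_abs.trans (cs2 hf hg)

lemma dual1 {U : Set X4} {f : X4 → ℝ} (hf : MemLp f 2 volume) {K : ℝ} (hK : 0 ≤ K)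
    (h : ∀ g, TF g → tsupport g ⊆ U → |∫ z, f z * g z| ≤ K * n2 g) {χ : X4 → ℝ} (hχ : TF χ) (hs : tsupport χ ⊆ U)
    (h0 : ∀ z, 0 ≤ χ z) (h1 : ∀ z, χ z ≤ 1) : ∫ z, χ z * f z ^ 2 ≤ K ^ 2 := by
  have hfi : Integrable (fun z => f z ^ 2) := (memLp_two_iff_integrable_sq hf.1).1 hf
  have hi : Integrable (fun z => χ z * f z ^ 2) := by
    refine hfi.mono' (hχ.cont.aestronglyMeasurable.mul hfi.1) (Eventually.of_forall fun z => ?_)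
    rw [Real.norm_eq_abs, abs_of_nonneg (mul_nonneg (h0 z) (sq_nonneg _))]
    exact mul_le_of_le_one_left (sq_nonneg _) (h1 z)
  have hI : 0 ≤ ∫ z, χ z * f z ^ 2 := integral_nonneg fun z => mul_nonneg (h0 z) (sq_nonneg _)
  set S := Real.sqrt (∫ z, χ z * f z ^ 2) with hS
  have hS2 : S ^ 2 = ∫ z, χ z * f z ^ 2 := Real.sq_sqrt hI
  have hS0 : 0 ≤ S := Real.sqrt_nonneg _
  have mf : MemLp (fun z => f z * χ z) 2 volume := memLp_mul_TF hf hχ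
  have hN : n2 (fun z => f z * χ z) ≤ S := by
    apply Real.sqrt_le_sqrt
    refine integral_mono ((memLp_two_iff_integrable_sq mf.1).1 mf) hi fun z => ?_
    have := mul_le_of_le_one_left (mul_nonneg (h0 z) (sq_nonneg (f z))) (h1 z)
    calc (f z * χ z) ^ 2 = χ z * (χ z * f z ^ 2) := by ring
      _ ≤ _ := this
  have key : ∀ δ > 0, S ^ 2 ≤ K * (S + δ) + S * δ := by
    intro δ hδ
    obtain ⟨g, g1, g2, g3⟩ := MemLp.exist_eLpNorm_sub_le (p := 2) (by simp) (by norm_num) hf hδ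
    have tg : TF g := ⟨g2, g1⟩
    have mg : MemLp g 2 volume := tg.memLp
    have mfg : MemLp (fun z => f z - g z) 2 volume := hf.sub mg
    have d1 : n2 (fun z => f z - g z) ≤ δ := by
      have := n2_eq mfg
      rw [show eLpNorm (fun z => f z - g z) 2 volume = eLpNorm (f - g) 2 volume from rfl] at this
      rw [this] at g3
      exact (ENNReal.ofReal_le_ofReal_iff hδ.le).1 g3
    have tg2 : TF (fun z => g z * χ z) := TF.mul tg.sm hχ
    have d2 := h (fun z => g z * χ z) tg2 ((tsupport_mul_subset_right).trans hs)
    have mfgc : MemLp (fun z => (g z - f z) * χ z) 2 volume := memLp_mul_TF (mg.sub hf) hχ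
    have d3 : n2 (fun z => g z * χ z) ≤ S + δ := by
      have := n2_add mf mfgc
      have e : (fun z => f z * χ z + (g z - f z) * χ z) = fun z => g z * χ z := by funext z; ring
      rw [e] at this
      refine this.trans (add_le_add hN (le_trans ?_ d1))
      refine n2_mono mfgc mfg fun z => ?_
      rw [abs_mul, abs_sub_comm, abs_of_nonneg (h0 z)]
      exact mul_le_of_le_one_right (abs_nonneg _) (h1 z)
    have d4 := abs_cs mf mfg
    have e : ∫ z, χ z * f z ^ 2 = (∫ z, f z * (g z * χ z)) + ∫ z, f z * χ z * (f z - g z) := by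
      rw [← integral_add (int_l2 hf tg2.memLp) (int_l2 mf mfg)]
      congr 1; funext z; ring
    rw [hS2, e]
    refine add_le_add ((le_abs_self _).trans (d2.trans ?_)) ((le_abs_self _).trans (d4.trans ?_))
    · gcongr
    · exact mul_le_mul hN d1 (n2_nonneg _) hS0
  have k2 : S ^ 2 ≤ K * S := by
    refine le_of_forall_pos_le_add fun e he => ?_
    have := key (e / (K + S + 1)) (by positivity)
    have h3 : (K + S) * (e / (K + S + 1)) ≤ e := by
      rw [mul_div_assoc', div_le_iff₀ (by positivity)]; nlinarith
    nlinarith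
  have k3 : S ≤ K := by
    by_contra hc; push Not at hc
    nlinarith
  rw [← hS2]; exact pow_le_pow_left₀ hS0 k3 2

lemma cutoffs {U : Set X4} (hU : IsOpen U) (hb : Bornology.IsBounded U) : ∃ χ : ℕ → X4 → ℝ, ∀ n, TF (χ n) ∧ tsupport (χ n) ⊆ U ∧
    (∀ z, 0 ≤ χ n z) ∧ (∀ z, χ n z ≤ 1) ∧ ∀ z ∈ U, Tendsto (fun n => χ n z) atTop (nhds 1) := by
  obtain ⟨f, f1, f2, f3⟩ := hU.exists_contDiff_support_eq (n := (⊤ : ℕ∞))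
  have f0 : ∀ z, 0 ≤ f z := fun z => (f3 (mem_range_self z)).1
  refine ⟨fun n z => mtr (n * f z), fun n => ?_⟩
  have ts : tsupport (fun z => mtr (n * f z)) ⊆ {z | 1 ≤ n * f z} := by
    apply closure_minimal
    · intro z hz
      by_contra h
      exact hz (mtr_zero (not_le.1 h).le)
    · exact isClosed_le continuous_const (continuous_const.mul f2.continuous)
  have tU : tsupport (fun z => mtr (n * f z)) ⊆ U := by
    intro z hz
    have := ts hz
    rw [← f1]
    intro h
    simp only [mem_ofPred_eq, h, mul_zero] at this
    linarith
  refine ⟨⟨mtr_smooth.comp (contDiff_const.mul f2), ?_⟩, tU, fun z => mtr_nonneg _, fun z => mtr_le _, ?_⟩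
  · exact Metric.isCompact_of_isClosed_isBounded (isClosed_tsupport _) (hb.subset tU)
  · intro z hz
    rw [← f1] at hz
    have hp : 0 < f z := lt_of_le_of_ne (f0 z) (Ne.symm hz)
    refine tendsto_const_nhds.congr' ?_
    obtain ⟨N, hN⟩ := exists_nat_ge (2 / f z)
    filter_upwards [eventually_ge_atTop N] with k hk
    rw [mtr_one]
    rw [div_le_iff₀ hp] at hN
    have : (N : ℝ) ≤ k := by exact_mod_cast hk
    nlinarith

lemma dual2 {U : Set X4} (hU : IsOpen U) (hb : Bornology.IsBounded U) {f : X4 → ℝ} (hf : MemLp f 2 volume) {K : ℝ} (hK : 0 ≤ K)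
    (h : ∀ g, TF g → tsupport g ⊆ U → |∫ z, f z * g z| ≤ K * n2 g) : ∫ z in U, f z ^ 2 ≤ K ^ 2 := by
  obtain ⟨χ, hχ⟩ := cutoffs hU hb
  have hfi : Integrable (fun z => f z ^ 2) := (memLp_two_iff_integrable_sq hf.1).1 hf
  have lim : Tendsto (fun n => ∫ z, χ n z * f z ^ 2) atTop (nhds (∫ z, U.indicator (fun z => f z ^ 2) z)) := by
    refine tendsto_integral_of_dominated_convergence (fun z => f z ^ 2) (fun n => (hχ n).1.cont.aestronglyMeasurable.mul hfi.1) hfi ?_ ?_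
    · intro n
      refine Eventually.of_forall fun z => ?_
      rw [Real.norm_eq_abs, abs_of_nonneg (mul_nonneg ((hχ n).2.2.1 z) (sq_nonneg _))]
      exact mul_le_of_le_one_left (sq_nonneg _) ((hχ n).2.2.2.1 z)
    · refine Eventually.of_forall fun z => ?_
      by_cases hz : z ∈ U
      · rw [indicator_of_mem hz]
        simpa using ((hχ 0).2.2.2.2 z hz).mul_const (f z ^ 2)
      · rw [indicator_of_notMem hz]
        refine tendsto_const_nhds.congr fun n => ?_
        rw [image_eq_zero_of_notMem_tsupport fun h2 => hz ((hχ n).2.1 h2), zero_mul]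
  rw [integral_indicator hU.measurableSet] at lim
  exact le_of_tendsto' lim fun n => dual1 hf hK h (hχ n).1 (hχ n).2.1 (hχ n).2.2.1 (hχ n).2.2.2.1

def vb : ℝ := volume.real (Metric.ball (0:E3) 1)
lemma vb_nonneg : 0 ≤ vb := measureReal_nonneg
lemma pcyl_open (z : X4) (R : ℝ) : IsOpen (pcyl z R) := Metric.isOpen_ball.prod isOpen_Ioo
lemma pcyl_bdd (z : X4) (R : ℝ) : Bornology.IsBounded (pcyl z R) := Metric.isBounded_ball.prod (Metric.isBounded_Ioo _ _)
lemma pcyl_fin (z : X4) (R : ℝ) : volume (pcyl z R) < ∞ := (pcyl_bdd z R).measure_lt_top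
lemma pcyl_vol (z : X4) {R : ℝ} (hR : 0 < R) : volume.real (pcyl z R) = R ^ 5 * vb := by
  have hv : (volume : Measure X4) = (volume : Measure E3).prod (volume : Measure ℝ) := rfl
  unfold pcyl vb
  rw [Measure.real, hv, Measure.prod_prod, Real.volume_Ioo, Measure.addHaar_ball _ _ hR.le, ENNReal.toReal_mul, ENNReal.toReal_mul,
    ENNReal.toReal_ofReal (by positivity), ENNReal.toReal_ofReal (by nlinarith)]
  simp only [finrank_euclideanSpace, Fintype.card_fin, Measure.real]
  ring
lemma pcyl_half (z : X4) {r R : ℝ} (hr : 0 ≤ r) (h : r ≤ R) : pcyl z r ⊆ pcyl z R := by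
  refine prod_mono (Metric.ball_subset_ball h) (Ioo_subset_Ioo_left ?_)
  nlinarith

lemma wn_ind {W : X4 → ℝ} {S : Set X4} (hS : MeasurableSet S) : n2 (S.indicator W) = wn W S := by
  unfold n2 wn
  rw [← integral_indicator hS]
  congr 2; funext z; by_cases hz : z ∈ S <;> simp [hz]

lemma wn_nonneg {W : X4 → ℝ} {S : Set X4} : 0 ≤ wn W S := Real.sqrt_nonneg _

lemma n2_bd {B : X4 → ℝ} {z : X4} {R b : ℝ} (hR : 0 < R) (hb : 0 ≤ b) (h1 : ∀ y, |B y| ≤ b) (h2 : ∀ y ∉ pcyl z R, B y = 0) :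
    n2 B ≤ b * Real.sqrt (R ^ 5 * vb) := by
  have e : (b * Real.sqrt (R ^ 5 * vb)) = Real.sqrt (b ^ 2 * (R ^ 5 * vb)) := by
    rw [Real.sqrt_mul (sq_nonneg b), Real.sqrt_sq hb]
  rw [e]
  apply Real.sqrt_le_sqrt
  have e2 : (b ^ 2 * (R ^ 5 * vb)) = ∫ y, (pcyl z R).indicator (fun _ => b ^ 2) y := by
    rw [integral_indicator (pcyl_open z R).measurableSet, setIntegral_const, pcyl_vol z hR, smul_eq_mul, mul_comm]
  rw [e2]
  refine integral_mono_of_nonneg (Eventually.of_forall fun y => sq_nonneg _) ?_ (Eventually.of_forall fun y => ?_)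
  · exact (integrable_indicator_iff (pcyl_open z R).measurableSet).2 (integrableOn_const (pcyl_fin z R).ne)
  · by_cases hy : y ∈ pcyl z R
    · simp only [indicator_of_mem hy]
      rw [← sq_abs]; exact pow_le_pow_left₀ (abs_nonneg _) (h1 y) 2
    · simp [indicator_of_notMem hy, h2 y hy]

lemma ww_L2 {O : Set X4} {V : Fin 3 → X4 → ℝ} {D : Fin 3 → Fin 3 → X4 → ℝ} (h : SolD O V D) (a b : Fin 3) : MemLp (ww D a b) 2 volume :=
  (h.hD a b).sub (h.hD b a)

/-- pairing of a function dominated by W with test function supported in S -/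
lemma pair_S {f W B : X4 → ℝ} {S : Set X4} (hS : MeasurableSet S) (hf : MemLp f 2 volume) (hW : MemLp W 2 volume) (h0 : ∀ z, |f z| ≤ W z)
    (hB : MemLp B 2 volume) (h2 : ∀ y ∉ S, B y = 0) : |∫ z, f z * B z| ≤ wn W S * n2 B := by
  have e : ∫ z, f z * B z = ∫ z, S.indicator f z * B z := by
    congr 1; funext z; by_cases hz : z ∈ S
    · simp [hz]
    · simp [h2 z hz]
  rw [e]
  refine (abs_cs (hf.indicator hS) hB).trans (mul_le_mul_of_nonneg_right ?_ (n2_nonneg _))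
  rw [← wn_ind hS]
  refine n2_mono (hf.indicator hS) (hW.indicator hS) fun z => ?_
  by_cases hz : z ∈ S
  · simp only [indicator_of_mem hz]; exact (h0 z).trans (le_abs_self _)
  · simp [hz]

lemma dec1 : ∃ C : ℝ, 0 ≤ C ∧ ∀ {O Q : Set X4} {V : Fin 3 → X4 → ℝ} {D : Fin 3 → Fin 3 → X4 → ℝ} {ε : ℝ} {W g : X4 → ℝ},
    SolD O V D → Smal Q ε (FF V D) W g → (∀ a b z, |ww D a b z| ≤ W z) → ∀ (z : X4) (R : ℝ), 0 < R →
    pcyl z R ⊆ O → pcyl z R ⊆ Q → ∀ h, TF h → tsupport h ⊆ pcyl z (R/2) → ∀ a b,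
    c0 * |∫ y, ww D a b y * h y| ≤ wn W (pcyl z R) * ((1 + 2 * Csob * ε) * (C * ((R^5)⁻¹ * ∫ y, |h y|) * Real.sqrt (R ^ 5 * vb)) + 2 * Csob * ε * (c0 * n2 h)) := by
  obtain ⟨C, hC, H⟩ := parm
  refine ⟨C, hC, ?_⟩
  intro O Q V D ε W g hs hm hw z R hR hO hQ h th hsup a b
  obtain ⟨Ψ, Hn, B, M, HH⟩ := H z R hR h th hsup
  set S := pcyl z R with hSdef
  have hS : MeasurableSet S := (pcyl_open z R).measurableSet
  set bb := C * ((R^5)⁻¹ * ∫ y, |h y|) with hbb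
  have hb0 : 0 ≤ bb := by
    have : 0 ≤ ∫ y, |h y| := integral_nonneg fun y => abs_nonneg _
    positivity
  have z1 : ∀ n, ∀ y ∉ S, Hn n y = 0 := fun n y hy => image_eq_zero_of_notMem_tsupport fun k => hy ((HH n).2.2.2.2.1 k)
  have z2 : ∀ n, ∀ y ∉ S, B n y = 0 := fun n y hy => by
    have h1 := (HH n).2.2.2.2.2.1 y
    rw [z1 n y hy, image_eq_zero_of_notMem_tsupport fun k => hy ((HH n).2.2.2.1 (heat_supp _ k))] at h1
    linarith
  have hε := hm.he
  have hwL := ww_L2 hs a b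
  have st : ∀ n, |∫ y, ww D a b y * Hn n y| ≤ wn W S * ((1 + 2 * Csob * ε) * (bb * Real.sqrt (R ^ 5 * vb)) + 2 * Csob * ε * n2 (Hn n)) := by
    intro n
    obtain ⟨t1, t2, t3, s1, s2, he, hM, hB, -⟩ := HH n
    have nB : n2 (B n) ≤ bb * Real.sqrt (R ^ 5 * vb) := n2_bd hR hb0 hB (z2 n)
    have pB := pair_S hS hwL hm.W2 (hw a b) (t3.memLp (μ := volume)) (z2 n)
    have v := hs.ve a b (Ψ n) t1 (s1.trans hO)
    have nh : n2 (heat (Ψ n)) ≤ n2 (B n) + n2 (Hn n) := by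
      have e : heat (Ψ n) = fun y => B n y + (- Hn n y) := by funext y; rw [he y]; ring
      have e3 : n2 (fun y => - Hn n y) = n2 (Hn n) := by unfold n2; simp
      rw [e]
      refine (n2_add t3.memLp t2.memLp.neg).trans ?_
      exact (congrArg (n2 (B n) + ·) e3).le
    have q1 := ES hm hS hQ t1 s1 a b
    have q2 := ES hm hS hQ t1 s1 b a
    have e4 : ∫ y, ww D a b y * heat (Ψ n) y = (∫ y, ww D a b y * B n y) - ∫ y, ww D a b y * Hn n y := by
      rw [← integral_sub (int_l2 hwL t3.memLp) (int_l2 hwL t2.memLp)]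
      congr 1; funext y; rw [he y]; ring
    rw [e4] at v
    have hn : Real.sqrt (∫ y, heat (Ψ n) y ^ 2) = n2 (heat (Ψ n)) := rfl
    rw [hn] at q1 q2
    have k0 : 0 ≤ Csob * ε * wn W S := mul_nonneg (mul_nonneg Csob_nonneg hε) wn_nonneg
    have k1 : Csob * ε * wn W S * n2 (heat (Ψ n)) ≤ Csob * ε * wn W S * (bb * Real.sqrt (R ^ 5 * vb) + n2 (Hn n)) :=
      mul_le_mul_of_nonneg_left (nh.trans (by linarith)) k0
    have k2 : wn W S * n2 (B n) ≤ wn W S * (bb * Real.sqrt (R ^ 5 * vb)) := mul_le_mul_of_nonneg_left nB wn_nonneg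
    rw [abs_le] at q1 q2 pB ⊢
    constructor <;> nlinarith
  have l1 : Tendsto (fun n => ∫ y, ww D a b y * Hn n y) atTop (nhds (∫ y, ww D a b y * (c0 * h y))) := by
    have hi : Integrable (fun y => |ww D a b y| * S.indicator (fun _ => M) y) := by
      refine int_l2 hwL.abs ?_
      exact memLp_indicator_const 2 hS M (Or.inr (pcyl_fin z R).ne)
    refine tendsto_integral_of_dominated_convergence _ (fun n => hwL.1.mul (HH n).2.1.cont.aestronglyMeasurable) hi ?_ ?_
    · intro n
      refine Eventually.of_forall fun y => ?_
      rw [norm_mul, Real.norm_eq_abs, Real.norm_eq_abs]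
      by_cases hy : y ∈ S
      · rw [indicator_of_mem hy]; exact mul_le_mul_of_nonneg_left ((HH n).2.2.2.2.2.2.1 y) (abs_nonneg _)
      · simp [z1 n y hy, hy]
    · exact Eventually.of_forall fun y => ((HH 0).2.2.2.2.2.2.2.2 y).const_mul _
  have l2 : Tendsto (fun n => n2 (Hn n)) atTop (nhds (c0 * n2 h)) := by
    have e : c0 * n2 h = Real.sqrt (∫ y, (c0 * h y) ^ 2) := by
      simp_rw [mul_pow]
      rw [integral_const_mul, Real.sqrt_mul (sq_nonneg _), Real.sqrt_sq c0_pos.le]; rfl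
    rw [e]
    refine (Real.continuous_sqrt.tendsto _).comp ?_
    have hi : Integrable (S.indicator (fun _ => M ^ 2)) := 
      (integrable_indicator_iff hS).2 (integrableOn_const (pcyl_fin z R).ne)
    refine tendsto_integral_of_dominated_convergence _ (fun n => ((HH n).2.1.cont.pow 2).aestronglyMeasurable) hi ?_ ?_
    · intro n
      refine Eventually.of_forall fun y => ?_
      rw [norm_pow, Real.norm_eq_abs]
      by_cases hy : y ∈ S
      · rw [indicator_of_mem hy]; exact pow_le_pow_left₀ (abs_nonneg _) ((HH n).2.2.2.2.2.2.1 y) 2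
      · simp [z1 n y hy, hy]
    · exact Eventually.of_forall fun y => ((HH 0).2.2.2.2.2.2.2.2 y).pow 2
  have fin := le_of_tendsto_of_tendsto' l1.abs (((l2.const_mul (2 * Csob * ε)).const_add _).const_mul (wn W S)) st
  have e5 : c0 * |∫ y, ww D a b y * h y| = |∫ y, ww D a b y * (c0 * h y)| := by
    rw [← abs_of_pos c0_pos, ← abs_mul, abs_of_pos c0_pos, ← integral_const_mul]
    congr 2; funext y; ring
  rw [e5]; exact fin

lemma l1_l2 {h : X4 → ℝ} (th : TF h) {z : X4} {ρ : ℝ} (hρ : 0 < ρ) (hs : tsupport h ⊆ pcyl z ρ) :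
    ∫ y, |h y| ≤ Real.sqrt (ρ ^ 5 * vb) * n2 h := by
  have hS := (pcyl_open z ρ).measurableSet
  have m1 : MemLp ((pcyl z ρ).indicator (fun _ => (1:ℝ))) 2 volume := memLp_indicator_const 2 hS 1 (Or.inr (pcyl_fin z ρ).ne)
  have := cs2 m1 (th.memLp (μ := volume))
  have e : ∀ y, |(pcyl z ρ).indicator (fun _ => (1:ℝ)) y * h y| = |h y| := by
    intro y; by_cases hy : y ∈ pcyl z ρ
    · simp [hy]
    · rw [image_eq_zero_of_notMem_tsupport fun k => hy (hs k)]; simp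
  simp_rw [e] at this
  refine this.trans (mul_le_mul_of_nonneg_right ?_ (n2_nonneg _))
  have := n2_bd (B := (pcyl z ρ).indicator (fun _ => (1:ℝ))) hρ (b := 1) (z := z) (by norm_num) (fun y => ?_) (fun y hy => by simp [hy])
  · rw [one_mul] at this; exact this
  · by_cases hy : y ∈ pcyl z ρ <;> simp [hy]

lemma dec2 : ∃ C : ℝ, 0 ≤ C ∧ ∀ {O Q : Set X4} {V : Fin 3 → X4 → ℝ} {D : Fin 3 → Fin 3 → X4 → ℝ} {ε : ℝ} {W g : X4 → ℝ},
    SolD O V D → Smal Q ε (FF V D) W g → (∀ a b z, |ww D a b z| ≤ W z) → (∀ z, W z ^ 2 ≤ ∑ a, ∑ b, ww D a b z ^ 2) → 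
    ∀ (z : X4) (R : ℝ), 0 < R → pcyl z R ⊆ O → pcyl z R ⊆ Q → ∀ κ : ℝ, 0 < κ → κ ≤ 1/2 →
    wn W (pcyl z (κ^4 * R)) ≤ (3 * ((1 + 2 * Csob * ε) * C * κ ^ 10 + 2 * Csob * ε)) * wn W (pcyl z R) := by
  obtain ⟨C, hC, H⟩ := dec1
  refine ⟨C * vb / c0, div_nonneg (mul_nonneg hC vb_nonneg) c0_pos.le, ?_⟩
  intro O Q V D ε W g hs hm hw hw2 z R hR hO hQ κ hκ hκ2
  have hε := hm.he
  have hcs := Csob_nonneg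
  have hvb := vb_nonneg
  have hc0 := c0_pos
  have hθ : κ ^ 4 ≤ 1 / 2 := by
    calc κ ^ 4 ≤ (1/2) ^ 4 := pow_le_pow_left₀ hκ.le hκ2 4
      _ ≤ _ := by norm_num
  have hρ : 0 < κ ^ 4 * R := by positivity
  set S := pcyl z (κ^4 * R) with hSd
  have hS : MeasurableSet S := (pcyl_open _ _).measurableSet
  set K := ((1 + 2 * Csob * ε) * (C * vb / c0) * κ ^ 10 + 2 * Csob * ε) * wn W (pcyl z R) with hK
  have hK0 : 0 ≤ K := mul_nonneg (by positivity) wn_nonneg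
  have sq : Real.sqrt (R ^ 5 * vb) * Real.sqrt ((κ ^ 4 * R) ^ 5 * vb) = R ^ 5 * vb * κ ^ 10 := by
    rw [← Real.sqrt_mul (by positivity)]
    rw [show R ^ 5 * vb * ((κ ^ 4 * R) ^ 5 * vb) = (R ^ 5 * vb * κ ^ 10) ^ 2 by ring, Real.sqrt_sq (by positivity)]
  have main : ∀ a b, ∫ y in S, ww D a b y ^ 2 ≤ K ^ 2 := by
    intro a b
    refine dual2 (pcyl_open _ _) (pcyl_bdd _ _) (ww_L2 hs a b) hK0 fun h th hsu => ?_
    have h1 := H hs hm hw z R hR hO hQ h th (hsu.trans (pcyl_half z hρ.le (by nlinarith))) a b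
    have h2 := l1_l2 th hρ hsu
    have h3 : (R^5)⁻¹ * (∫ y, |h y|) * Real.sqrt (R ^ 5 * vb) ≤ vb * κ ^ 10 * n2 h := by
      calc (R^5)⁻¹ * (∫ y, |h y|) * Real.sqrt (R ^ 5 * vb) ≤ (R^5)⁻¹ * (Real.sqrt ((κ ^ 4 * R) ^ 5 * vb) * n2 h) * Real.sqrt (R ^ 5 * vb) := by gcongr
        _ = (R^5)⁻¹ * (Real.sqrt (R ^ 5 * vb) * Real.sqrt ((κ ^ 4 * R) ^ 5 * vb)) * n2 h := by ring
        _ = _ := by rw [sq]; field_simp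
    have h4 : c0 * |∫ y, ww D a b y * h y| ≤ c0 * (K * n2 h) := by
      refine h1.trans ?_
      calc _ = wn W (pcyl z R) * ((1 + 2 * Csob * ε) * (C * ((R^5)⁻¹ * (∫ y, |h y|) * Real.sqrt (R ^ 5 * vb))) + 2 * Csob * ε * (c0 * n2 h)) := by ring
        _ ≤ wn W (pcyl z R) * ((1 + 2 * Csob * ε) * (C * (vb * κ ^ 10 * n2 h)) + 2 * Csob * ε * (c0 * n2 h)) := by
          refine mul_le_mul_of_nonneg_left ?_ wn_nonneg
          gcongr
        _ = _ := by rw [hK]; field_simp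
    exact le_of_mul_le_mul_left h4 hc0
  have hi : ∀ a b, Integrable (fun y => ww D a b y ^ 2) := fun a b => (memLp_two_iff_integrable_sq (ww_L2 hs a b).1).1 (ww_L2 hs a b)
  have tot : ∫ y in S, W y ^ 2 ≤ (3 * K) ^ 2 := by
    calc ∫ y in S, W y ^ 2 ≤ ∫ y in S, ∑ a, ∑ b, ww D a b y ^ 2 := by
          refine integral_mono ((memLp_two_iff_integrable_sq hm.W2.1).1 hm.W2).integrableOn ?_ hw2
          exact integrable_finsetSum _ fun a _ => integrable_finsetSum _ fun b _ => (hi a b).integrableOn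
      _ = ∑ a, ∑ b, ∫ y in S, ww D a b y ^ 2 := by
          rw [integral_finsetSum _ fun a _ => integrable_finsetSum _ fun b _ => (hi a b).integrableOn]
          refine Finset.sum_congr rfl fun a _ => ?_
          rw [integral_finsetSum _ fun b _ => (hi a b).integrableOn]
      _ ≤ ∑ a : Fin 3, ∑ b : Fin 3, K ^ 2 := Finset.sum_le_sum fun a _ => Finset.sum_le_sum fun b _ => main a b
      _ = _ := by simp; ring
  calc wn W S ≤ Real.sqrt ((3 * K) ^ 2) := Real.sqrt_le_sqrt tot
    _ = 3 * K := Real.sqrt_sq (by positivity)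
    _ = _ := by rw [hK]; ring

lemma dec3 : ∃ κ ε₀ : ℝ, 0 < κ ∧ κ ≤ 1/2 ∧ 0 < ε₀ ∧ ∀ {O Q : Set X4} {V : Fin 3 → X4 → ℝ} {D : Fin 3 → Fin 3 → X4 → ℝ} {W g : X4 → ℝ},
    SolD O V D → Smal Q ε₀ (FF V D) W g → (∀ a b z, |ww D a b z| ≤ W z) → (∀ z, W z ^ 2 ≤ ∑ a, ∑ b, ww D a b z ^ 2) → 
    ∀ (z : X4) (R : ℝ), 0 < R → pcyl z R ⊆ O → pcyl z R ⊆ Q → ∀ n : ℕ, 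
    wn W (pcyl z ((κ^4) ^ n * R)) ≤ (κ ^ 9) ^ n * wn W (pcyl z R) := by
  obtain ⟨C, hC, H⟩ := dec2
  have hcs := Csob_nonneg
  set A := 3 * (1 + 2 * Csob) * C with hA
  have hA0 : 0 ≤ A := by positivity
  set κ := min (1/2) (1 / (2 * A + 1)) with hκd
  have hκ : 0 < κ := by rw [hκd, lt_min_iff]; constructor <;> positivity
  have hκ2 : κ ≤ 1/2 := min_le_left _ _
  have hκA : A * κ ≤ 1 / 2 := by
    have : κ ≤ 1 / (2 * A + 1) := min_le_right _ _
    calc A * κ ≤ A * (1 / (2 * A + 1)) := by gcongr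
      _ ≤ 1/2 := by rw [mul_one_div, div_le_div_iff₀ (by positivity) (by norm_num)]; linarith
  set ε := min 1 (κ ^ 9 / (12 * Csob + 1)) with hεd
  have hε : 0 < ε := by rw [hεd, lt_min_iff]; constructor <;> positivity
  have hε1 : ε ≤ 1 := min_le_left _ _
  have hε2 : 6 * Csob * ε ≤ κ ^ 9 / 2 := by
    have : ε ≤ κ ^ 9 / (12 * Csob + 1) := min_le_right _ _
    calc 6 * Csob * ε ≤ 6 * Csob * (κ ^ 9 / (12 * Csob + 1)) := by gcongr
      _ ≤ _ := by rw [mul_div_assoc', div_le_div_iff₀ (by positivity) (by norm_num)]; nlinarith [pow_pos hκ 9]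
  have fac : 3 * ((1 + 2 * Csob * ε) * C * κ ^ 10 + 2 * Csob * ε) ≤ κ ^ 9 := by
    calc 3 * ((1 + 2 * Csob * ε) * C * κ ^ 10 + 2 * Csob * ε) ≤ 3 * ((1 + 2 * Csob * 1) * C * κ ^ 10 + 2 * Csob * ε) := by gcongr
      _ = (A * κ) * κ ^ 9 + 6 * Csob * ε := by rw [hA]; ring
      _ ≤ (1/2) * κ ^ 9 + κ ^ 9 / 2 := by gcongr
      _ = _ := by ring
  have hθ1 : κ ^ 4 ≤ 1 := pow_le_one₀ hκ.le (by linarith)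
  refine ⟨κ, ε, hκ, hκ2, hε, ?_⟩
  intro O Q V D W g hs hm hw hw2 z R hR hO hQ n
  induction n with
  | zero => simp
  | succ n ih =>
    have hle : (κ ^ 4) ^ n * R ≤ R := mul_le_of_le_one_left hR.le (pow_le_one₀ (by positivity) hθ1)
    have hsub : pcyl z ((κ^4) ^ n * R) ⊆ pcyl z R := pcyl_half z (by positivity) hle
    have h1 := H hs hm hw hw2 z ((κ^4)^n * R) (by positivity) (hsub.trans hO) (hsub.trans hQ) κ hκ hκ2
    have h2 : wn W (pcyl z ((κ^4) ^ (n+1) * R)) ≤ κ ^ 9 * wn W (pcyl z ((κ^4) ^ n * R)) := by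
      rw [show (κ^4) ^ (n+1) * R = κ ^ 4 * ((κ^4) ^ n * R) by ring]
      exact h1.trans (mul_le_mul_of_nonneg_right fac wn_nonneg)
    calc _ ≤ κ ^ 9 * wn W (pcyl z ((κ^4) ^ n * R)) := h2
      _ ≤ κ ^ 9 * ((κ ^ 9) ^ n * wn W (pcyl z R)) := by gcongr
      _ = _ := by ring

def es (i : Fin 3) : E3 := EuclideanSpace.single i 1
def qk (s : ℝ) : ℝ := (Real.sqrt s)⁻¹ ^ 3 * mtr (4 * s)
lemma qk_smooth : ContDiff ℝ (⊤ : ℕ∞) qk := by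
  rw [contDiff_iff_contDiffAt]
  intro s
  by_cases hs : s < 1/4
  · have : qk =ᶠ[nhds s] fun _ => 0 := by
      filter_upwards [Iio_mem_nhds hs] with w hw
      have hw' : w < 1/4 := hw
      unfold qk; rw [mtr_zero (by linarith), mul_zero]
    exact contDiffAt_const.congr_of_eventuallyEq this
  · push Not at hs
    have hp : 0 < s := by linarith
    refine ContDiffAt.mul (ContDiffAt.pow (ContDiffAt.inv (Real.contDiffAt_sqrt hp.ne') (Real.sqrt_pos.2 hp).ne') 3) ?_
    exact (mtr_smooth.comp (contDiff_const.mul contDiff_id)).contDiffAt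

def k1 (s : ℝ) : ℝ := 1 - (1/2) * ∫ u in (1:ℝ)..s, qk u
lemma k1_deriv (s : ℝ) : HasDerivAt k1 (-(1/2) * qk s) s := by
  have := (intervalIntegral.integral_hasDerivAt_right (qk_smooth.continuous.intervalIntegrable 1 s) 
    (qk_smooth.continuous.stronglyMeasurableAtFilter _ _) qk_smooth.continuous.continuousAt)
  have h2 := (this.const_mul (1/2)).const_sub 1
  exact h2.congr_deriv (by ring)
lemma k1_d : deriv k1 = fun s => -(1/2) * qk s := funext fun s => (k1_deriv s).deriv
lemma k1_smooth : ContDiff ℝ (⊤ : ℕ∞) k1 := by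
  rw [contDiff_infty_iff_deriv]
  refine ⟨fun s => (k1_deriv s).differentiableAt, ?_⟩
  rw [k1_d]; exact contDiff_const.mul qk_smooth
lemma inv_sqrt_d {s : ℝ} (hp : 0 < s) : HasDerivAt (fun s => (Real.sqrt s)⁻¹) (-(1/2) * (Real.sqrt s)⁻¹ ^ 3) s := by
  have h := (Real.hasDerivAt_sqrt hp.ne').fun_inv (Real.sqrt_pos.2 hp).ne'
  have := (Real.sqrt_pos.2 hp).ne'
  refine h.congr_deriv ?_
  field_simp
lemma k1_far {s : ℝ} (hs : 1/2 ≤ s) : k1 s = (Real.sqrt s)⁻¹ := by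
  have hpos : ∀ u ∈ uIcc 1 s, 1/2 ≤ u := by
    intro u hu
    rw [mem_uIcc] at hu
    rcases hu with h | h <;> linarith [h.1]
  have : ∫ u in (1:ℝ)..s, qk u = (-2 * (Real.sqrt s)⁻¹) - (-2 * (Real.sqrt 1)⁻¹) := by
    refine intervalIntegral.integral_eq_sub_of_hasDerivAt (f := fun u => -2 * (Real.sqrt u)⁻¹) (fun u hu => ?_) 
      (qk_smooth.continuous.intervalIntegrable 1 s)
    have hu2 := hpos u hu
    have := (inv_sqrt_d (s := u) (by linarith)).const_mul (-2)
    refine this.congr_deriv ?_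
    unfold qk; rw [mtr_one (by linarith)]; ring
  unfold k1; rw [this]; simp; ring

lemma radial {k : ℝ → ℝ} (hk : Differentiable ℝ k) (i : Fin 3) (x : E3) : dd (es i) (fun x => k (‖x‖ ^ 2)) x = 2 * x i * deriv k (‖x‖ ^ 2) := by
  have h := (hk (‖x‖^2)).hasDerivAt.comp_hasFDerivAt x (hasStrictFDerivAt_norm_sq x).hasFDerivAt
  have e := h.fderiv
  unfold dd
  have e' : (fun x : E3 => k (‖x‖^2)) = k ∘ fun x => ‖x‖^2 := rfl
  rw [e', e]
  simp [es, EuclideanSpace.inner_single_right]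
  ring

lemma rad_smooth {k : ℝ → ℝ} (hk : ContDiff ℝ (⊤ : ℕ∞) k) : ContDiff ℝ (⊤ : ℕ∞) (fun x : E3 => k (‖x‖ ^ 2)) := hk.comp (contDiff_norm_sq ℝ)

def lap3 (f : E3 → ℝ) (x : E3) : ℝ := ∑ i, dd (es i) (dd (es i) f) x

lemma radial2 {k : ℝ → ℝ} (hk : ContDiff ℝ (⊤ : ℕ∞) k) (x : E3) : 
    lap3 (fun x => k (‖x‖ ^ 2)) x = 6 * deriv k (‖x‖ ^ 2) + 4 * ‖x‖ ^ 2 * deriv (deriv k) (‖x‖ ^ 2) := by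
  have hk' : ContDiff ℝ (⊤ : ℕ∞) (deriv k) := ((contDiff_infty_iff_deriv).1 hk).2
  have e1 : ∀ i, dd (es i) (dd (es i) (fun x : E3 => k (‖x‖ ^ 2))) x = 2 * deriv k (‖x‖ ^ 2) + 4 * (x i) ^ 2 * deriv (deriv k) (‖x‖ ^ 2) := by
    intro i
    have e : dd (es i) (fun x : E3 => k (‖x‖ ^ 2)) = fun x => (2 * x i) * (fun x : E3 => deriv k (‖x‖ ^ 2)) x := 
      funext fun x => radial (hk.differentiable (by simp)) i x
    rw [e]
    have hl : HasFDerivAt (fun x : E3 => 2 * x i) ((2:ℝ) • (EuclideanSpace.proj i : E3 →L[ℝ] ℝ)) x := 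
      (EuclideanSpace.proj i : E3 →L[ℝ] ℝ).hasFDerivAt.const_mul 2
    have hd : Differentiable ℝ (fun x : E3 => 2 * x i) := by fun_prop
    rw [dd_mul hd ((rad_smooth hk').differentiable (by simp)), radial (hk'.differentiable (by simp))]
    unfold dd
    rw [hl.fderiv]
    simp [es]
    ring
  unfold lap3
  simp_rw [e1]
  rw [EuclideanSpace.norm_sq_eq]
  simp only [Fin.sum_univ_three, Real.norm_eq_abs, sq_abs]
  ring

def Pk (x : E3) : ℝ := k1 (‖x‖ ^ 2)
def fk (x : E3) : ℝ := -8 * ‖x‖⁻¹ * deriv mtr (4 * ‖x‖ ^ 2)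
lemma lap_Pk (x : E3) : lap3 Pk x = fk x := by
  have h := radial2 k1_smooth x
  rw [show lap3 Pk x = _ from h]
  rw [k1_d]
  have hd : Differentiable ℝ qk := qk_smooth.differentiable (by simp)
  rw [deriv_const_mul _ (hd _)]
  unfold fk
  by_cases hx : x = 0
  · simp [hx, qk]
  have hn : 0 < ‖x‖ := norm_pos_iff.2 hx
  have hq : HasDerivAt qk _ (‖x‖^2) := ((inv_sqrt_d (s := ‖x‖^2) (by positivity)).pow 3).mul 
    ((mtr_smooth.differentiable (by simp) (4 * ‖x‖^2)).hasDerivAt.comp (‖x‖^2) ((hasDerivAt_id (‖x‖^2)).const_mul 4))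
  rw [hq.deriv]
  unfold qk
  simp only [Pi.pow_apply]
  rw [Real.sqrt_sq hn.le, show (3 - 1 : ℕ) = 2 from rfl]
  field_simp
  push_cast
  ring

lemma Pk_smooth : ContDiff ℝ (⊤ : ℕ∞) Pk := rad_smooth k1_smooth
lemma lap3_smooth {f : E3 → ℝ} (hf : ContDiff ℝ (⊤ : ℕ∞) f) : ContDiff ℝ (⊤ : ℕ∞) (lap3 f) := 
  ContDiff.sum fun i _ => dd_smooth (dd_smooth hf _) _
lemma cp_of_zero {f : E3 → ℝ} (h : ∀ x, 1 / 2 < ‖x‖ ^ 2 → f x = 0) : HasCompactSupport f ∧ tsupport f ⊆ Metric.ball 0 1 := by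
  have h1 : tsupport f ⊆ {x | ‖x‖ ^ 2 ≤ 1/2} := by
    refine closure_minimal (fun x hx => ?_) (isClosed_le (by fun_prop) continuous_const)
    by_contra hc
    exact hx (h x (not_le.1 hc))
  have h2 : tsupport f ⊆ Metric.ball 0 1 := fun x hx => by
    have : ‖x‖ ^ 2 ≤ 1/2 := h1 hx
    rw [mem_ball_zero_iff]
    nlinarith [norm_nonneg x]
  exact ⟨Metric.isCompact_of_isClosed_isBounded (isClosed_tsupport _) (Metric.isBounded_ball.subset h2), h2⟩
lemma fk_TF : TF fk := by
  refine ⟨?_, (cp_of_zero fun x hx => ?_).1⟩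
  · rw [show fk = lap3 Pk from funext fun x => (lap_Pk x).symm]; exact lap3_smooth Pk_smooth
  · unfold fk; rw [mtd_zero2 (by linarith), mul_zero]
def cf : ℝ := ∫ x, fk x
lemma cf_neg : cf < 0 := by
  have : 0 < ∫ x, - fk x := by
    rw [integral_pos_iff_support_of_nonneg (f := fun x => - fk x) (fun x => ?_) fk_TF.integrable.neg]
    · have ho : IsOpen (Function.support (fun x => - fk x)) := fk_TF.cont.neg.isOpen_support
      refine ho.measure_pos (volume : Measure E3) ?_
      obtain ⟨s, hs, e⟩ := exists_deriv_eq_slope mtr (by norm_num : (1:ℝ) < 2) mtr_smooth.continuous.continuousOn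
        (mtr_smooth.differentiable (by simp)).differentiableOn
      have hs0 : 0 < s := by linarith [hs.1]
      have hn : ‖EuclideanSpace.single (0 : Fin 3) (Real.sqrt (s/4))‖ = Real.sqrt (s/4) := by
        rw [EuclideanSpace.norm_single, Real.norm_eq_abs, abs_of_nonneg (Real.sqrt_nonneg _)]
      refine ⟨EuclideanSpace.single 0 (Real.sqrt (s/4)), ?_⟩
      simp only [Function.mem_support, fk]
      rw [hn, Real.sq_sqrt (by positivity), mul_div_cancel₀ s (by norm_num : (4:ℝ) ≠ 0), e, mtr_one le_rfl, mtr_zero le_rfl]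
      have : 0 < Real.sqrt (s/4) := Real.sqrt_pos.2 (by positivity)
      have h2 : 0 < -(-8 * (Real.sqrt (s/4))⁻¹ * ((1 - 0) / (2 - 1))) := by
        have := inv_pos.2 this
        norm_num at this ⊢
        exact this
      exact h2.ne'
    · have h1 := mtd_nonneg (4 * ‖x‖^2)
      show 0 ≤ - fk x
      unfold fk
      have : 0 ≤ 8 * ‖x‖⁻¹ * deriv mtr (4 * ‖x‖ ^ 2) := by positivity
      linarith
  rw [integral_neg] at this
  unfold cf; linarith

lemma dd_scale {f : E3 → ℝ} (hf : Differentiable ℝ f) (a : ℝ) (x1 u x : E3) : dd u (fun x => f (a • (x - x1))) x = a * dd u f (a • (x - x1)) := by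
  have h1 : HasFDerivAt (fun x : E3 => a • (x - x1)) (a • ContinuousLinearMap.id ℝ E3) x := ((hasFDerivAt_id x).sub_const x1).const_smul a
  have h2 : HasFDerivAt (fun x => f (a • (x - x1))) _ x := (hf (a • (x - x1))).hasFDerivAt.comp x h1
  unfold dd; rw [h2.fderiv]; simp

lemma kern {θ : ℝ} (h0 : 0 < θ) (h1 : θ < 1) : ∃ K : E3 → ℝ, TF K ∧ tsupport K ⊆ Metric.ball 0 1 ∧ 
    ∀ x, lap3 K x = fk x - θ⁻¹ ^ 3 * fk (θ⁻¹ • x) := by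
  have sm : ContDiff ℝ (⊤ : ℕ∞) (fun x => Pk (θ⁻¹ • (x - 0))) := Pk_smooth.comp (by fun_prop)
  have hz := cp_of_zero (f := fun x => Pk x - θ⁻¹ * Pk (θ⁻¹ • (x - 0))) (fun x hx => by
    unfold Pk
    have hn : 0 < ‖x‖ := norm_pos_iff.2 (by rintro rfl; norm_num at hx)
    have i1 : 1 < θ⁻¹ := (one_lt_inv₀ h0).2 h1
    have e : ‖θ⁻¹ • (x - 0)‖ = θ⁻¹ * ‖x‖ := by rw [sub_zero, norm_smul, Real.norm_eq_abs, abs_of_pos (by positivity)]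
    have h3 : ‖x‖ ^ 2 ≤ (θ⁻¹ * ‖x‖) ^ 2 := by
      apply pow_le_pow_left₀ hn.le; nlinarith
    rw [e, k1_far hx.le, k1_far (hx.le.trans h3), Real.sqrt_sq hn.le, Real.sqrt_sq (by positivity)]
    field_simp; ring)
  refine ⟨_, ⟨Pk_smooth.sub (contDiff_const.mul sm), hz.1⟩, hz.2, fun x => ?_⟩
  have hP := Pk_smooth.differentiable (by simp)
  have s1 : ∀ (a : ℝ) {f g : E3 → ℝ}, Differentiable ℝ f → Differentiable ℝ g → ∀ u, dd u (fun x => f x - a * g x) = fun x => dd u f x - a * dd u g x := by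
    intro a f g hf hg u
    funext x
    have := ((hf x).hasFDerivAt.sub ((hg x).hasFDerivAt.const_mul a)).fderiv
    unfold dd
    have e : (fun x => f x - a * g x) = f - fun x => a * g x := rfl
    rw [e, this]; simp
  have hdP : ∀ u, Differentiable ℝ (dd u Pk) := fun u => (dd_smooth Pk_smooth u).differentiable (by simp)
  have e2 : ∀ u, dd u (dd u (fun x => Pk x - θ⁻¹ * Pk (θ⁻¹ • (x - 0)))) x = dd u (dd u Pk) x - θ⁻¹ ^ 3 * dd u (dd u Pk) (θ⁻¹ • x) := by
    intro u
    rw [s1 _ hP (sm.differentiable (by simp)) u]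
    have e3 : (fun x => dd u Pk x - θ⁻¹ * dd u (fun x => Pk (θ⁻¹ • (x - 0))) x) = fun x => dd u Pk x - θ⁻¹^2 * (fun x => dd u Pk (θ⁻¹ • (x - 0))) x := by
      funext y; rw [dd_scale hP]; ring
    have hc : Differentiable ℝ (fun x => dd u Pk (θ⁻¹ • (x - 0))) := (hdP u).comp (f := fun x : E3 => θ⁻¹ • (x - 0)) (by fun_prop)
    rw [e3, s1 _ (hdP u) hc u]
    simp only
    rw [dd_scale (hdP u), sub_zero]; ring
  rw [← lap_Pk, ← lap_Pk]
  unfold lap3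
  simp_rw [e2]
  rw [Finset.sum_sub_distrib, Finset.mul_sum]

lemma dd_fst {f : E3 → ℝ} (hf : Differentiable ℝ f) (u z : X4) : dd u (fun z : X4 => f z.1) z = dd u.1 f z.1 := by
  have h : HasFDerivAt (fun z : X4 => f z.1) _ z := (hf z.1).hasFDerivAt.comp z (hasFDerivAt_fst (𝕜 := ℝ) (p := z))
  unfold dd; rw [h.fderiv]; rfl
lemma dd_px {f : E3 → ℝ} {g : ℝ → ℝ} (hf : Differentiable ℝ f) (hg : Differentiable ℝ g) (i : Fin 3) (z : X4) :
    dd (ex i) (fun z : X4 => f z.1 * g z.2) z = dd (es i) f z.1 * g z.2 := by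
  have h := dd_mul (f := fun z : X4 => f z.1) (g := fun z : X4 => g z.2) (hf.comp differentiable_fst) (hg.comp differentiable_snd) (ex i) z
  rw [dd_fst hf, dd_snd hg] at h
  rw [h]; simp [ex, es]
lemma dd_pt {f : E3 → ℝ} {g : ℝ → ℝ} (hf : Differentiable ℝ f) (hg : Differentiable ℝ g) (z : X4) :
    dd et (fun z : X4 => f z.1 * g z.2) z = f z.1 * deriv g z.2 := by
  have h := dd_mul (f := fun z : X4 => f z.1) (g := fun z : X4 => g z.2) (hf.comp differentiable_fst) (hg.comp differentiable_snd) et z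
  rw [dd_fst hf, dd_snd hg] at h
  rw [h]; simp [et, dd]
lemma dd_pxx {f : E3 → ℝ} {g : ℝ → ℝ} (hf : TF f) (hg : TF g) (i j : Fin 3) (z : X4) :
    dd (ex j) (dd (ex i) (fun z : X4 => f z.1 * g z.2)) z = dd (es j) (dd (es i) f) z.1 * g z.2 := by
  rw [show dd (ex i) (fun z : X4 => f z.1 * g z.2) = fun z : X4 => dd (es i) f z.1 * g z.2 from funext fun z => dd_px hf.diff hg.diff i z]
  exact dd_px (hf.dd _).diff hg.diff j z
lemma heat_prod {f : E3 → ℝ} {g : ℝ → ℝ} (hf : TF f) (hg : TF g) (z : X4) :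
    heat (fun z : X4 => f z.1 * g z.2) z = f z.1 * deriv g z.2 + lap3 f z.1 * g z.2 := by
  unfold heat lap lap3
  rw [dd_pt hf.diff hg.diff, Finset.sum_mul]
  simp_rw [dd_pxx hf hg]

lemma cpt_Ioo {K : Set ℝ} (hK : IsCompact K) {α β : ℝ} (h : K ⊆ Ioo α β) (hab : α < β) : ∃ a b, α < a ∧ b < β ∧ a < b ∧ K ⊆ Ioo a b := by
  rcases K.eq_empty_or_nonempty with rfl | hn
  · exact ⟨α + (β - α)/3, β - (β - α)/3, by linarith, by linarith, by linarith, by simp⟩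
  · have h1 := h (hK.sInf_mem hn)
    have h2 := h (hK.sSup_mem hn)
    have h3 : sInf K ≤ sSup K := csInf_le hK.bddBelow (hK.sSup_mem hn)
    refine ⟨(α + sInf K)/2, (β + sSup K)/2, by linarith [h1.1], by linarith [h2.2], by linarith [h1.1, h2.2], fun x hx => ?_⟩
    have h4 := csInf_le hK.bddBelow hx
    have h5 := le_csSup hK.bddAbove hx
    constructor <;> linarith [h1.1, h2.2]

lemma primit {f : ℝ → ℝ} (hf : TF f) {α β : ℝ} (hab : α < β) (hs : tsupport f ⊆ Ioo α β) (h0 : ∫ t, f t = 0) : 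
    ∃ L : ℝ → ℝ, TF L ∧ tsupport L ⊆ Ioo α β ∧ deriv L = f ∧ ∀ t, |L t| ≤ ∫ u, |f u| := by
  obtain ⟨a, b, ha, hb, hlt, hK⟩ := cpt_Ioo hf.cp.isCompact hs hab
  have hz : ∀ t ∉ Ioo a b, f t = 0 := fun t ht => image_eq_zero_of_notMem_tsupport fun h => ht (hK h)
  set L : ℝ → ℝ := fun t => ∫ u in a..t, f u with hL
  have hd : ∀ t, HasDerivAt L (f t) t := fun t => 
    intervalIntegral.integral_hasDerivAt_right (hf.cont.intervalIntegrable a t) (hf.cont.stronglyMeasurableAtFilter _ _) hf.cont.continuousAt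
  have dL : deriv L = f := funext fun t => (hd t).deriv
  have sL : tsupport L ⊆ Icc a b := by
    refine closure_minimal (fun t ht => ?_) isClosed_Icc
    by_contra hc
    apply ht
    by_cases h1 : a ≤ t
    · have h2 : b < t := by by_contra h; exact hc ⟨h1, not_lt.1 h⟩
      rw [hL]
      simp only
      rw [intervalIntegral.integral_eq_integral_of_support_subset, h0]
      intro u hu
      by_contra h
      exact hu (hz u fun k => h ⟨k.1, (k.2.trans h2).le⟩)
    · push Not at h1
      rw [hL]
      simp only
      rw [intervalIntegral.integral_symm, intervalIntegral.integral_of_le h1.le, neg_eq_zero]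
      refine setIntegral_eq_zero_of_forall_eq_zero fun u hu => hz u fun k => ?_
      linarith [k.1, hu.2]
  refine ⟨L, ⟨?_, ?_⟩, sL.trans fun t ht => ⟨ha.trans_le ht.1, ht.2.trans_lt hb⟩, dL, fun t => ?_⟩
  · rw [contDiff_infty_iff_deriv, dL]; exact ⟨fun t => (hd t).differentiableAt, hf.sm⟩
  · exact isCompact_Icc.of_isClosed_subset (isClosed_tsupport _) sL
  · have hi : Integrable f volume := hf.integrable
    have h1 : |L t| ≤ ∫ u in uIoc a t, |f u| := intervalIntegral.norm_integral_le_integral_norm_uIoc (f := f) (μ := volume)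
    exact h1.trans (setIntegral_le_integral hi.abs (Eventually.of_forall fun u => abs_nonneg _))

lemma FF_L1 {O : Set X4} {V : Fin 3 → X4 → ℝ} {D : Fin 3 → Fin 3 → X4 → ℝ} (h : SolD O V D) (i : Fin 3) : Integrable (FF V D i) :=
  integrable_finsetSum _ fun j _ => int_l2 (h.hV j) (ww_L2 h j i)

lemma int_bd {G ψ : X4 → ℝ} {S : Set X4} (hG : IntegrableOn G S volume) (hS : MeasurableSet S) {A : ℝ} (h1 : ∀ z, |ψ z| ≤ A) 
    (h2 : ∀ z ∉ S, ψ z = 0) : |∫ z, G z * ψ z| ≤ A * ∫ z in S, |G z| := by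
  rw [← integral_indicator hS, ← integral_const_mul, ← Real.norm_eq_abs]
  have hG2 : IntegrableOn (fun z => |G z|) S volume := Integrable.abs hG
  have hG3 : Integrable (S.indicator fun z => |G z|) := (integrable_indicator_iff hS).2 hG2
  refine norm_integral_le_of_norm_le (hG3.const_mul A) (Eventually.of_forall fun z => ?_)
  by_cases hz : z ∈ S
  · rw [indicator_of_mem hz, norm_mul, mul_comm, Real.norm_eq_abs, Real.norm_eq_abs]
    exact mul_le_mul_of_nonneg_right (h1 z) (abs_nonneg _)
  · simp [h2 z hz, hz]

lemma windowL {O : Set X4} {V : Fin 3 → X4 → ℝ} {D : Fin 3 → Fin 3 → X4 → ℝ} (h : SolD O V D) {B : Set E3} {α β : ℝ} (hab : α < β)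
    (hB : MeasurableSet B) (hfin : volume (B ×ˢ Ioo α β) < ∞) (hO : B ×ˢ Ioo α β ⊆ O) {f : E3 → ℝ} (hf : TF f) (hfs : tsupport f ⊆ B) {A0 A1 A2 Bm : ℝ}
    (h0 : ∀ x, |f x| ≤ A0) (h1 : ∀ i x, |dd (es i) f x| ≤ A1) (h2 : ∀ x, |lap3 f x| ≤ A2) {μ l : ℝ → ℝ} (hμ : TF μ) (hl : TF l)
    (hμs : tsupport μ ⊆ Ioo α β) (hls : tsupport l ⊆ Ioo α β) (hμ0 : ∀ t, 0 ≤ μ t) (hμ1 : ∫ t, μ t = 1) (hμb : ∀ t, μ t ≤ Bm) (a b : Fin 3) :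
    |∫ z, ww D a b z * (f z.1 * l z.2)| ≤ (∫ t, |l t|) * ((A0 * Bm + 2 * A2) * (∫ z in B ×ˢ Ioo α β, |ww D a b z|) 
      + 2 * A1 * ((∫ z in B ×ˢ Ioo α β, |FF V D a z|) + ∫ z in B ×ˢ Ioo α β, |FF V D b z|)) := by
  set S := B ×ˢ Ioo α β with hSd
  have hS : MeasurableSet S := hB.prod measurableSet_Ioo
  set I := ∫ t, l t with hI
  set N := ∫ t, |l t| with hN
  have hIN : |I| ≤ N := abs_integral_le_integral_abs
  have hN0 : 0 ≤ N := integral_nonneg fun t => abs_nonneg _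
  have hA0 : 0 ≤ A0 := (abs_nonneg _).trans (h0 0)
  have hA1 : 0 ≤ A1 := (abs_nonneg _).trans (h1 0 0)
  have hA2 : 0 ≤ A2 := (abs_nonneg _).trans (h2 0)
  have hBm : 0 ≤ Bm := (hμ0 0).trans (hμb 0)
  have tI : TF (fun t => I * μ t) := TF.mul contDiff_const hμ
  have tg : TF (fun t => l t - I * μ t) := hl.sub tI
  have tgs : tsupport (fun t => l t - I * μ t) ⊆ Ioo α β := by
    refine (tsupport_sub _ _).trans (union_subset hls ((tsupport_mul_subset_right).trans hμs))
  have tg0 : ∫ t, (l t - I * μ t) = 0 := by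
    rw [integral_sub hl.integrable tI.integrable, integral_const_mul, hμ1]; simp [hI]
  obtain ⟨L, tL, Ls, Ld, Lb⟩ := primit tg hab tgs tg0
  have Lb2 : ∀ t, |L t| ≤ 2 * N := by
    intro t
    refine (Lb t).trans ?_
    have : ∫ t, |l t - I * μ t| ≤ ∫ t, (|l t| + |I| * μ t) := by
      refine integral_mono tg.integrable.abs (hl.integrable.abs.add (hμ.integrable.const_mul _)) fun t => ?_
      refine (abs_sub _ _).trans ?_
      rw [abs_mul, abs_of_nonneg (hμ0 t)]
    refine this.trans ?_
    rw [integral_add hl.integrable.abs (hμ.integrable.const_mul _), integral_const_mul, hμ1]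
    linarith
  have tψ := prod_TF hf tL
  have sψ : tsupport (fun z : X4 => f z.1 * L z.2) ⊆ S := (prod_supp f L).trans (prod_mono hfs Ls)
  have ve := h.ve a b _ tψ (sψ.trans hO)
  have hw := ww_L2 h a b
  have zero : ∀ {p : E3 → ℝ} {q : ℝ → ℝ}, tsupport p ⊆ B → tsupport q ⊆ Ioo α β → ∀ z ∉ S, p z.1 * q z.2 = 0 := by
    intro p q hp hq z hz
    by_cases k : z.1 ∈ B
    · rw [image_eq_zero_of_notMem_tsupport (f := q) fun k2 => hz ⟨k, hq k2⟩, mul_zero]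
    · rw [image_eq_zero_of_notMem_tsupport (f := p) fun k2 => k (hp k2), zero_mul]
  have tlap : TF (lap3 f) := TF.sum _ fun _ => (hf.dd _).dd _
  have slap : tsupport (lap3 f) ⊆ B := by
    refine (closure_minimal (fun x hx => ?_) (isClosed_tsupport f)).trans hfs
    by_contra hc
    apply hx
    refine Finset.sum_eq_zero fun i _ => ?_
    exact image_eq_zero_of_notMem_tsupport fun k => hc (tsupport_dd _ _ (tsupport_dd _ _ k))
  have e1 : ∫ z, ww D a b z * heat (fun z : X4 => f z.1 * L z.2) z = (∫ z, ww D a b z * (f z.1 * l z.2)) 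
      - (∫ z, ww D a b z * (f z.1 * (I * μ z.2))) + ∫ z, ww D a b z * (lap3 f z.1 * L z.2) := by
    have i1 : Integrable (fun z : X4 => ww D a b z * (f z.1 * l z.2)) := int_l2 hw (prod_TF hf hl).memLp
    have i2 : Integrable (fun z : X4 => ww D a b z * (f z.1 * (I * μ z.2))) := int_l2 hw (prod_TF hf tI).memLp
    have i3 : Integrable (fun z : X4 => ww D a b z * (lap3 f z.1 * L z.2)) := int_l2 hw (prod_TF tlap tL).memLp
    have i12 : Integrable (fun z : X4 => ww D a b z * (f z.1 * l z.2) - ww D a b z * (f z.1 * (I * μ z.2))) := i1.sub i2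
    rw [← integral_sub i1 i2, ← integral_add i12 i3]
    congr 1; funext z
    rw [heat_prod hf tL, Ld]; ring
  rw [e1] at ve
  have : IsFiniteMeasure (volume.restrict S) := ⟨by simpa using hfin⟩
  have hwi : IntegrableOn (ww D a b) S := (hw.restrict S).integrable one_le_two
  have hFa : IntegrableOn (FF V D a) S := (FF_L1 h a).integrableOn
  have hFb : IntegrableOn (FF V D b) S := (FF_L1 h b).integrableOn
  have m1 : ∀ {p q A B : ℝ}, |p| ≤ A → |q| ≤ B → |p * q| ≤ A * B := fun h1 h2 => by
    rw [abs_mul]; exact mul_le_mul h1 h2 (abs_nonneg _) ((abs_nonneg _).trans h1)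
  have b1 := int_bd hwi hS (ψ := fun z : X4 => f z.1 * (I * μ z.2)) (A := A0 * (N * Bm)) 
    (fun z => m1 (h0 _) (m1 hIN (by rw [abs_of_nonneg (hμ0 _)]; exact hμb _))) (zero (q := fun t => I * μ t) hfs ((tsupport_mul_subset_right (f := fun _ => I)).trans hμs))
  have b2 := int_bd hwi hS (ψ := fun z : X4 => lap3 f z.1 * L z.2) (A := A2 * (2 * N)) 
    (fun z => m1 (h2 _) (Lb2 _)) (zero slap Ls)
  have b3 : ∀ i {G : X4 → ℝ}, IntegrableOn G S → |∫ z, G z * dd (ex i) (fun z : X4 => f z.1 * L z.2) z| ≤ A1 * (2 * N) * ∫ z in S, |G z| := by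
    intro i G hG
    refine int_bd hG hS (fun z => ?_) fun z hz => ?_
    · rw [dd_px hf.diff tL.diff]; exact m1 (h1 _ _) (Lb2 _)
    · rw [dd_px hf.diff tL.diff]; exact zero ((tsupport_dd _ _).trans hfs) Ls z hz
  have b3a := b3 b hFa
  have b3b := b3 a hFb
  rw [abs_le] at b1 b2 b3a b3b ⊢
  constructor <;> nlinarith [b1.1, b1.2, b2.1, b2.2, b3a.1, b3a.2, b3b.1, b3b.2]

lemma ae_bd {G : ℝ → ℝ} (hG : Integrable G) {U : Set ℝ} {C : ℝ} (hC : ∀ s ∈ U, ∃ δ > 0, ∀ l : ℝ → ℝ, TF l → (∀ t, 0 ≤ l t) → 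
    tsupport l ⊆ Metric.ball s δ → |∫ t, G t * l t| ≤ C * ∫ t, l t) : ∀ᵐ s, s ∈ U → |G s| ≤ C := by
  let φ : ℕ → ContDiffBump (0 : ℝ) := fun n => 
    ⟨1 / 2 / (n + 2), 1 / (n + 2), by positivity, by
      rw [div_right_comm]; exact half_lt_self (by positivity)⟩
  have hφ : Tendsto (fun n => (φ n).rOut) atTop (nhds 0) := by
    show Tendsto (fun n : ℕ => 1 / ((n : ℝ) + 2)) atTop (nhds 0)
    exact Tendsto.const_div_atTop (tendsto_natCast_atTop_atTop.atTop_add tendsto_const_nhds) 1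
  have h2 : ∀ n, (φ n).rOut ≤ 2 * (φ n).rIn := fun n => by
    show 1 / ((n : ℝ) + 2) ≤ 2 * (1 / 2 / (n + 2))
    apply le_of_eq; ring
  filter_upwards [ContDiffBump.ae_convolution_tendsto_right_of_locallyIntegrable hφ (Eventually.of_forall h2) hG.locallyIntegrable] with s hs hsU
  obtain ⟨δ, hδ, h⟩ := hC s hsU
  refine le_of_tendsto hs.abs ?_
  filter_upwards [hφ.eventually (gt_mem_nhds hδ)] with n hn
  have ht : TF ((φ n).normed volume) := ⟨(φ n).contDiff_normed, (φ n).hasCompactSupport_normed⟩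
  have h3 := h _ (ht.refl s) (fun t => (φ n).nonneg_normed _) ?_
  · rw [integral_sub_left_eq_self (fun t => (φ n).normed volume t), (φ n).integral_normed, mul_one] at h3
    rw [convolution_eq_swap]
    simpa [mul_comm] using h3
  · refine (tsupport_comp_subset_preimage ((φ n).normed volume) (by fun_prop : Continuous fun y : ℝ => s - y)).trans fun y hy => ?_
    rw [mem_preimage, (φ n).tsupport_normed_eq] at hy
    rw [Metric.mem_ball, dist_comm, dist_eq_norm]
    simp only [Metric.mem_closedBall, dist_zero_right] at hy
    exact hy.trans_lt hn

lemma fk_supp {x : E3} (h : 1 ≤ ‖x‖) : fk x = 0 := by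
  unfold fk; rw [mtd_zero2 (by nlinarith), mul_zero]

def phn (ρ : ℝ) (x1 x : E3) : ℝ := ρ⁻¹ ^ 3 * fk (ρ⁻¹ • (x - x1))

lemma phn_zero {ρ : ℝ} (hρ : 0 < ρ) {x1 x : E3} (h : x ∉ Metric.ball x1 ρ) : phn ρ x1 x = 0 := by
  rw [Metric.mem_ball, dist_eq_norm, not_lt] at h
  unfold phn
  rw [fk_supp, mul_zero]
  rw [norm_smul, norm_inv, Real.norm_eq_abs, abs_of_pos hρ, inv_mul_eq_div]
  exact (one_le_div hρ).2 h

lemma int_phn {ρ : ℝ} (hρ : 0 < ρ) (x1 : E3) : ∫ x, phn ρ x1 x = cf := by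
  unfold phn
  rw [integral_const_mul, integral_sub_right_eq_self (fun x => fk (ρ⁻¹ • x)) x1, Measure.integral_comp_smul]
  simp only [finrank_euclideanSpace, Fintype.card_fin, smul_eq_mul, inv_pow, inv_inv]
  rw [abs_of_pos (by positivity)]
  rw [← mul_assoc, inv_mul_cancel₀ (by positivity), one_mul]; rfl

lemma leb {u : E3 → ℝ} (hu : Integrable u) {ρ : ℕ → ℝ} (hρ : ∀ n, 0 < ρ n) (hl : Tendsto ρ atTop (nhds 0)) : 
    ∀ᵐ x1, Tendsto (fun n => ∫ x, u x * phn (ρ n) x1 x) atTop (nhds (cf * u x1)) := by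
  obtain ⟨C, hC⟩ := fk_TF.bdd
  have hc : cf ≠ 0 := cf_neg.ne
  filter_upwards [(Besicovitch.vitaliFamily volume).ae_tendsto_average_norm_sub hu.locallyIntegrable] with x1 h0
  have hρ' : Tendsto ρ atTop (nhdsWithin 0 (Ioi 0)) := tendsto_nhdsWithin_iff.2 ⟨hl, Eventually.of_forall hρ⟩
  have h1 := (h0.comp (Besicovitch.tendsto_filterAt volume x1)).comp hρ'
  have h2 := tendsto_integral_smul_of_tendsto_average_norm_sub (g := fun n x => cf⁻¹ * phn (ρ n) x1 x) 
    (|cf⁻¹| * C * volume.real (Metric.closedBall (0 : E3) 1)) h1 (Eventually.of_forall fun n => hu.integrableOn) ?_ ?_ ?_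
  · refine (h2.const_mul cf).congr fun n => ?_
    rw [← integral_const_mul]
    congr 1; funext x
    simp only [smul_eq_mul]
    field_simp
  · refine tendsto_const_nhds.congr fun n => ?_
    rw [integral_const_mul, int_phn (hρ n), inv_mul_cancel₀ hc]
  · refine Eventually.of_forall fun n x hx => ?_
    by_contra hk
    apply hx
    show cf⁻¹ * _ = 0
    rw [phn_zero (hρ n) (fun k => hk (Metric.ball_subset_closedBall k)), mul_zero]
  · refine Eventually.of_forall fun n x => ?_
    have hp := hρ n
    have e : volume.real (Metric.closedBall x1 (ρ n)) = ρ n ^ 3 * volume.real (Metric.closedBall (0 : E3) 1) := by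
      rw [Measure.addHaar_real_closedBall' _ _ hp.le]; simp
    have hv : 0 < volume.real (Metric.closedBall (0 : E3) 1) := by
      apply ENNReal.toReal_pos
      · exact (Metric.measure_closedBall_pos _ _ one_pos).ne'
      · exact (isCompact_closedBall _ _).measure_lt_top.ne
    show _ ≤ _ / volume.real (Metric.closedBall x1 (ρ n))
    rw [e, mul_div_mul_right _ _ hv.ne', le_div_iff₀ (by positivity)]
    unfold phn
    rw [abs_mul, abs_mul, abs_of_pos (by positivity : 0 < (ρ n)⁻¹ ^ 3)]
    have := hC ((ρ n)⁻¹ • (x - x1))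
    rw [Real.norm_eq_abs] at this
    calc |cf⁻¹| * ((ρ n)⁻¹ ^ 3 * |fk ((ρ n)⁻¹ • (x - x1))|) * ρ n ^ 3 = |cf⁻¹| * |fk ((ρ n)⁻¹ • (x - x1))| := by field_simp
      _ ≤ _ := mul_le_mul_of_nonneg_left this (abs_nonneg _)

lemma vw {O : Set X4} {V : Fin 3 → X4 → ℝ} {D : Fin 3 → Fin 3 → X4 → ℝ} (h : SolD O V D) {K : E3 → ℝ} {l : ℝ → ℝ} (hK : TF K) (hl : TF l)
    (hs : tsupport K ×ˢ tsupport l ⊆ O) (j : Fin 3) : 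
    ∫ z, V j z * (lap3 K z.1 * l z.2) = - ∑ i, ∫ z, ww D i j z * (dd (es i) K z.1 * l z.2) := by
  have t1 : ∀ i, TF (fun z : X4 => dd (es i) K z.1 * l z.2) := fun i => prod_TF (hK.dd _) hl
  have s1 : ∀ i, tsupport (fun z : X4 => dd (es i) K z.1 * l z.2) ⊆ O := fun i => 
    (prod_supp _ _).trans ((prod_mono (tsupport_dd _ _) subset_rfl).trans hs)
  have g1 : ∀ i k m, ∫ z, V m z * (dd (es i) (dd (es k) K) z.1 * l z.2) = - ∫ z, D i m z * (dd (es k) K z.1 * l z.2) := by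
    intro i k m
    rw [← h.wg i m _ (t1 k) (s1 k)]
    congr 1; funext z
    rw [dd_px (hK.dd _).diff hl.diff]
  have iD : ∀ i k m, Integrable (fun z : X4 => D i m z * (dd (es k) K z.1 * l z.2)) := fun i k m => int_l2 (h.hD i m) (t1 k).memLp
  have e1 : ∫ z, V j z * (lap3 K z.1 * l z.2) = - ∑ i, ∫ z, D i j z * (dd (es i) K z.1 * l z.2) := by
    rw [← Finset.sum_neg_distrib]
    simp_rw [← g1]
    rw [← integral_finsetSum _ fun i _ => int_l2 (h.hV j) (prod_TF ((hK.dd _).dd _) hl).memLp]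
    congr 1; funext z
    rw [lap3, Finset.sum_mul, Finset.mul_sum]
  have e2 : ∑ i, ∫ z, D j i z * (dd (es i) K z.1 * l z.2) = 0 := by
    have : ∀ i, ∫ z, D j i z * (dd (es i) K z.1 * l z.2) = ∫ z, D i i z * (dd (es j) K z.1 * l z.2) := by
      intro i
      rw [← neg_inj, ← g1, ← g1, dd_comm hK.sm]
    simp_rw [this]
    rw [← integral_finsetSum _ fun i _ => iD i j i]
    apply integral_eq_zero_of_ae
    filter_upwards [h.dv] with z hz
    rw [← Finset.sum_mul, hz]; simp
  rw [e1]
  congr 1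
  have : ∀ i, ∫ z, ww D i j z * (dd (es i) K z.1 * l z.2) = (∫ z, D i j z * (dd (es i) K z.1 * l z.2)) - ∫ z, D j i z * (dd (es i) K z.1 * l z.2) := by
    intro i
    rw [← integral_sub (iD _ _ _) (iD _ _ _)]
    congr 1; funext z
    rw [ww, sub_mul]
  simp_rw [this]
  rw [Finset.sum_sub_distrib, e2, sub_zero]

def kn (K : E3 → ℝ) (ρ : ℝ) (x1 x : E3) : ℝ := ρ⁻¹ * K (ρ⁻¹ • (x - x1))

lemma scal_TF {K : E3 → ℝ} (hK : TF K) (a : ℝ) {b : ℝ} (hb : 0 < b) (x1 : E3) : TF (fun x => a * K (b • (x - x1))) := by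
  have hh : Topology.IsClosedEmbedding (fun x : E3 => b • (x - x1)) := 
    ((Homeomorph.subRight x1).trans (Homeomorph.smulOfNeZero b hb.ne')).isClosedEmbedding
  refine TF.mul contDiff_const ⟨hK.sm.comp (by fun_prop), hK.cp.comp_isClosedEmbedding hh⟩

lemma kn_TF {K : E3 → ℝ} (hK : TF K) {ρ : ℝ} (hρ : 0 < ρ) (x1 : E3) : TF (kn K ρ x1) := scal_TF hK _ (inv_pos.2 hρ) x1

lemma kn_supp {K : E3 → ℝ} (hs : tsupport K ⊆ Metric.ball 0 1) {ρ : ℝ} (hρ : 0 < ρ) (x1 : E3) : tsupport (kn K ρ x1) ⊆ Metric.ball x1 ρ := by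
  refine (tsupport_mul_subset_right (f := fun _ => ρ⁻¹)).trans ?_
  refine (tsupport_comp_subset_preimage K (by fun_prop : Continuous fun x : E3 => ρ⁻¹ • (x - x1))).trans fun x hx => ?_
  have := hs hx
  rw [Metric.mem_ball, dist_zero_right, norm_smul, norm_inv, Real.norm_eq_abs, abs_of_pos hρ, inv_mul_eq_div, div_lt_one hρ] at this
  rwa [Metric.mem_ball, dist_eq_norm]

lemma dd_sc {f : E3 → ℝ} (hf : TF f) (c a : ℝ) (x1 u : E3) : 
    dd u (fun x => c * f (a • (x - x1))) = fun x => (c * a) * dd u f (a • (x - x1)) := by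
  funext x
  rw [dd_cmul c u (f := fun x => f (a • (x - x1))) (hf.diff.comp (by fun_prop)) x, dd_scale hf.diff, mul_assoc]

lemma lap3_sc {f : E3 → ℝ} (hf : TF f) (c a : ℝ) (x1 : E3) : 
    lap3 (fun x => c * f (a • (x - x1))) = fun x => (c * a * a) * lap3 f (a • (x - x1)) := by
  funext x
  unfold lap3
  rw [Finset.mul_sum]
  refine Finset.sum_congr rfl fun i _ => ?_
  rw [dd_sc hf, dd_sc (hf.dd _)]

lemma kn_lap {θ : ℝ} {K : E3 → ℝ} (hK : TF K) (hl : ∀ x, lap3 K x = fk x - θ⁻¹ ^ 3 * fk (θ⁻¹ • x)) {ρ : ℝ} (x1 x : E3) :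
    lap3 (kn K ρ x1) x = phn ρ x1 x - phn (θ * ρ) x1 x := by
  unfold kn phn
  rw [lap3_sc hK]
  simp only [hl, smul_smul, mul_inv]
  ring

lemma kn_bd {K : E3 → ℝ} (hK : TF K) : ∃ A, 0 ≤ A ∧ ∀ ρ : ℝ, 0 < ρ → ∀ x1 i, (∀ x, |dd (es i) (kn K ρ x1) x| ≤ A * ρ⁻¹ ^ 2) ∧ 
    (∀ j x, |dd (es j) (dd (es i) (kn K ρ x1)) x| ≤ A * ρ⁻¹ ^ 3) ∧ ∀ x, |lap3 (dd (es i) (kn K ρ x1)) x| ≤ A * ρ⁻¹ ^ 4 := by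
  choose A0 hA0 using fun i => (hK.dd (es i)).bdd
  choose A1 hA1 using fun i j => ((hK.dd (es i)).dd (es j)).bdd
  have tl : ∀ i, TF (lap3 (dd (es i) K)) := fun i => TF.sum _ fun _ => ((hK.dd _).dd _).dd _
  choose A2 hA2 using fun i => (tl i).bdd
  have p0 : ∀ i, 0 ≤ A0 i := fun i => (norm_nonneg _).trans (hA0 i 0)
  have p1 : ∀ i j, 0 ≤ A1 i j := fun i j => (norm_nonneg _).trans (hA1 i j 0)
  have p2 : ∀ i, 0 ≤ A2 i := fun i => (norm_nonneg _).trans (hA2 i 0)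
  have q0 : ∀ i, A0 i ≤ ∑ i, A0 i := fun i => Finset.single_le_sum (fun i _ => p0 i) (Finset.mem_univ i)
  have q1 : ∀ i j, A1 i j ≤ ∑ i, ∑ j, A1 i j := fun i j => (Finset.single_le_sum (fun j _ => p1 i j) (Finset.mem_univ j)).trans 
    (Finset.single_le_sum (f := fun i => ∑ j, A1 i j) (fun i _ => Finset.sum_nonneg fun j _ => p1 i j) (Finset.mem_univ i))
  have q2 : ∀ i, A2 i ≤ ∑ i, A2 i := fun i => Finset.single_le_sum (fun i _ => p2 i) (Finset.mem_univ i)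
  have r0 : 0 ≤ ∑ i, A0 i := Finset.sum_nonneg fun i _ => p0 i
  have r1 : 0 ≤ ∑ i, ∑ j, A1 i j := Finset.sum_nonneg fun i _ => Finset.sum_nonneg fun j _ => p1 i j
  have r2 : 0 ≤ ∑ i, A2 i := Finset.sum_nonneg fun i _ => p2 i
  refine ⟨(∑ i, A0 i) + (∑ i, ∑ j, A1 i j) + ∑ i, A2 i, by positivity, fun ρ hρ x1 i => ?_⟩
  have e0 : dd (es i) (kn K ρ x1) = fun x => (ρ⁻¹ * ρ⁻¹) * dd (es i) K (ρ⁻¹ • (x - x1)) := dd_sc hK _ _ _ _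
  have key : ∀ {p A c d B : ℝ}, |p| ≤ A → A ≤ B → 0 ≤ c → c = d → |c * p| ≤ B * d := by
    intro p A c d B h1 h2 h3 h4
    rw [abs_mul, abs_of_nonneg h3, ← h4, mul_comm]
    exact mul_le_mul_of_nonneg_right (h1.trans h2) h3
  refine ⟨fun x => ?_, fun j x => ?_, fun x => ?_⟩
  · rw [e0]; exact key (hA0 i _) (by linarith [q0 i]) (by positivity) (by ring)
  · rw [e0, dd_sc (hK.dd _)]; exact key (hA1 i j _) (by linarith [q1 i j]) (by positivity) (by ring)
  · rw [e0, lap3_sc (hK.dd _)]; exact key (hA2 i _) (by linarith [q2 i]) (by positivity) (by ring)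

lemma mu_ex : ∃ C : ℝ, 0 ≤ C ∧ ∀ s ρ : ℝ, 0 < ρ → ∃ μ : ℝ → ℝ, TF μ ∧ tsupport μ ⊆ Ioo (s - ρ ^ 2) s ∧ (∀ t, 0 ≤ μ t) ∧ ∫ t, μ t = 1 ∧ 
    ∀ t, μ t ≤ C * ρ⁻¹ ^ 2 := by
  obtain ⟨C, hC⟩ := mtd_TF.bdd
  have hC0 : 0 ≤ C := (norm_nonneg _).trans (hC 0)
  have i1 : ∫ t, deriv mtr t = 1 := by
    have h1 : ∫ t in (0:ℝ)..3, deriv mtr t = mtr 3 - mtr 0 := intervalIntegral.integral_deriv_eq_sub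
      (fun t _ => mtr_smooth.differentiable (by simp) t) (mtd_TF.cont.intervalIntegrable _ _)
    rw [mtr_one (by norm_num), mtr_zero (by norm_num), intervalIntegral.integral_eq_integral_of_support_subset] at h1
    · rw [h1]; norm_num
    · intro u hu
      by_contra hk
      rw [mem_Ioc, not_and_or, not_lt, not_le] at hk
      rcases hk with hk | hk
      · exact hu (mtd_zero (by linarith))
      · exact hu (mtd_zero2 (by linarith))
  refine ⟨4 * C, by positivity, fun s ρ hρ => ?_⟩
  have hb : 0 < 4 * ρ⁻¹ ^ 2 := by positivity
  set b := 4 * ρ⁻¹ ^ 2 with hbd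
  have hbr : b * ρ ^ 2 = 4 := by rw [hbd]; field_simp
  set y := s - ρ ^ 2 with hy
  have tk : TF (fun t => b * deriv mtr (b * (t - y))) := by
    have hh : Topology.IsClosedEmbedding (fun x : ℝ => b * (x - y)) := 
      ((Homeomorph.subRight y).trans (Homeomorph.mulLeft₀ b hb.ne')).isClosedEmbedding
    refine TF.mul contDiff_const ⟨mtd_TF.sm.comp (by fun_prop), mtd_TF.cp.comp_isClosedEmbedding hh⟩
  refine ⟨_, tk, ?_, fun t => mul_nonneg hb.le (mtd_nonneg _), ?_, fun t => ?_⟩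
  · have : tsupport (fun t => b * deriv mtr (b * (t - y))) ⊆ Icc (y + ρ ^ 2 / 4) (y + ρ ^ 2 / 2) := by
      refine closure_minimal (fun t ht => ?_) isClosed_Icc
      have h1 : ¬ (b * (t - y) < 1) := fun k => ht (by simp [mtd_zero k])
      have h2 : ¬ (2 < b * (t - y)) := fun k => ht (by simp [mtd_zero2 k])
      rw [not_lt] at h1 h2
      constructor <;> by_contra k <;> nlinarith
    refine this.trans fun t ht => ⟨?_, ?_⟩
    · nlinarith [ht.1]
    · nlinarith [ht.2]
  · rw [integral_const_mul, integral_sub_right_eq_self (fun t => deriv mtr (b * t)) y, Measure.integral_comp_mul_left, i1, abs_of_pos (by positivity)]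
    simp [hb.ne']
  · have := (le_abs_self _).trans (hC (b * (t - y)))
    rw [hbd]
    nlinarith

lemma int_w {D : Fin 3 → Fin 3 → X4 → ℝ} {W : X4 → ℝ} (hW : MemLp W 2 volume) (hw : ∀ a b z, |ww D a b z| ≤ W z) (z : X4) {ρ : ℝ} (hρ : 0 < ρ) 
    (a b : Fin 3) : ∫ y in pcyl z ρ, |ww D a b y| ≤ Real.sqrt (ρ ^ 5 * vb) * wn W (pcyl z ρ) := by
  have hf : IsFiniteMeasure (volume.restrict (pcyl z ρ)) := ⟨by simpa using pcyl_fin z ρ⟩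
  have h1 := cs2 (memLp_const (μ := volume.restrict (pcyl z ρ)) (1:ℝ)) (hW.restrict (pcyl z ρ))
  have e : ∫ y in pcyl z ρ, (1:ℝ) ^ 2 = ρ ^ 5 * vb := by simp [pcyl_vol z hρ]
  rw [e] at h1
  refine le_trans ?_ h1
  refine integral_mono_of_nonneg (Eventually.of_forall fun y => abs_nonneg _) ?_ (Eventually.of_forall fun y => ?_)
  · simpa using ((hW.restrict (pcyl z ρ)).integrable one_le_two).abs
  · simpa using (hw a b y).trans (le_abs_self _)

lemma int_V {V : X4 → ℝ} (hV : MemLp V 2 volume) {M : ℝ} (hM : ∀ᵐ t : ℝ, ∫ x, V (x, t) ^ 2 ≤ M ^ 2) (h0 : 0 ≤ M) (z : X4) {ρ : ℝ} (hρ : 0 < ρ) : 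
    Real.sqrt (∫ y in pcyl z ρ, V y ^ 2) ≤ M * ρ := by
  rw [← Real.sqrt_sq (by positivity : 0 ≤ M * ρ)]
  apply Real.sqrt_le_sqrt
  have hv : (volume : Measure X4) = (volume : Measure E3).prod (volume : Measure ℝ) := rfl
  have hi : Integrable (fun y => V y ^ 2) ((volume : Measure E3).prod (volume : Measure ℝ)) := hV.integrable_sq
  set I := Ioo (z.2 - ρ ^ 2) z.2
  have hi2 : Integrable (fun y => V y ^ 2) ((volume : Measure E3).prod (volume.restrict I)) := by
    have := hi.restrict (s := univ ×ˢ I)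
    rwa [← Measure.prod_restrict, Measure.restrict_univ] at this
  calc ∫ y in pcyl z ρ, V y ^ 2 ≤ ∫ y in univ ×ˢ I, V y ^ 2 := by
        refine setIntegral_mono_set hi.integrableOn (Eventually.of_forall fun y => sq_nonneg _) 
          (LE.le.eventuallyLE (prod_mono (subset_univ _) subset_rfl))
    _ = ∫ y, V y ^ 2 ∂((volume : Measure E3).prod (volume.restrict I)) := by
        rw [hv, ← Measure.prod_restrict, Measure.restrict_univ]
    _ = ∫ t in I, ∫ x, V (x, t) ^ 2 := integral_prod_symm _ hi2
    _ ≤ ∫ t in I, M ^ 2 := by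
        refine integral_mono_ae hi2.integral_prod_right (integrable_const _) (ae_restrict_of_ae hM)
    _ = (M * ρ) ^ 2 := by
        simp [I, Real.volume_Ioo, Measure.real]
        rw [ENNReal.toReal_ofReal (by positivity)]; ring

lemma int_F {O : Set X4} {V : Fin 3 → X4 → ℝ} {D : Fin 3 → Fin 3 → X4 → ℝ} (h : SolD O V D) {W : X4 → ℝ} (hW : MemLp W 2 volume) (hw : ∀ a b z, |ww D a b z| ≤ W z) 
    {M : ℝ} (hM : ∀ j, ∀ᵐ t : ℝ, ∫ x, V j (x, t) ^ 2 ≤ M ^ 2) (h0 : 0 ≤ M) (z : X4) {ρ : ℝ} (hρ : 0 < ρ) 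
    (i : Fin 3) : ∫ y in pcyl z ρ, |FF V D i y| ≤ 3 * (M * ρ * wn W (pcyl z ρ)) := by
  have hi : ∀ j, Integrable (fun y => |V j y * W y|) (volume.restrict (pcyl z ρ)) := fun j => (int_l2 (h.hV j) hW).abs.restrict
  calc ∫ y in pcyl z ρ, |FF V D i y| ≤ ∫ y in pcyl z ρ, ∑ j, |V j y * W y| := by
        refine integral_mono_of_nonneg (Eventually.of_forall fun y => abs_nonneg _) (integrable_finsetSum _ fun j _ => hi j) (Eventually.of_forall fun y => ?_)
        refine (Finset.abs_sum_le_sum_abs _ _).trans (Finset.sum_le_sum fun j _ => ?_)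
        rw [abs_mul, abs_mul]
        exact mul_le_mul_of_nonneg_left ((hw _ _ _).trans (le_abs_self _)) (abs_nonneg _)
    _ = ∑ j, ∫ y in pcyl z ρ, |V j y * W y| := integral_finsetSum _ fun j _ => hi j
    _ ≤ ∑ j : Fin 3, M * ρ * wn W (pcyl z ρ) := Finset.sum_le_sum fun j _ => 
        (cs2 ((h.hV j).restrict _) (hW.restrict _)).trans (mul_le_mul_of_nonneg_right (int_V (h.hV j) (hM j) h0 z hρ) (Real.sqrt_nonneg _))
    _ = _ := by simp

lemma step1 {K : E3 → ℝ} {θ : ℝ} (hK : TF K) (hKs : tsupport K ⊆ Metric.ball 0 1) (hKl : ∀ x, lap3 K x = fk x - θ⁻¹ ^ 3 * fk (θ⁻¹ • x)) :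
    ∃ B : ℝ, 0 ≤ B ∧ ∀ {O : Set X4} {V : Fin 3 → X4 → ℝ} {D : Fin 3 → Fin 3 → X4 → ℝ} {W : X4 → ℝ} {M : ℝ}, SolD O V D → MemLp W 2 volume → 
    (∀ a b z, |ww D a b z| ≤ W z) → (∀ j, ∀ᵐ t : ℝ, ∫ x, V j (x, t) ^ 2 ≤ M ^ 2) → 0 ≤ M → ∀ (x1 : E3) (s ρ : ℝ), 0 < ρ → pcyl (x1, s) ρ ⊆ O → 
    ∀ l : ℝ → ℝ, TF l → tsupport l ⊆ Ioo (s - ρ ^ 2) s → ∀ j, |∫ z, V j z * ((phn ρ x1 z.1 - phn (θ * ρ) x1 z.1) * l z.2)| 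
      ≤ (∫ t, |l t|) * (B * (ρ⁻¹ ^ 4 * Real.sqrt (ρ ^ 5 * vb) + M * ρ⁻¹ ^ 2) * wn W (pcyl (x1, s) ρ)) := by
  obtain ⟨A, hA, hb⟩ := kn_bd hK
  obtain ⟨C, hC, hm⟩ := mu_ex
  refine ⟨3 * A * (C + 12), by positivity, ?_⟩
  intro O V D W M h hW hw hM hM0 x1 s ρ hρ hO l tl hl j
  obtain ⟨μ, tμ, sμ, μ0, μ1, μb⟩ := hm s ρ hρ
  have tk := kn_TF hK hρ x1
  have sk := kn_supp hKs hρ x1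
  have e := vw h tk tl ((prod_mono sk hl).trans hO) j
  simp_rw [kn_lap hK hKl] at e
  rw [e, abs_neg]
  have hαβ : s - ρ ^ 2 < s := by nlinarith [pow_pos hρ 2]
  set w := wn W (pcyl (x1, s) ρ) with hwd
  have hw0 : 0 ≤ w := wn_nonneg
  set N := ∫ t, |l t| with hN
  have hN0 : 0 ≤ N := integral_nonneg fun t => abs_nonneg _
  set q := Real.sqrt (ρ ^ 5 * vb) with hq
  have hq0 : 0 ≤ q := Real.sqrt_nonneg _
  have each : ∀ i, |∫ z, ww D i j z * (dd (es i) (kn K ρ x1) z.1 * l z.2)| ≤ N * (A * (C + 12) * (ρ⁻¹ ^ 4 * q + M * ρ⁻¹ ^ 2) * w) := by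
    intro i
    obtain ⟨b0, b1, b2⟩ := hb ρ hρ x1 i
    have := windowL h hαβ (Metric.isOpen_ball.measurableSet) (pcyl_fin (x1, s) ρ) hO (tk.dd (es i)) ((tsupport_dd _ _).trans sk) b0 b1 b2 tμ tl sμ hl μ0 μ1 μb i j
    refine this.trans (mul_le_mul_of_nonneg_left ?_ hN0)
    have c1 := int_w hW hw (x1, s) hρ i j
    have c2 := int_F h hW hw hM hM0 (x1, s) hρ i
    have c3 := int_F h hW hw hM hM0 (x1, s) hρ j
    have a1 : 0 ≤ A * ρ⁻¹ ^ 2 * (C * ρ⁻¹ ^ 2) + 2 * (A * ρ⁻¹ ^ 4) := by positivity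
    have a2 : 0 ≤ 2 * (A * ρ⁻¹ ^ 3) := by positivity
    calc _ ≤ (A * ρ⁻¹ ^ 2 * (C * ρ⁻¹ ^ 2) + 2 * (A * ρ⁻¹ ^ 4)) * (q * w) + 2 * (A * ρ⁻¹ ^ 3) * (3 * (M * ρ * w) + 3 * (M * ρ * w)) := 
          add_le_add (mul_le_mul_of_nonneg_left c1 a1) (mul_le_mul_of_nonneg_left (add_le_add c2 c3) a2)
      _ = A * (C + 2) * (ρ⁻¹ ^ 4 * q) * w + 12 * A * (M * ρ⁻¹ ^ 2) * w := by field_simp; ring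
      _ ≤ A * (C + 12) * (ρ⁻¹ ^ 4 * q) * w + (C + 12) * A * (M * ρ⁻¹ ^ 2) * w := by gcongr <;> linarith
      _ = _ := by ring
  refine (Finset.abs_sum_le_sum_abs _ _).trans ((Finset.sum_le_sum fun i _ => each i).trans (le_of_eq ?_))
  simp
  ring

lemma step2 {κ : ℝ} (h0 : 0 < κ) (h1 : κ ≤ 1/2) : ∃ B : ℝ, 0 ≤ B ∧ ∀ {O : Set X4} {V : Fin 3 → X4 → ℝ} {D : Fin 3 → Fin 3 → X4 → ℝ} {W : X4 → ℝ} {M : ℝ}, SolD O V D → MemLp W 2 volume → 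
    (∀ a b z, |ww D a b z| ≤ W z) → (∀ j, ∀ᵐ t : ℝ, ∫ x, V j (x, t) ^ 2 ≤ M ^ 2) → 0 ≤ M → ∀ (x1 : E3) (s R : ℝ), 0 < R → pcyl (x1, s) R ⊆ O → 
    (∀ n : ℕ, wn W (pcyl (x1, s) ((κ^4) ^ n * R)) ≤ (κ ^ 9) ^ n * wn W (pcyl (x1, s) R)) → 
    ∀ (n : ℕ) (l : ℝ → ℝ), TF l → tsupport l ⊆ Ioo (s - ((κ^4) ^ n * R) ^ 2) s → ∀ j, 
      |∫ z, V j z * ((phn ((κ^4) ^ n * R) x1 z.1 - phn ((κ^4) ^ (n + 1) * R) x1 z.1) * l z.2)| 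
      ≤ (∫ t, |l t|) * (B * (R⁻¹ ^ 4 * Real.sqrt (R ^ 5 * vb) + M * R⁻¹ ^ 2) * n2 W * κ ^ n) := by
  have hθ0 : 0 < κ ^ 4 := by positivity
  have hθ1 : κ ^ 4 < 1 := pow_lt_one₀ h0.le (by linarith) (by norm_num)
  obtain ⟨K, tK, sK, lK⟩ := kern hθ0 hθ1
  obtain ⟨B, hB, H⟩ := step1 tK sK lK
  refine ⟨B, hB, ?_⟩
  intro O V D W M h hW hw hM hM0 x1 s R hR hO hdec n l tl hl j
  set q := κ ^ n with hq
  have q0 : 0 < q := pow_pos h0 n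
  have q1 : q ≤ 1 := pow_le_one₀ h0.le (by linarith)
  have e4 : (κ ^ 4) ^ n = q ^ 4 := by rw [hq, ← pow_mul, ← pow_mul, mul_comm]
  have e9 : (κ ^ 9) ^ n = q ^ 9 := by rw [hq, ← pow_mul, ← pow_mul, mul_comm]
  have hd := hdec n
  have q4 : q ^ 4 ≤ 1 := pow_le_one₀ q0.le q1
  rw [pow_succ' (κ ^ 4), mul_assoc]
  rw [e4] at hl hd ⊢
  rw [e9] at hd
  have hρ : 0 < q ^ 4 * R := by positivity
  have hle : q ^ 4 * R ≤ R := by nlinarith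
  have hsub := pcyl_half (x1, s) hρ.le hle
  refine (H h hW hw hM hM0 x1 s _ hρ (hsub.trans hO) l tl hl j).trans (mul_le_mul_of_nonneg_left ?_ (integral_nonneg fun t => abs_nonneg _))
  have hwW : wn W (pcyl (x1, s) R) ≤ n2 W := by
    refine Real.sqrt_le_sqrt (setIntegral_le_integral hW.integrable_sq (Eventually.of_forall fun z => sq_nonneg _))
  have hw2 : wn W (pcyl (x1, s) (q ^ 4 * R)) ≤ q ^ 9 * n2 W := hd.trans (by gcongr)
  have es : Real.sqrt ((q ^ 4 * R) ^ 5 * vb) = q ^ 10 * Real.sqrt (R ^ 5 * vb) := by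
    rw [show (q ^ 4 * R) ^ 5 * vb = (q ^ 10) ^ 2 * (R ^ 5 * vb) by ring, Real.sqrt_mul (by positivity), Real.sqrt_sq (by positivity)]
  rw [es]
  have hn := n2_nonneg W
  calc _ ≤ B * ((q ^ 4 * R)⁻¹ ^ 4 * (q ^ 10 * Real.sqrt (R ^ 5 * vb)) + M * (q ^ 4 * R)⁻¹ ^ 2) * (q ^ 9 * n2 W) := by
        gcongr
    _ = B * (R⁻¹ ^ 4 * Real.sqrt (R ^ 5 * vb) * q ^ 2 + M * R⁻¹ ^ 2) * n2 W * q := by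
        field_simp
    _ ≤ B * (R⁻¹ ^ 4 * Real.sqrt (R ^ 5 * vb) * 1 + M * R⁻¹ ^ 2) * n2 W * q := by
        gcongr
        exact pow_le_one₀ q0.le q1
    _ = _ := by ring

lemma phn_sm (ρ : ℝ) : ContDiff ℝ (⊤ : ℕ∞) (fun p : E3 × E3 => phn ρ p.1 p.2) := by
  unfold phn
  exact contDiff_const.mul (fk_TF.sm.comp (by fun_prop))
lemma phn_TF {ρ : ℝ} (hρ : 0 < ρ) (x1 : E3) : TF (phn ρ x1) := scal_TF fk_TF _ (inv_pos.2 hρ) x1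

lemma phn_l2 (ρ : ℝ) (x1 : E3) : ∫ x, phn ρ x1 x ^ 2 = ∫ x, phn ρ 0 x ^ 2 := by
  unfold phn
  rw [integral_sub_right_eq_self (fun x => (ρ⁻¹ ^ 3 * fk (ρ⁻¹ • x)) ^ 2) x1]
  simp

/-- the tested velocity at fixed time -/
def Gt (U : X4 → ℝ) (ρ : ℝ) (x1 : E3) (t : ℝ) : ℝ := ∫ x, U (x, t) * phn ρ x1 x

lemma Gt_meas0 {U : X4 → ℝ} (hU : Measurable U) {k : E3 × E3 → ℝ} (hk : Measurable k) : 
    Measurable (fun p : X4 => ∫ x, U (x, p.2) * k (p.1, x)) := by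
  have h1 : Measurable (fun p : X4 × E3 => U (p.2, p.1.2) * k (p.1.1, p.2)) := by
    have a1 : Measurable (fun p : X4 × E3 => (p.2, p.1.2)) := measurable_snd.prodMk (measurable_snd.comp measurable_fst)
    have a2 : Measurable (fun p : X4 × E3 => (p.1.1, p.2)) := (measurable_fst.comp measurable_fst).prodMk measurable_snd
    exact (hU.comp a1).mul (hk.comp a2)
  exact (h1.stronglyMeasurable.integral_prod_right').measurable

lemma Gt_meas {U : X4 → ℝ} (hU : Measurable U) (ρ : ℝ) : Measurable (fun p : X4 => Gt U ρ p.1 p.2) := 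
  Gt_meas0 hU (k := fun p : E3 × E3 => phn ρ p.1 p.2) (phn_sm ρ).continuous.measurable

lemma U_phn {U : X4 → ℝ} (hU : Integrable U) {ρ : ℝ} (hρ : 0 < ρ) (x1 : E3) : 
    Integrable (fun z : X4 => U z * phn ρ x1 z.1) ((volume : Measure E3).prod (volume : Measure ℝ)) := by
  obtain ⟨C, hC⟩ := (phn_TF hρ x1).bdd
  have : Integrable (fun z : X4 => U z * phn ρ x1 z.1) := 
    hU.mul_bdd (c := C) (((phn_TF hρ x1).cont.comp continuous_fst).aestronglyMeasurable) (Eventually.of_forall fun z => hC _)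
  exact this

lemma Gt_int {U : X4 → ℝ} (hU : Integrable U) {ρ : ℝ} (hρ : 0 < ρ) (x1 : E3) : Integrable (Gt U ρ x1) :=
  (U_phn hU hρ x1).integral_prod_right

lemma Gt_fub {U : X4 → ℝ} (hU : Integrable U) {ρ : ℝ} (hρ : 0 < ρ) (x1 : E3) {l : ℝ → ℝ} (hl : TF l) : 
    ∫ t, Gt U ρ x1 t * l t = ∫ z, U z * (phn ρ x1 z.1 * l z.2) := by
  obtain ⟨C, hC⟩ := hl.bdd
  have h1 : Integrable (fun z : X4 => U z * phn ρ x1 z.1 * l z.2) ((volume : Measure E3).prod (volume : Measure ℝ)) := 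
    (U_phn hU hρ x1).mul_bdd (c := C) ((hl.cont.comp continuous_snd).aestronglyMeasurable) (Eventually.of_forall fun z => hC _)
  have := integral_prod_symm _ h1
  have e : ∫ z, U z * (phn ρ x1 z.1 * l z.2) = ∫ z, U z * phn ρ x1 z.1 * l z.2 ∂((volume : Measure E3).prod (volume : Measure ℝ)) := by
    simp_rw [mul_assoc]; rfl
  rw [e, this]
  congr 1; funext t
  simp only [Gt]
  rw [← integral_mul_const]

lemma Gt_zero {V U : X4 → ℝ} (hVm : Measurable V) (hV : MemLp V 2 volume) (hUm : Measurable U) (hU : ∀ z, |U z| ≤ |V z|) {M : ℝ} (hM0 : 0 ≤ M)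
    (hM : ∀ᵐ t : ℝ, ∫ x, V (x, t) ^ 2 ≤ M ^ 2) {ρ : ℝ} (hρ : 0 < ρ) (x1 : E3) : 
    ∀ᵐ t : ℝ, |Gt U ρ x1 t| ≤ M * Real.sqrt (∫ x, phn ρ 0 x ^ 2) := by
  filter_upwards [hM, slice_L2 hVm hV] with t h1 h2
  have h3 : MemLp (fun x => U (x, t)) 2 volume := h2.mono (hUm.comp (by fun_prop)).aestronglyMeasurable (Eventually.of_forall fun x => hU _)
  refine abs_integral_le_integral_abs.trans ((cs2 h3 (phn_TF hρ x1).memLp).trans ?_)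
  rw [phn_l2]
  refine mul_le_mul_of_nonneg_right ?_ (Real.sqrt_nonneg _)
  rw [← Real.sqrt_sq hM0]
  refine Real.sqrt_le_sqrt (le_trans ?_ h1)
  exact integral_mono h3.integrable_sq h2.integrable_sq fun x => sq_le_sq.2 (hU _)

lemma vfin {U : X4 → ℝ} (hUm : Measurable U) (hU : Integrable U) {ρ : ℕ → ℝ} (hρ : ∀ n, 0 < ρ n) (hl : Tendsto ρ atTop (nhds 0)) {B : Set E3} {I : Set ℝ}
    (hB : MeasurableSet B) (hI : MeasurableSet I) {M : ℝ} (h : ∀ x1 ∈ B, ∀ᵐ t : ℝ, t ∈ I → ∀ n, |Gt U (ρ n) x1 t| ≤ M) : 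
    ∀ᵐ z : X4, z ∈ B ×ˢ I → |U z| ≤ M / |cf| := by
  have hv : (volume : Measure X4) = (volume : Measure E3).prod (volume : Measure ℝ) := rfl
  have hc : 0 < |cf| := abs_pos.2 cf_neg.ne
  have m1 : MeasurableSet {p : X4 | p.1 ∈ B → p.2 ∈ I → ∀ n, |Gt U (ρ n) p.1 p.2| ≤ M} := by
    have : {p : X4 | p.1 ∈ B → p.2 ∈ I → ∀ n, |Gt U (ρ n) p.1 p.2| ≤ M} = (B ×ˢ I)ᶜ ∪ ⋂ n, {p : X4 | |Gt U (ρ n) p.1 p.2| ≤ M} := by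
      ext p
      simp only [mem_ofPred_eq, mem_union, mem_compl_iff, mem_prod, mem_iInter]
      tauto
    rw [this]
    refine (hB.prod hI).compl.union (MeasurableSet.iInter fun n => ?_)
    exact measurableSet_le (Gt_meas hUm (ρ n)).abs measurable_const
  have m2 : MeasurableSet {p : X4 | p ∈ B ×ˢ I → |U p| ≤ M / |cf|} := by
    have : {p : X4 | p ∈ B ×ˢ I → |U p| ≤ M / |cf|} = (B ×ˢ I)ᶜ ∪ {p : X4 | |U p| ≤ M / |cf|} := by
      ext p
      simp only [mem_ofPred_eq, mem_union, mem_compl_iff]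
      tauto
    rw [this]
    exact (hB.prod hI).compl.union (measurableSet_le hUm.abs measurable_const)
  have h1 : ∀ᵐ x1 : E3, ∀ᵐ t : ℝ, x1 ∈ B → t ∈ I → ∀ n, |Gt U (ρ n) x1 t| ≤ M := by
    refine Eventually.of_forall fun x1 => ?_
    by_cases hx : x1 ∈ B
    · filter_upwards [h x1 hx] with t ht _ using ht
    · exact Eventually.of_forall fun t k => absurd k hx
  rw [Measure.ae_ae_comm m1] at h1
  have h2 : ∀ᵐ t : ℝ, Integrable (fun x => U (x, t)) := Integrable.prod_left_ae (show Integrable U ((volume : Measure E3).prod (volume : Measure ℝ)) from hU)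
  rw [hv, Measure.ae_prod_iff_ae_ae m2, Measure.ae_ae_comm (p := fun x t => (x, t) ∈ B ×ˢ I → |U (x, t)| ≤ M / |cf|) m2]
  filter_upwards [h1, h2] with t ht1 ht2
  filter_upwards [ht1, leb ht2 hρ hl] with x hx1 hx2 hx
  rw [le_div_iff₀ hc, mul_comm, ← abs_mul]
  exact le_of_tendsto hx2.abs (Eventually.of_forall fun n => hx1 hx.1 hx.2 n)

lemma geo {κ : ℝ} (h0 : 0 < κ) (h1 : κ ≤ 1/2) {C P : ℝ} (hC : 0 ≤ C) {g : ℕ → ℝ} (hg0 : |g 0| ≤ P) (hg : ∀ n, |g n - g (n + 1)| ≤ C * κ ^ n) (n : ℕ) : 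
    |g n| ≤ P + 2 * C := by
  have : ∀ n, |g n| ≤ P + 2 * C * (1 - κ ^ n) := by
    intro n
    induction n with
    | zero => simpa using hg0
    | succ k ih => 
      have h2 := hg k
      have hk : 0 ≤ C * κ ^ k := by positivity
      have h3 : |g (k + 1)| ≤ |g k| + |g k - g (k + 1)| := by
        rw [abs_sub_comm]
        have := abs_add_le (g k) (g (k + 1) - g k)
        simpa using this
      have h4 : C * κ ^ (k + 1) ≤ C * κ ^ k * (1/2) := by rw [pow_succ, ← mul_assoc]; exact mul_le_mul_of_nonneg_left h1 hk
      linarith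
  refine (this n).trans ?_
  have : 0 ≤ C * κ ^ n := by positivity
  linarith

lemma vmain {κ : ℝ} (h0 : 0 < κ) (h1 : κ ≤ 1/2) {O : Set X4} {V : Fin 3 → X4 → ℝ} {D : Fin 3 → Fin 3 → X4 → ℝ} {W : X4 → ℝ} {M : ℝ} (h : SolD O V D)
    (hVm : ∀ j, Measurable (V j)) (hW : MemLp W 2 volume) (hw : ∀ a b z, |ww D a b z| ≤ W z) (hM : ∀ j, ∀ᵐ t : ℝ, ∫ x, V j (x, t) ^ 2 ≤ M ^ 2) (hM0 : 0 ≤ M)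
    {z0 : X4} {r : ℝ} (hr : 0 < r) (hQ : pcyl z0 r ⊆ O) (hdec : ∀ z R, 0 < R → pcyl z R ⊆ pcyl z0 r → ∀ n : ℕ, 
      wn W (pcyl z ((κ^4) ^ n * R)) ≤ (κ ^ 9) ^ n * wn W (pcyl z R)) (j : Fin 3) : ∃ C, ∀ᵐ z : X4, z ∈ pcyl z0 (r / 2) → |V j z| ≤ C := by
  obtain ⟨B, hB, H⟩ := step2 h0 h1
  set R := r / 2 with hR
  have hR0 : 0 < R := by positivity
  set ρ : ℕ → ℝ := fun n => (κ ^ 4) ^ n * R with hρd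
  have hθ1 : κ ^ 4 < 1 := pow_lt_one₀ h0.le (by linarith) (by norm_num)
  have hρ : ∀ n, 0 < ρ n := fun n => by positivity
  have hρR : ∀ n, ρ n ≤ R := fun n => by
    have : (κ ^ 4) ^ n ≤ 1 := pow_le_one₀ (by positivity) hθ1.le
    show (κ ^ 4) ^ n * R ≤ R
    nlinarith
  have hl : Tendsto ρ atTop (nhds 0) := by
    simpa using (tendsto_pow_atTop_nhds_zero_of_lt_one (by positivity) hθ1).mul_const R
  have hS := (pcyl_open z0 r).measurableSet
  set U := (pcyl z0 r).indicator (V j) with hUd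
  have hUm : Measurable U := (hVm j).indicator hS
  have hUV : ∀ z, |U z| ≤ |V j z| := fun z => by
    by_cases hz : z ∈ pcyl z0 r <;> simp [hUd, hz]
  have hUi : Integrable U := by
    rw [hUd, integrable_indicator_iff hS]
    have hf : IsFiniteMeasure (volume.restrict (pcyl z0 r)) := ⟨by simpa using pcyl_fin z0 r⟩
    exact ((h.hV j).restrict _).integrable one_le_two
  set C := B * (R⁻¹ ^ 4 * Real.sqrt (R ^ 5 * vb) + M * R⁻¹ ^ 2) * n2 W with hC
  have hC0 : 0 ≤ C := by have := n2_nonneg W; positivity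
  have hR4 : r ^ 2 = 4 * R ^ 2 := by rw [hR]; ring
  set I := Ioo (z0.2 - R ^ 2) z0.2 with hI
  have hz := vfin (B := Metric.ball z0.1 R) (I := I) (M := M * Real.sqrt (∫ x, phn (ρ 0) 0 x ^ 2) + 2 * C) hUm hUi hρ hl Metric.isOpen_ball.measurableSet measurableSet_Ioo ?_
  · refine ⟨(M * Real.sqrt (∫ x, phn (ρ 0) 0 x ^ 2) + 2 * C) / |cf|, ?_⟩
    filter_upwards [hz] with z hz2 hz3
    have hz4 : z ∈ pcyl z0 r := pcyl_half z0 hR0.le (by linarith) hz3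
    have := hz2 hz3
    simp only [hUd] at this
    rwa [indicator_of_mem hz4] at this
  intro x1 hx1
  have hball : Metric.ball x1 R ⊆ Metric.ball z0.1 r := Metric.ball_subset_ball' (by
    have := Metric.mem_ball.1 hx1; linarith)
  have hn : ∀ n, ∀ᵐ t : ℝ, t ∈ I → |Gt U (ρ n) x1 t - Gt U (ρ (n + 1)) x1 t| ≤ C * κ ^ n := by
    intro n
    refine ae_bd ((Gt_int hUi (hρ n) x1).sub (Gt_int hUi (hρ (n + 1)) x1)) fun s hs => ?_
    set δ := min (ρ n ^ 2 / 2) (z0.2 - s) with hδ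
    have hδ0 : 0 < δ := lt_min (by have := hρ n; positivity) (by linarith [hs.2])
    have d1 : δ ≤ ρ n ^ 2 / 2 := min_le_left _ _
    have d2 : δ ≤ z0.2 - s := min_le_right _ _
    have hcyl : pcyl (x1, s + δ) R ⊆ pcyl z0 r := by
      refine prod_mono hball fun t ht => ⟨?_, ?_⟩
      · have := ht.1; have := hs.1; simp only at *; nlinarith
      · have := ht.2; simp only at *; linarith
    refine ⟨δ, hδ0, fun l tl l0 ls => ?_⟩
    have ls2 : tsupport l ⊆ Ioo (s + δ - ρ n ^ 2) (s + δ) := by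
      rw [Real.ball_eq_Ioo] at ls
      exact ls.trans (Ioo_subset_Ioo_left (by linarith))
    have key := H h hW hw hM hM0 x1 (s + δ) R hR0 (hcyl.trans hQ) (hdec _ _ hR0 hcyl) n l tl ls2 j
    have eabs : ∫ t, |l t| = ∫ t, l t := by simp_rw [abs_of_nonneg (l0 _)]
    rw [eabs] at key
    have e1 : ∫ t, (Gt U (ρ n) x1 - Gt U (ρ (n + 1)) x1) t * l t = (∫ z, U z * (phn (ρ n) x1 z.1 * l z.2)) - ∫ z, U z * (phn (ρ (n+1)) x1 z.1 * l z.2) := by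
      rw [← Gt_fub hUi (hρ n) x1 tl, ← Gt_fub hUi (hρ (n + 1)) x1 tl, ← integral_sub]
      · congr 1; funext t; simp only [Pi.sub_apply]; ring
      · exact (Gt_int hUi (hρ n) x1).mul_bdd tl.cont.aestronglyMeasurable (Eventually.of_forall tl.bdd.choose_spec)
      · exact (Gt_int hUi (hρ (n + 1)) x1).mul_bdd tl.cont.aestronglyMeasurable (Eventually.of_forall tl.bdd.choose_spec)
    have e2 : ∀ m, ∫ z, U z * (phn (ρ m) x1 z.1 * l z.2) = ∫ z, V j z * (phn (ρ m) x1 z.1 * l z.2) := by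
      intro m
      congr 1; funext z
      by_cases hz : z ∈ pcyl z0 r
      · rw [hUd, indicator_of_mem hz]
      · have : phn (ρ m) x1 z.1 * l z.2 = 0 := by
          by_cases hzx : z.1 ∈ Metric.ball x1 R
          · rw [image_eq_zero_of_notMem_tsupport (f := l), mul_zero]
            intro k
            apply hz
            apply hcyl
            refine ⟨hzx, ?_⟩
            have k2 := ls2 k
            refine ⟨lt_of_le_of_lt ?_ k2.1, k2.2⟩
            have := hρR n
            have := hρ n
            simp only
            nlinarith
          · rw [phn_zero (hρ m) (fun k => hzx (Metric.ball_subset_ball (hρR m) k)), zero_mul]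
        rw [this]; simp
    have i2 : ∀ m, Integrable (fun z : X4 => V j z * (phn (ρ m) x1 z.1 * l z.2)) := fun m => int_l2 (h.hV j) (prod_TF (phn_TF (hρ m) x1) tl).memLp
    rw [e1, e2, e2, ← integral_sub (i2 n) (i2 (n + 1))]
    calc _ = |∫ z, V j z * ((phn ((κ^4) ^ n * R) x1 z.1 - phn ((κ^4) ^ (n + 1) * R) x1 z.1) * l z.2)| := by
          congr 2; funext z; simp only [hρd]; ring
      _ ≤ _ := key
      _ = _ := by rw [hC]; ring
  have hz0 := Gt_zero (hVm j) (h.hV j) hUm hUV hM0 (hM j) (hρ 0) x1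
  filter_upwards [ae_all_iff.2 hn, hz0] with t h2 h3 ht n
  exact geo h0 h1 hC0 (g := fun n => Gt U (ρ n) x1 t) h3 (fun n => h2 n ht) n

lemma vec3_0 (a b c : ℝ) : vec3 a b c 0 = a := rfl
lemma vec3_1 (a b c : ℝ) : vec3 a b c 1 = b := rfl
lemma vec3_2 (a b c : ℝ) : vec3 a b c 2 = c := rfl

lemma comp_le (u : E3) (i : Fin 3) : |u i| ≤ ‖u‖ := by
  simpa using PiLp.norm_apply_le u i

lemma nsq3 (u : E3) : ‖u‖ ^ 2 = u 0 ^ 2 + u 1 ^ 2 + u 2 ^ 2 := by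
  rw [EuclideanSpace.norm_sq_eq, Fin.sum_univ_three]; simp

lemma n_le3 (u : E3) : ‖u‖ ≤ |u 0| + |u 1| + |u 2| := by
  refine abs_le_of_sq_le_sq' ?_ (by positivity) |>.2
  rw [nsq3, ← sq_abs (u 0), ← sq_abs (u 1), ← sq_abs (u 2)]
  nlinarith [abs_nonneg (u 0), abs_nonneg (u 1), abs_nonneg (u 2), mul_nonneg (abs_nonneg (u 0)) (abs_nonneg (u 1)), mul_nonneg (abs_nonneg (u 0)) (abs_nonneg (u 2)), mul_nonneg (abs_nonneg (u 1)) (abs_nonneg (u 2))]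

lemma cross_unit (u w : E3) (i : Fin 3) : |cross3 u w i| ≤ ‖w‖ * ‖cross3 u (unitd w)‖ := by
  have e : cross3 u w i = ‖w‖ * cross3 u (unitd w) i := by
    by_cases hw : w = 0
    · subst hw
      fin_cases i <;> simp [cross3, vec3]
    · have hn : ‖w‖ ≠ 0 := by simpa using hw
      fin_cases i <;> simp [cross3, vec3, unitd] <;> field_simp
  rw [e, abs_mul, abs_norm]
  exact mul_le_mul_of_nonneg_left (comp_le _ _) (norm_nonneg _)

def cW (O : Set X4) (Dv : X4 → Fin 3 → Fin 3 → ℝ) : X4 → ℝ := O.indicator fun z => ‖curlOf Dv z‖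

lemma ww_in {O : Set X4} {Dv : X4 → Fin 3 → Fin 3 → ℝ} {z : X4} (hz : z ∈ O) (a b : Fin 3) : ww (Dx O Dv) a b z = Dv z a b - Dv z b a := by
  simp [ww, Dx, hz]

lemma ww_out {O : Set X4} {Dv : X4 → Fin 3 → Fin 3 → ℝ} {z : X4} (hz : z ∉ O) (a b : Fin 3) : ww (Dx O Dv) a b z = 0 := by
  simp [ww, Dx, hz]

lemma cW_lo (O : Set X4) (Dv : X4 → Fin 3 → Fin 3 → ℝ) (a b : Fin 3) (z : X4) : |ww (Dx O Dv) a b z| ≤ cW O Dv z := by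
  by_cases hz : z ∈ O
  · rw [ww_in hz, cW, indicator_of_mem hz]
    have h0 : |Dv z 1 2 - Dv z 2 1| ≤ ‖curlOf Dv z‖ := comp_le (curlOf Dv z) 0
    have h1 : |Dv z 2 0 - Dv z 0 2| ≤ ‖curlOf Dv z‖ := comp_le (curlOf Dv z) 1
    have h2 : |Dv z 0 1 - Dv z 1 0| ≤ ‖curlOf Dv z‖ := comp_le (curlOf Dv z) 2
    have h0' := h0
    have h1' := h1
    have h2' := h2
    rw [abs_sub_comm] at h0' h1' h2'
    fin_cases a <;> fin_cases b <;> first | assumption | (simp)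
  · rw [ww_out hz, cW, indicator_of_notMem hz]; simp

lemma cW_hi (O : Set X4) (Dv : X4 → Fin 3 → Fin 3 → ℝ) (z : X4) : cW O Dv z ^ 2 ≤ ∑ a, ∑ b, ww (Dx O Dv) a b z ^ 2 := by
  by_cases hz : z ∈ O
  · simp only [ww_in hz]
    rw [cW, indicator_of_mem hz, nsq3]
    simp only [curlOf, vec3_0, vec3_1, vec3_2, Fin.sum_univ_three]
    nlinarith [sq_nonneg (Dv z 1 2 - Dv z 2 1), sq_nonneg (Dv z 2 0 - Dv z 0 2), sq_nonneg (Dv z 0 1 - Dv z 1 0)]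
  · simp [ww_out hz, cW, hz]

lemma curl_meas {Dv : X4 → Fin 3 → Fin 3 → ℝ} (h : Measurable Dv) : Measurable (curlOf Dv) := by
  have : ∀ i j, Measurable fun z => Dv z i j := fun i j => by fun_prop
  have h2 : Measurable fun z => (![Dv z 1 2 - Dv z 2 1, Dv z 2 0 - Dv z 0 2, Dv z 0 1 - Dv z 1 0] : Fin 3 → ℝ) := by
    refine measurable_pi_iff.2 fun i => ?_
    fin_cases i
    · exact (this 1 2).sub (this 2 1)
    · exact (this 2 0).sub (this 0 2)
    · exact (this 0 1).sub (this 1 0)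
  exact (MeasurableEquiv.toLp 2 (Fin 3 → ℝ)).measurable.comp h2

lemma cross_meas {u w : X4 → E3} (hu : Measurable u) (hw : Measurable w) : Measurable fun z => cross3 (u z) (w z) := by
  have a : ∀ i, Measurable fun z => u z i := fun i => by fun_prop
  have b : ∀ i, Measurable fun z => w z i := fun i => by fun_prop
  have h2 : Measurable fun z => (![u z 1 * w z 2 - u z 2 * w z 1, u z 2 * w z 0 - u z 0 * w z 2, u z 0 * w z 1 - u z 1 * w z 0] : Fin 3 → ℝ) := by
    refine measurable_pi_iff.2 fun i => ?_
    fin_cases i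
    · exact ((a 1).mul (b 2)).sub ((a 2).mul (b 1))
    · exact ((a 2).mul (b 0)).sub ((a 0).mul (b 2))
    · exact ((a 0).mul (b 1)).sub ((a 1).mul (b 0))
  exact (MeasurableEquiv.toLp 2 (Fin 3 → ℝ)).measurable.comp h2

lemma FF_bd {O : Set X4} {v : X4 → E3} {Dv : X4 → Fin 3 → Fin 3 → ℝ} {z : X4} (hz : z ∈ O) (i : Fin 3) :
    |FF (Vx O v) (Dx O Dv) i z| ≤ cW O Dv z * ‖cross3 (v z) (unitd (curlOf Dv z))‖ := by
  rw [cW, indicator_of_mem hz]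
  refine le_trans (le_of_eq ?_) (cross_unit (v z) (curlOf Dv z) i)
  rw [← abs_neg]
  congr 1
  simp only [FF, ww_in hz, Vx, indicator_of_mem hz, Fin.sum_univ_three]
  fin_cases i <;> simp [cross3, curlOf, vec3] <;> ring

lemma cW_L2 {Ω : Set E3} {T : ℝ} {v : X4 → E3} {Dv : X4 → Fin 3 → Fin 3 → ℝ} {p : X4 → ℝ} {v₀ : E3 → E3} (hΩ : IsOpen Ω) (h : IsSuitableWeakSolution Ω T v Dv p v₀) :
    Measurable (cW (Ω ×ˢ Ioo 0 T) Dv) ∧ MemLp (cW (Ω ×ˢ Ioo 0 T) Dv) 2 volume := by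
  have hm : Measurable (cW (Ω ×ˢ Ioo 0 T) Dv) := (curl_meas h.meas_Dv).norm.indicator (QT_meas hΩ h)
  refine ⟨hm, ?_⟩
  rw [memLp_two_iff_integrable_sq hm.aestronglyMeasurable]
  have hi : Integrable fun z => ∑ a, ∑ b, ww (Dx (Ω ×ˢ Ioo 0 T) Dv) a b z ^ 2 :=
    integrable_finsetSum _ fun a _ => integrable_finsetSum _ fun b _ => (ww_L2 (solD hΩ h) a b).integrable_sq
  refine hi.mono' (hm.pow_const 2).aestronglyMeasurable (Eventually.of_forall fun z => ?_)
  rw [Real.norm_of_nonneg (sq_nonneg _)]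
  exact cW_hi _ _ z

lemma g3_bd {f : X4 → E3} {z0 : X4} {r ε : ℝ} (h : mixedNorm f (Metric.ball z0.1 r) (z0.2 - r ^ 2) z0.2 3 ∞ ≤ ENNReal.ofReal ε) :
    ∀ᵐ t : ℝ, eLpNorm (fun x : E3 => (pcyl z0 r).indicator (fun z => ‖f z‖) (x, t)) 3 volume ≤ ENNReal.ofReal ε := by
  rw [mixedNorm, if_pos rfl] at h
  have h2 := ae_le_essSup (fun t => eLpNorm (fun x => f (x, t)) 3 (volume.restrict (Metric.ball z0.1 r))) (μ := volume.restrict (Ioo (z0.2 - r ^ 2) z0.2))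
  rw [ae_restrict_iff' measurableSet_Ioo] at h2
  filter_upwards [h2] with t ht
  by_cases hI : t ∈ Ioo (z0.2 - r ^ 2) z0.2
  · have e : (fun x : E3 => (pcyl z0 r).indicator (fun z => ‖f z‖) (x, t)) = (Metric.ball z0.1 r).indicator (fun x => ‖f (x, t)‖) := by
      funext x
      by_cases hx : x ∈ Metric.ball z0.1 r
      · have : (x, t) ∈ pcyl z0 r := ⟨hx, hI⟩
        rw [indicator_of_mem this, indicator_of_mem hx]
      · have : (x, t) ∉ pcyl z0 r := fun k => hx k.1
        rw [indicator_of_notMem this, indicator_of_notMem hx]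
    rw [e, eLpNorm_indicator_eq_eLpNorm_restrict Metric.isOpen_ball.measurableSet, eLpNorm_norm]
    exact (ht hI).trans h
  · have e : (fun x : E3 => (pcyl z0 r).indicator (fun z => ‖f z‖) (x, t)) = 0 := by
      funext x
      have : (x, t) ∉ pcyl z0 r := fun k => hI k.2
      rw [indicator_of_notMem this]; rfl
    rw [e]; simp

lemma M_ex {Ω : Set E3} {T : ℝ} {v : X4 → E3} {Dv : X4 → Fin 3 → Fin 3 → ℝ} {p : X4 → ℝ} {v₀ : E3 → E3} (hΩ : IsOpen Ω) (h : IsSuitableWeakSolution Ω T v Dv p v₀) :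
    ∃ M : ℝ, 0 ≤ M ∧ ∀ j, ∀ᵐ t : ℝ, ∫ x, Vx (Ω ×ˢ Ioo 0 T) v j (x, t) ^ 2 ≤ M ^ 2 := by
  have h1 := h.v_linf_l2
  rw [MemMixed, mixedNorm, if_pos rfl] at h1
  have h2 := ae_le_essSup (fun t => eLpNorm (fun x => v (x, t)) 2 (volume.restrict Ω)) (μ := volume.restrict (Ioo 0 T))
  rw [ae_restrict_iff' measurableSet_Ioo] at h2
  set A := essSup (fun t => eLpNorm (fun x => v (x, t)) 2 (volume.restrict Ω)) (volume.restrict (Ioo 0 T))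
  refine ⟨A.toReal, ENNReal.toReal_nonneg, fun j => ?_⟩
  filter_upwards [h2, slice_L2 (Vx_meas hΩ h j) (Vx_L2 hΩ h j)] with t ht hs
  by_cases hI : t ∈ Ioo 0 T
  · have e : (fun x : E3 => Vx (Ω ×ˢ Ioo 0 T) v j (x, t)) = Ω.indicator (fun x => v (x, t) j) := by
      funext x
      by_cases hx : x ∈ Ω
      · have : (x, t) ∈ Ω ×ˢ Ioo 0 T := ⟨hx, hI⟩
        rw [Vx, indicator_of_mem this, indicator_of_mem hx]
      · have : (x, t) ∉ Ω ×ˢ Ioo 0 T := fun k => hx k.1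
        rw [Vx, indicator_of_notMem this, indicator_of_notMem hx]
    have h3 := l2_eq hs
    have h4 : eLpNorm (fun x : E3 => Vx (Ω ×ˢ Ioo 0 T) v j (x, t)) 2 volume ≤ A := by
      rw [e, eLpNorm_indicator_eq_eLpNorm_restrict hΩ.measurableSet]
      refine le_trans (eLpNorm_mono fun x => ?_) (ht hI)
      exact comp_le _ _
    rw [h3, ENNReal.ofReal_le_iff_le_toReal h1.ne] at h4
    have h5 := Real.sq_sqrt (show 0 ≤ ∫ x, Vx (Ω ×ˢ Ioo 0 T) v j (x, t) ^ 2 from integral_nonneg fun x => sq_nonneg _)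
    rw [← h5]
    exact pow_le_pow_left₀ (Real.sqrt_nonneg _) h4 2
  · have e : ∀ x : E3, Vx (Ω ×ˢ Ioo 0 T) v j (x, t) = 0 := by
      intro x
      have : (x, t) ∉ Ω ×ˢ Ioo 0 T := fun k => hI k.2
      rw [Vx, indicator_of_notMem this]
    simp_rw [e]
    simp [sq_nonneg]

/-- **Theorem 1.1 (i)** (Chae, "Remarks on regularity conditions of the
Navier–Stokes equations"): there is an absolute constant `ε₀ > 0` such that
if `(v,p)` is a suitable weak solution of the Navier–Stokes equations in
`Q_T = Ω × (0,T)`, `z₀ ∈ Q_T`, the closure of `Q_{z₀,r}` is contained in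
`Q_T`, and `‖v × (ω/|ω|)‖_{L^{3,∞}_{x,t}(Q_{z₀,r})} ≤ ε₀` where `ω = curl v`,
then `z₀` is a regular point of `v`. -/
theorem velocity_cross_vorticity_direction_small_L3_linfty_implies_regular :
    ∃ ε₀ : ℝ, 0 < ε₀ ∧
      ∀ (Ω : Set E3) (T : ℝ) (v : E3 × ℝ → E3) (Dv : E3 × ℝ → Fin 3 → Fin 3 → ℝ)
        (p : E3 × ℝ → ℝ) (v₀ : E3 → E3) (z₀ : E3 × ℝ) (r : ℝ),
        IsOpen Ω → 0 < T →
        IsSuitableWeakSolution Ω T v Dv p v₀ →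
        z₀ ∈ Ω ×ˢ Ioo 0 T → 0 < r →
        closure (pcyl z₀ r) ⊆ Ω ×ˢ Ioo 0 T →
        mixedNorm (fun z => cross3 (v z) (unitd (curlOf Dv z)))
            (Metric.ball z₀.1 r) (z₀.2 - r ^ 2) z₀.2 3 ∞
          ≤ ENNReal.ofReal ε₀ →
        RegularPoint Ω T v z₀ := by
  obtain ⟨κ, ε₀, h0, h1, he, H⟩ := dec3
  refine ⟨ε₀, he, ?_⟩
  intro Ω T v Dv p v₀ z₀ r hΩ _ h _ hr hcl hsm
  have hQ : pcyl z₀ r ⊆ Ω ×ˢ Ioo 0 T := subset_closure.trans hcl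
  have hS := solD hΩ h
  obtain ⟨hWm, hW2⟩ := cW_L2 hΩ h
  have hun : Measurable fun z => unitd (curlOf Dv z) := by
    have := curl_meas h.meas_Dv
    exact this.norm.inv.smul this
  have sm : Smal (pcyl z₀ r) ε₀ (FF (Vx (Ω ×ˢ Ioo 0 T) v) (Dx (Ω ×ˢ Ioo 0 T) Dv)) (cW (Ω ×ˢ Ioo 0 T) Dv)
      ((pcyl z₀ r).indicator fun z => ‖cross3 (v z) (unitd (curlOf Dv z))‖) :=
    { mW := hWm
      W2 := hW2
      W0 := fun z => indicator_nonneg (fun _ _ => norm_nonneg _) z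
      mg := (cross_meas h.meas_v hun).norm.indicator (pcyl_open z₀ r).measurableSet
      he := he.le
      g3 := g3_bd hsm
      Fb := fun i z hz => by
        rw [indicator_of_mem hz]
        exact FF_bd (hQ hz) i }
  obtain ⟨M, hM0, hM⟩ := M_ex hΩ h
  have key := vmain h0 h1 hS (Vx_meas hΩ h) hW2 (cW_lo _ Dv) hM hM0 hr hQ
    (fun z R hR hz n => H hS sm (cW_lo _ Dv) (cW_hi _ Dv) z R hR (hz.trans hQ) hz n)
  choose C hC using key
  have hh : pcyl z₀ (r / 2) ⊆ Ω ×ˢ Ioo 0 T := (pcyl_half z₀ (by positivity) (by linarith)).trans hQ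
  refine ⟨r / 2, by positivity, hh, C 0 + C 1 + C 2, ?_⟩
  rw [ae_restrict_iff' (pcyl_open z₀ _).measurableSet]
  filter_upwards [hC 0, hC 1, hC 2] with z c0 c1 c2 hz
  have k0 := c0 hz
  have k1 := c1 hz
  have k2 := c2 hz
  simp only [Vx, indicator_of_mem (hh hz)] at k0 k1 k2
  exact (n_le3 (v z)).trans (by linarith)

end
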